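/- arXiv:1301.1613 — 5 statements merged into one kernel-verified Lean document; each statement's English description precedes it below -/
import Mathlib

section
/- Let u : ℝ² → ℝ be continuously differentiable with ∇u ℤ²-periodic and ⟨∇u⟩ ≠ 0, and suppose there exists an infinitely differentiable, ℤ²-periodic, symmetric matrix-valued σ : ℝ² → ℝ^{2×2}, pointwise positive definite, with div(σ∇u) = 0 in the sense of distributions on ℝ². Then there exists a continuously differentiable function v : ℝ² → ℝ with ∇v ℤ²-periodic and ⟨∇v⟩ ≠ 0 such that det(∇u(x), ∇v(x)) = R⊥∇u(x) · ∇v(x) > 0 for every x ∈ ℝ². (Theorem 2.2, necessity.) -/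
open MeasureTheory

namespace PeriodicPlane

open Set

/-- The closed unit square. -/
def unitSquare : Set (ℝ × ℝ) := Icc 0 1 ×ˢ Icc 0 1

/-- A function on the plane is `ℤ²`-periodic. -/
def IsPeriodic {α : Type*} (f : ℝ × ℝ → α) : Prop :=
  ∀ (z : ℝ × ℝ) (k l : ℤ), f (z.1 + k, z.2 + l) = f z

/-- Partial derivative in the first variable. -/
noncomputable def pdx (f : ℝ × ℝ → ℝ) (z : ℝ × ℝ) : ℝ := fderiv ℝ f z (1, 0)

/-- Partial derivative in the second variable. -/
noncomputable def pdy (f : ℝ × ℝ → ℝ) (z : ℝ × ℝ) : ℝ := fderiv ℝ f z (0, 1)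

lemma isCompact_unitSquare : IsCompact unitSquare := isCompact_Icc.prod isCompact_Icc

lemma measurableSet_unitSquare : MeasurableSet unitSquare :=
  isCompact_unitSquare.isClosed.measurableSet

lemma integrableOn_unitSquare {f : ℝ × ℝ → ℝ} (hf : Continuous f) :
    IntegrableOn f unitSquare :=
  hf.continuousOn.integrableOn_compact isCompact_unitSquare

lemma setIntegral_unitSquare_mono {f g : ℝ × ℝ → ℝ} (hf : Continuous f) (hg : Continuous g)
    (h : ∀ z ∈ unitSquare, f z ≤ g z) : ∫ z in unitSquare, f z ≤ ∫ z in unitSquare, g z :=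
  setIntegral_mono_on (integrableOn_unitSquare hf) (integrableOn_unitSquare hg)
    measurableSet_unitSquare h

lemma volume_unitSquare : volume.real unitSquare = 1 := by
  rw [unitSquare, measureReal_def, Measure.volume_eq_prod, Measure.prod_prod]
  simp

lemma exists_int_shift_mem_unitSquare (z : ℝ × ℝ) :
    ∃ k l : ℤ, (z.1 + k, z.2 + l) ∈ unitSquare := by
  refine ⟨-⌊z.1⌋, -⌊z.2⌋, ?_⟩
  simp only [unitSquare, mem_prod, mem_Icc]
  push_cast
  refine ⟨⟨?_, ?_⟩, ?_, ?_⟩ <;>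
    linarith [Int.floor_le z.1, Int.floor_le z.2, Int.lt_floor_add_one z.1,
      Int.lt_floor_add_one z.2]

lemma contDiff_pdx {f : ℝ × ℝ → ℝ} {n m : WithTop ℕ∞} (hf : ContDiff ℝ n f) (h : m + 1 ≤ n) :
    ContDiff ℝ m (pdx f) :=
  (hf.fderiv_right h).clm_apply contDiff_const

lemma contDiff_pdy {f : ℝ × ℝ → ℝ} {n m : WithTop ℕ∞} (hf : ContDiff ℝ n f) (h : m + 1 ≤ n) :
    ContDiff ℝ m (pdy f) :=
  (hf.fderiv_right h).clm_apply contDiff_const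

lemma continuous_pdx {f : ℝ × ℝ → ℝ} (hf : ContDiff ℝ 1 f) : Continuous (pdx f) :=
  (contDiff_pdx (m := 0) hf (by simp)).continuous

lemma continuous_pdy {f : ℝ × ℝ → ℝ} (hf : ContDiff ℝ 1 f) : Continuous (pdy f) :=
  (contDiff_pdy (m := 0) hf (by simp)).continuous

lemma IsPeriodic.fderiv {f : ℝ × ℝ → ℝ} (hf : IsPeriodic f) : IsPeriodic (fderiv ℝ f) := by
  intro z k l
  have h : f = fun w => f (w + ((k : ℝ), (l : ℝ))) := by
    ext w; exact (hf w k l).symm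
  conv_rhs => rw [h]
  rw [fderiv_comp_add_right]
  rfl

lemma IsPeriodic.pdx {f : ℝ × ℝ → ℝ} (hf : IsPeriodic f) : IsPeriodic (pdx f) := fun z k l => by
  simp only [PeriodicPlane.pdx, hf.fderiv z k l]

lemma IsPeriodic.pdy {f : ℝ × ℝ → ℝ} (hf : IsPeriodic f) : IsPeriodic (pdy f) := fun z k l => by
  simp only [PeriodicPlane.pdy, hf.fderiv z k l]

lemma hasDerivAt_pdx {f : ℝ × ℝ → ℝ} (hf : Differentiable ℝ f) (x y : ℝ) :
    HasDerivAt (fun t => f (t, y)) (pdx f (x, y)) x := by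
  have := (hf (x, y)).hasFDerivAt.comp_hasDerivAt x
    ((hasDerivAt_id x).prodMk (hasDerivAt_const x y))
  exact this

lemma hasDerivAt_pdy {f : ℝ × ℝ → ℝ} (hf : Differentiable ℝ f) (x y : ℝ) :
    HasDerivAt (fun t => f (x, t)) (pdy f (x, y)) y := by
  have := (hf (x, y)).hasFDerivAt.comp_hasDerivAt y
    ((hasDerivAt_const y x).prodMk (hasDerivAt_id y))
  exact this

lemma pdx_mul {f g : ℝ × ℝ → ℝ} {z : ℝ × ℝ} (hf : DifferentiableAt ℝ f z)
    (hg : DifferentiableAt ℝ g z) :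
    pdx (fun w => f w * g w) z = pdx f z * g z + f z * pdx g z := by
  simp only [pdx]
  rw [fderiv_fun_mul hf hg]
  simp; ring

lemma pdy_mul {f g : ℝ × ℝ → ℝ} {z : ℝ × ℝ} (hf : DifferentiableAt ℝ f z)
    (hg : DifferentiableAt ℝ g z) :
    pdy (fun w => f w * g w) z = pdy f z * g z + f z * pdy g z := by
  simp only [pdy]
  rw [fderiv_fun_mul hf hg]
  simp; ring

lemma pdx_comp {f : ℝ × ℝ → ℝ} {φ : ℝ → ℝ} {d : ℝ} {z : ℝ × ℝ} (hφ : HasDerivAt φ d (f z))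
    (hf : DifferentiableAt ℝ f z) : pdx (fun w => φ (f w)) z = d * pdx f z := by
  have := (hφ.comp_hasFDerivAt z hf.hasFDerivAt).fderiv
  simp only [pdx, Function.comp_def] at this ⊢
  rw [this]; simp

lemma pdy_comp {f : ℝ × ℝ → ℝ} {φ : ℝ → ℝ} {d : ℝ} {z : ℝ × ℝ} (hφ : HasDerivAt φ d (f z))
    (hf : DifferentiableAt ℝ f z) : pdy (fun w => φ (f w)) z = d * pdy f z := by
  have := (hφ.comp_hasFDerivAt z hf.hasFDerivAt).fderiv
  simp only [pdy, Function.comp_def] at this ⊢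
  rw [this]; simp

lemma pdx_pdy_comm {f : ℝ × ℝ → ℝ} (hf : ContDiff ℝ 2 f) (z : ℝ × ℝ) :
    pdx (pdy f) z = pdy (pdx f) z := by
  have hd : DifferentiableAt ℝ (_root_.fderiv ℝ f) z :=
    ((hf.fderiv_right (m := 1) (by norm_num)).differentiable (by norm_num)) z
  have hs : IsSymmSndFDerivAt ℝ f z :=
    hf.contDiffAt.isSymmSndFDerivAt (by simp)
  have key : ∀ v w : ℝ × ℝ, _root_.fderiv ℝ (fun y => _root_.fderiv ℝ f y v) z w
      = _root_.fderiv ℝ (_root_.fderiv ℝ f) z w v := by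
    intro v w
    rw [fderiv_clm_apply hd (differentiableAt_const v)]
    simp
  show _root_.fderiv ℝ (fun y => _root_.fderiv ℝ f y (0, 1)) z (1, 0)
    = _root_.fderiv ℝ (fun y => _root_.fderiv ℝ f y (1, 0)) z (0, 1)
  rw [key, key]
  exact hs _ _

/-- The divergence of a periodic vector field has zero average. -/
lemma integral_div_eq_zero {P R : ℝ × ℝ → ℝ} (hP : ContDiff ℝ 1 P) (hR : ContDiff ℝ 1 R)
    (hPp : IsPeriodic P) (hRp : IsPeriodic R) :
    ∫ z in unitSquare, (pdx P z + pdy R z) = 0 := by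
  have hQ : unitSquare = Icc ((0 : ℝ), (0 : ℝ)) (1, 1) := by
    rw [unitSquare, Icc_prod_Icc]
  have hc : Continuous fun z => pdx P z + pdy R z := (continuous_pdx hP).add (continuous_pdy hR)
  have h := integral_divergence_prod_Icc_of_hasFDerivAt_of_le P R (_root_.fderiv ℝ P)
    (_root_.fderiv ℝ R)
    (0, 0) (1, 1) (by simp) hP.continuous.continuousOn hR.continuous.continuousOn
    (fun x _ => ((hP.differentiable (by norm_num)) x).hasFDerivAt)
    (fun x _ => ((hR.differentiable (by norm_num)) x).hasFDerivAt)
    (by rw [← hQ]; exact integrableOn_unitSquare hc)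
  rw [hQ]
  simp only [pdx, pdy]
  rw [h]
  have h1 : ∀ x, R (x, 1) = R (x, 0) := fun x => by simpa using hRp (x, 0) 0 1
  have h2 : ∀ y, P (1, y) = P (0, y) := fun y => by simpa using hPp (0, y) 1 0
  simp [h1, h2]

/-- The Jacobian determinant of a pair of functions. -/
noncomputable def jac (P R : ℝ × ℝ → ℝ) (z : ℝ × ℝ) : ℝ :=
  pdx P z * pdy R z - pdy P z * pdx R z

lemma continuous_jac {P R : ℝ × ℝ → ℝ} (hP : ContDiff ℝ 1 P) (hR : ContDiff ℝ 1 R) :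
    Continuous (jac P R) :=
  ((continuous_pdx hP).mul (continuous_pdy hR)).sub ((continuous_pdy hP).mul (continuous_pdx hR))

/-- The Jacobian is a null Lagrangian. -/
lemma integral_jac_eq_zero {P R : ℝ × ℝ → ℝ} (hP : ContDiff ℝ 2 P) (hR : ContDiff ℝ 2 R)
    (hPp : IsPeriodic P) (hRp : IsPeriodic R) :
    ∫ z in unitSquare, jac P R z = 0 := by
  have hP1 : ContDiff ℝ 1 P := hP.of_le (by norm_num)
  have hRx : ContDiff ℝ 1 (pdx R) := contDiff_pdx hR (by norm_num)
  have hRy : ContDiff ℝ 1 (pdy R) := contDiff_pdy hR (by norm_num)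
  have h := integral_div_eq_zero (P := fun z => P z * pdy R z) (R := fun z => (-P z) * pdx R z)
    (hP1.mul hRy) (hP1.neg.mul hRx)
    (fun z k l => by simp only [hPp z k l, hRp.pdy z k l])
    (fun z k l => by simp only [hPp z k l, hRp.pdx z k l])
  rw [← h]
  congr 1 with z
  have d1 := (hP1.differentiable (by norm_num)) z
  have d2 := (hRx.differentiable (by norm_num)) z
  have d3 := (hRy.differentiable (by norm_num)) z
  rw [pdx_mul d1 d3, pdy_mul d1.fun_neg d2, pdx_pdy_comm hR]
  have : pdy (fun w => -P w) z = - pdy P z := by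
    simp only [pdy]; rw [fderiv_fun_neg]; rfl
  rw [this, jac]; ring

/-- The map `(a, b)` from the torus to the plane has degree zero. -/
lemma integral_normSq_pow_mul_jac {a b : ℝ × ℝ → ℝ} (ha : ContDiff ℝ 2 a) (hb : ContDiff ℝ 2 b)
    (hap : IsPeriodic a) (hbp : IsPeriodic b) (n : ℕ) :
    ∫ z in unitSquare, (a z ^ 2 + b z ^ 2) ^ n * jac a b z = 0 := by
  set t : ℝ × ℝ → ℝ := fun z => a z ^ 2 + b z ^ 2 with ht
  have htc : ContDiff ℝ 2 t := (ha.pow 2).add (hb.pow 2)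
  have htn : ContDiff ℝ 2 fun z => t z ^ n := htc.pow n
  have htp : IsPeriodic fun z => t z ^ n := fun z k l => by simp only [ht, hap z k l, hbp z k l]
  have h1 := integral_jac_eq_zero (P := fun z => t z ^ n * a z) (R := b) (htn.mul ha) hb
    (fun z k l => by simp only [htp z k l, hap z k l]) hbp
  have h2 := integral_jac_eq_zero (P := a) (R := fun z => t z ^ n * b z) ha (htn.mul hb) hap
    (fun z k l => by simp only [htp z k l, hbp z k l])
  have c1 : Continuous (jac (fun z => t z ^ n * a z) b) :=
    continuous_jac ((htn.mul ha).of_le (by norm_num)) (hb.of_le (by norm_num))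
  have c2 : Continuous (jac a (fun z => t z ^ n * b z)) :=
    continuous_jac (ha.of_le (by norm_num)) ((htn.mul hb).of_le (by norm_num))
  have key : ∀ z, (2 * n + 2) * (t z ^ n * jac a b z)
      = jac (fun z => t z ^ n * a z) b z + jac a (fun z => t z ^ n * b z) z := by
    intro z
    have da := (ha.differentiable (by norm_num)) z
    have db := (hb.differentiable (by norm_num)) z
    have dt := (htc.differentiable (by norm_num)) z
    have dn := (htn.differentiable (by norm_num)) z
    have da2 : DifferentiableAt ℝ (fun w => a w ^ 2) z := da.pow 2
    have db2 : DifferentiableAt ℝ (fun w => b w ^ 2) z := db.pow 2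
    have tx : pdx t z = 2 * a z * pdx a z + 2 * b z * pdx b z := by
      have e1 := pdx_comp (φ := fun s => s ^ 2) (by simpa using hasDerivAt_pow 2 (a z)) da
      have e2 := pdx_comp (φ := fun s => s ^ 2) (by simpa using hasDerivAt_pow 2 (b z)) db
      rw [← e1, ← e2]
      simp only [pdx, ht]
      rw [fderiv_fun_add da2 db2]; rfl
    have ty : pdy t z = 2 * a z * pdy a z + 2 * b z * pdy b z := by
      have e1 := pdy_comp (φ := fun s => s ^ 2) (by simpa using hasDerivAt_pow 2 (a z)) da
      have e2 := pdy_comp (φ := fun s => s ^ 2) (by simpa using hasDerivAt_pow 2 (b z)) db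
      rw [← e1, ← e2]
      simp only [pdy, ht]
      rw [fderiv_fun_add da2 db2]; rfl
    simp only [jac]
    rw [pdx_mul dn da, pdy_mul dn da, pdx_mul dn db, pdy_mul dn db,
      pdx_comp (φ := fun s => s ^ n) (hasDerivAt_pow n (t z)) dt,
      pdy_comp (φ := fun s => s ^ n) (hasDerivAt_pow n (t z)) dt, tx, ty]
    have hpow : (n : ℝ) * t z ^ n = n * t z ^ (n - 1) * (a z ^ 2 + b z ^ 2) := by
      rcases n with _ | m
      · simp
      · simp only [Nat.add_sub_cancel, pow_succ, ht]; ring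
    linear_combination (2 * (pdx a z * pdy b z - pdy a z * pdx b z)) * hpow
  have h3 : ∫ z in unitSquare, (2 * n + 2) * (t z ^ n * jac a b z) = 0 := by
    simp_rw [key]
    rw [integral_add (integrableOn_unitSquare c1) (integrableOn_unitSquare c2), h1, h2, add_zero]
  rw [integral_const_mul] at h3
  rcases mul_eq_zero.1 h3 with h | h
  · exact absurd h (by positivity : (2 * (n : ℝ) + 2) ≠ 0)
  · exact h

lemma integral_comp_normSq_mul_jac {a b : ℝ × ℝ → ℝ} (ha : ContDiff ℝ 2 a) (hb : ContDiff ℝ 2 b)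
    (hap : IsPeriodic a) (hbp : IsPeriodic b) {G : ℝ → ℝ} (hG : ContinuousOn G (Ici 0)) :
    ∫ z in unitSquare, G (a z ^ 2 + b z ^ 2) * jac a b z = 0 := by
  have ha1 : ContDiff ℝ 1 a := ha.of_le (by norm_num)
  have hb1 : ContDiff ℝ 1 b := hb.of_le (by norm_num)
  set t : ℝ × ℝ → ℝ := fun z => a z ^ 2 + b z ^ 2 with ht
  have htc : Continuous t := by have := ha.continuous; have := hb.continuous; fun_prop
  have hJ := continuous_jac ha1 hb1
  have hGt : Continuous fun z => G (t z) :=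
    hG.comp_continuous htc (fun z => by simp only [ht, mem_Ici]; positivity)
  have hpoly : ∀ p : Polynomial ℝ, ∫ z in unitSquare, p.eval (t z) * jac a b z = 0 := by
    intro p
    simp_rw [Polynomial.eval_eq_sum_range, Finset.sum_mul]
    rw [integral_finsetSum]
    · refine Finset.sum_eq_zero fun n _ => ?_
      simp_rw [mul_assoc]
      rw [integral_const_mul, integral_normSq_pow_mul_jac ha hb hap hbp n, mul_zero]
    · intro n _
      exact integrableOn_unitSquare (by fun_prop)
  obtain ⟨M, hM⟩ := (isCompact_unitSquare.image htc).bddAbove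
  have hJi : IntegrableOn (fun z => |jac a b z|) unitSquare := integrableOn_unitSquare hJ.abs
  set K := ∫ z in unitSquare, |jac a b z| with hK
  have hK0 : 0 ≤ K := integral_nonneg fun _ => abs_nonneg _
  have hb' : ∀ ε > 0, |∫ z in unitSquare, G (t z) * jac a b z| ≤ ε * K := by
    intro ε hε
    obtain ⟨p, hp⟩ := exists_polynomial_near_of_continuousOn 0 M G
      (hG.mono fun x hx => hx.1) ε hε
    have : ∫ z in unitSquare, G (t z) * jac a b z
        = ∫ z in unitSquare, (G (t z) - p.eval (t z)) * jac a b z := by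
      simp_rw [sub_mul]
      rw [integral_sub, hpoly, sub_zero]
      · exact integrableOn_unitSquare (hGt.mul hJ)
      · exact integrableOn_unitSquare (by fun_prop)
    rw [this, hK, ← integral_const_mul]
    refine (abs_integral_le_integral_abs).trans ?_
    refine setIntegral_unitSquare_mono
      ((hGt.sub (by fun_prop : Continuous fun z => p.eval (t z))).mul hJ).abs (by fun_prop)
      fun z hz => ?_
    rw [abs_mul]
    refine mul_le_mul_of_nonneg_right ?_ (abs_nonneg _)
    rw [abs_sub_comm]
    exact (hp _ ⟨by simp only [ht]; positivity, hM (mem_image_of_mem t hz)⟩).le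
  by_contra hne
  have hpos := abs_pos.2 hne
  have := hb' (|∫ z in unitSquare, G (t z) * jac a b z| / (2 * (K + 1))) (by positivity)
  rw [div_mul_eq_mul_div, le_div_iff₀ (by positivity)] at this
  nlinarith

lemma integral_slices_snd {g : ℝ × ℝ → ℝ} (hg : Continuous g) :
    ∫ x in Icc (0 : ℝ) 1, ∫ y in Icc (0 : ℝ) 1, g (x, y) = ∫ z in unitSquare, g z := by
  rw [unitSquare, Measure.volume_eq_prod, setIntegral_prod]
  exact integrableOn_unitSquare hg

lemma integral_slices_fst {g : ℝ × ℝ → ℝ} (hg : Continuous g) :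
    ∫ y in Icc (0 : ℝ) 1, ∫ x in Icc (0 : ℝ) 1, g (x, y) = ∫ z in unitSquare, g z := by
  rw [← integral_slices_snd hg]
  refine integral_integral_swap (μ := volume.restrict (Icc (0 : ℝ) 1))
    (ν := volume.restrict (Icc (0 : ℝ) 1)) (f := fun y x => g (x, y)) ?_
  rw [Measure.prod_restrict]
  exact (hg.comp continuous_swap).continuousOn.integrableOn_compact
    (isCompact_Icc.prod isCompact_Icc)

lemma abs_sub_le_integral_abs_deriv {f f' : ℝ → ℝ} (hf : ∀ t, HasDerivAt f (f' t) t)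
    (hf' : Continuous f') {x t : ℝ} (hx : x ∈ Icc (0 : ℝ) 1) (ht : t ∈ Icc (0 : ℝ) 1) :
    |f x - f t| ≤ ∫ s in Icc (0 : ℝ) 1, |f' s| := by
  rw [← intervalIntegral.integral_eq_sub_of_hasDerivAt (fun s _ => hf s)
    (hf'.intervalIntegrable t x), ← Real.norm_eq_abs]
  refine (intervalIntegral.norm_integral_le_integral_norm_uIoc).trans ?_
  refine setIntegral_mono_set (hf'.norm.continuousOn.integrableOn_compact isCompact_Icc)
    (Filter.Eventually.of_forall fun _ => norm_nonneg _) ?_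
  refine Filter.Eventually.of_forall fun s hs => ?_
  exact uIcc_subset_Icc ht hx (uIoc_subset_uIcc hs)

lemma le_integral_add_integral_abs_deriv {f f' : ℝ → ℝ} (hf : ∀ t, HasDerivAt f (f' t) t)
    (hf' : Continuous f') {x : ℝ} (hx : x ∈ Icc (0 : ℝ) 1) :
    f x ≤ ∫ s in Icc (0 : ℝ) 1, (f s + |f' s|) := by
  have hfc : Continuous f := continuous_iff_continuousAt.2 fun t => (hf t).continuousAt
  have i1 : IntegrableOn f (Icc 0 1) := hfc.continuousOn.integrableOn_compact isCompact_Icc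
  have i2 : IntegrableOn (fun s => |f' s|) (Icc 0 1) :=
    hf'.abs.continuousOn.integrableOn_compact isCompact_Icc
  have h : ∀ t ∈ Icc (0 : ℝ) 1, f x - ∫ s in Icc (0 : ℝ) 1, |f' s| ≤ f t := fun t ht => by
    linarith [le_abs_self (f x - f t), abs_sub_le_integral_abs_deriv hf hf' hx ht]
  have := setIntegral_mono_on (integrableOn_const (by simp) (by simp)) i1 measurableSet_Icc h
  rw [integral_add i1 i2]
  simp at this
  linarith

lemma sq_sub_le_integral_sq_deriv {f f' : ℝ → ℝ} (hf : ∀ t, HasDerivAt f (f' t) t)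
    (hf' : Continuous f') {x t : ℝ} (hx : x ∈ Icc (0 : ℝ) 1) (ht : t ∈ Icc (0 : ℝ) 1) :
    (f x - f t) ^ 2 ≤ ∫ s in Icc (0 : ℝ) 1, f' s ^ 2 := by
  have h := abs_sub_le_integral_abs_deriv hf hf' hx ht
  set m := ∫ s in Icc (0 : ℝ) 1, |f' s| with hm
  have i1 : IntegrableOn (fun s => f' s ^ 2) (Icc 0 1) :=
    (hf'.pow 2).continuousOn.integrableOn_compact isCompact_Icc
  have i2 : IntegrableOn (fun s => |f' s|) (Icc 0 1) :=
    hf'.abs.continuousOn.integrableOn_compact isCompact_Icc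
  have h0 : 0 ≤ ∫ s in Icc (0 : ℝ) 1, (f' s ^ 2 - 2 * m * |f' s| + m ^ 2) := by
    refine integral_nonneg fun s => ?_
    have : f' s ^ 2 - 2 * m * |f' s| + m ^ 2 = (|f' s| - m) ^ 2 := by
      rw [← sq_abs (f' s)]; ring
    simp only [Pi.zero_apply]
    rw [this]; positivity
  have i3 : IntegrableOn (fun s => f' s ^ 2 - 2 * m * |f' s|) (Icc 0 1) :=
    i1.sub (i2.const_mul _)
  have i4 : IntegrableOn (fun _ : ℝ => m ^ 2) (Icc 0 1) :=
    continuousOn_const.integrableOn_compact isCompact_Icc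
  rw [integral_add i3 i4, integral_sub i1 (i2.const_mul _), integral_const_mul, ← hm] at h0
  simp at h0
  rw [← sq_abs]
  nlinarith [abs_nonneg (f x - f t)]

/-- A Ladyzhenskaya type inequality on the unit square. -/
lemma integral_pow_four_le {q : ℝ × ℝ → ℝ} (hq : ContDiff ℝ 1 q) {K : ℝ} (hK : 0 < K)
    (h : ∫ z in unitSquare, (pdx q z ^ 2 + pdy q z ^ 2) ≤ K ^ 2 * ∫ z in unitSquare, q z ^ 2) :
    ∫ z in unitSquare, q z ^ 4 ≤ (1 + 2 * K) ^ 2 * (∫ z in unitSquare, q z ^ 2) ^ 2 := by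
  have cq := hq.continuous
  have cx := continuous_pdx hq
  have cy := continuous_pdy hq
  have hd := hq.differentiable (by norm_num)
  set N := ∫ z in unitSquare, q z ^ 2 with hN
  have hN0 : 0 ≤ N := integral_nonneg fun _ => sq_nonneg _
  set A : ℝ → ℝ := fun y => ∫ t in Icc (0 : ℝ) 1, (q (t, y) ^ 2 + |2 * q (t, y) * pdx q (t, y)|)
  set B : ℝ → ℝ := fun x => ∫ t in Icc (0 : ℝ) 1, (q (x, t) ^ 2 + |2 * q (x, t) * pdy q (x, t)|)
  have hA : ∀ x ∈ Icc (0 : ℝ) 1, ∀ y, q (x, y) ^ 2 ≤ A y := fun x hx y => by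
    refine le_integral_add_integral_abs_deriv (f := fun t => q (t, y) ^ 2)
      (f' := fun t => 2 * q (t, y) * pdx q (t, y)) (fun t => ?_) (by fun_prop) hx
    simpa using (hasDerivAt_pdx hd t y).fun_pow 2
  have hB : ∀ x, ∀ y ∈ Icc (0 : ℝ) 1, q (x, y) ^ 2 ≤ B x := fun x y hy => by
    refine le_integral_add_integral_abs_deriv (f := fun t => q (x, t) ^ 2)
      (f' := fun t => 2 * q (x, t) * pdy q (x, t)) (fun t => ?_) (by fun_prop) hy
    simpa using (hasDerivAt_pdy hd x t).fun_pow 2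
  have cA : Continuous A := by
    refine continuous_parametric_integral_of_continuous
      (f := fun y t => q (t, y) ^ 2 + |2 * q (t, y) * pdx q (t, y)|) ?_ isCompact_Icc
    simp only [Function.uncurry_def]
    fun_prop
  have cB : Continuous B := by
    refine continuous_parametric_integral_of_continuous
      (f := fun x t => q (x, t) ^ 2 + |2 * q (x, t) * pdy q (x, t)|) ?_ isCompact_Icc
    simp only [Function.uncurry_def]
    fun_prop
  have bound : ∀ d : ℝ × ℝ → ℝ, Continuous d →
      (∀ z, d z ^ 2 ≤ pdx q z ^ 2 + pdy q z ^ 2) →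
      ∫ z in unitSquare, (q z ^ 2 + |2 * q z * d z|) ≤ (1 + 2 * K) * N := by
    intro d hdc hd2
    have i1 : IntegrableOn (fun z => q z ^ 2) unitSquare := integrableOn_unitSquare (by fun_prop)
    have i2 : IntegrableOn (fun z => pdx q z ^ 2 + pdy q z ^ 2) unitSquare :=
      integrableOn_unitSquare (by fun_prop)
    calc ∫ z in unitSquare, (q z ^ 2 + |2 * q z * d z|)
        ≤ ∫ z in unitSquare, ((1 + K) * q z ^ 2 + K⁻¹ * (pdx q z ^ 2 + pdy q z ^ 2)) := by
          refine setIntegral_unitSquare_mono (by fun_prop) (by fun_prop) fun z _ => ?_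
          have h1 : |2 * q z * d z| ≤ K * q z ^ 2 + K⁻¹ * d z ^ 2 := by
            have hk : K * K⁻¹ = 1 := mul_inv_cancel₀ hK.ne'
            have e1 : K * q z ^ 2 + K⁻¹ * d z ^ 2 - 2 * q z * d z
                = K * (q z - K⁻¹ * d z) ^ 2 := by
              linear_combination (2 * q z * d z - K⁻¹ * d z ^ 2) * hk
            have e2 : K * q z ^ 2 + K⁻¹ * d z ^ 2 + 2 * q z * d z
                = K * (q z + K⁻¹ * d z) ^ 2 := by
              linear_combination (-2 * q z * d z - K⁻¹ * d z ^ 2) * hk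
            have p1 : 0 ≤ K * (q z - K⁻¹ * d z) ^ 2 := by positivity
            have p2 : 0 ≤ K * (q z + K⁻¹ * d z) ^ 2 := by positivity
            rw [abs_le]; constructor <;> linarith
          have h2 : K⁻¹ * d z ^ 2 ≤ K⁻¹ * (pdx q z ^ 2 + pdy q z ^ 2) :=
            mul_le_mul_of_nonneg_left (hd2 z) (by positivity)
          linarith
      _ = (1 + K) * N + K⁻¹ * ∫ z in unitSquare, (pdx q z ^ 2 + pdy q z ^ 2) := by
          rw [integral_add (i1.const_mul _) (i2.const_mul _), integral_const_mul,
            integral_const_mul]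
      _ ≤ (1 + K) * N + K⁻¹ * (K ^ 2 * N) := by gcongr
      _ = (1 + 2 * K) * N := by field_simp; ring
  have hAi : ∫ y in Icc (0 : ℝ) 1, A y ≤ (1 + 2 * K) * N := by
    have := integral_slices_fst (g := fun z => q z ^ 2 + |2 * q z * pdx q z|) (by fun_prop)
    simp only [A]
    rw [this]
    exact bound _ cx fun z => by nlinarith [sq_nonneg (pdy q z)]
  have hBi : ∫ y in Icc (0 : ℝ) 1, B y ≤ (1 + 2 * K) * N := by
    have := integral_slices_snd (g := fun z => q z ^ 2 + |2 * q z * pdy q z|) (by fun_prop)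
    simp only [B]
    rw [this]
    exact bound _ cy fun z => by nlinarith [sq_nonneg (pdx q z)]
  have hA0 : 0 ≤ ∫ y in Icc (0 : ℝ) 1, A y :=
    integral_nonneg fun y => integral_nonneg fun t => by positivity
  calc ∫ z in unitSquare, q z ^ 4 ≤ ∫ z in unitSquare, B z.1 * A z.2 := by
        refine setIntegral_unitSquare_mono (by fun_prop) (by fun_prop) fun z hz => ?_
        have e1 := hA z.1 hz.1 z.2
        have e2 := hB z.1 z.2 hz.2
        have : q z ^ 4 = q z ^ 2 * q z ^ 2 := by ring
        rw [this]
        exact mul_le_mul e2 e1 (sq_nonneg _) ((sq_nonneg _).trans e2)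
    _ = (∫ x in Icc (0 : ℝ) 1, B x) * ∫ y in Icc (0 : ℝ) 1, A y := by
        rw [unitSquare, Measure.volume_eq_prod, setIntegral_prod_mul]
    _ ≤ ((1 + 2 * K) * N) * ((1 + 2 * K) * N) :=
        mul_le_mul hBi hAi hA0 (by positivity)
    _ = _ := by ring

/-- A Poincaré type inequality on the unit square for functions controlled on a segment. -/
lemma integral_sq_le_of_le_on_segment {q : ℝ × ℝ → ℝ} (hq : ContDiff ℝ 1 q) {K α β y₀ M : ℝ}
    (hα : 0 ≤ α) (hαβ : α < β) (hβ : β ≤ 1) (hy₀ : y₀ ∈ Icc (0 : ℝ) 1)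
    (hM : ∀ x ∈ Icc α β, q (x, y₀) ^ 2 ≤ M) (hK : 8 * K ^ 2 ≤ β - α)
    (h : ∫ z in unitSquare, (pdx q z ^ 2 + pdy q z ^ 2) ≤ K ^ 2 * ∫ z in unitSquare, q z ^ 2) :
    ∫ z in unitSquare, q z ^ 2 ≤ 4 * M := by
  have cq := hq.continuous
  have cx := continuous_pdx hq
  have cy := continuous_pdy hq
  have hd := hq.differentiable (by norm_num)
  set N := ∫ z in unitSquare, q z ^ 2 with hN
  have hN0 : 0 ≤ N := integral_nonneg fun _ => sq_nonneg _
  set A : ℝ → ℝ := fun y => ∫ t in Icc (0 : ℝ) 1, pdx q (t, y) ^ 2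
  set B : ℝ → ℝ := fun x => ∫ t in Icc (0 : ℝ) 1, pdy q (x, t) ^ 2
  have cA : Continuous A := by
    refine continuous_parametric_integral_of_continuous
      (f := fun y t => pdx q (t, y) ^ 2) ?_ isCompact_Icc
    simp only [Function.uncurry_def]
    fun_prop
  have cB : Continuous B := by
    refine continuous_parametric_integral_of_continuous
      (f := fun x t => pdy q (x, t) ^ 2) ?_ isCompact_Icc
    simp only [Function.uncurry_def]
    fun_prop
  have hAi : ∫ z in unitSquare, A z.2 = ∫ z in unitSquare, pdx q z ^ 2 := by
    rw [← integral_slices_snd (by fun_prop), ← integral_slices_fst (by fun_prop)]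
    simp [A]
  have hBi : ∫ x in Icc (0 : ℝ) 1, B x = ∫ z in unitSquare, pdy q z ^ 2 :=
    integral_slices_snd (g := fun z => pdy q z ^ 2) (by fun_prop)
  have hB0 : ∀ x, 0 ≤ B x := fun x => integral_nonneg fun t => sq_nonneg _
  have pt : ∀ z ∈ unitSquare, ∀ x' ∈ Icc α β, q z ^ 2 ≤ 2 * M + 4 * A z.2 + 4 * B x' := by
    intro z hz x' hx'
    have hx'' : x' ∈ Icc (0 : ℝ) 1 := ⟨hα.trans hx'.1, hx'.2.trans hβ⟩
    have e1 : (q (z.1, z.2) - q (x', z.2)) ^ 2 ≤ A z.2 :=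
      sq_sub_le_integral_sq_deriv (f := fun t => q (t, z.2)) (f' := fun t => pdx q (t, z.2))
        (fun t => hasDerivAt_pdx hd t z.2) (by fun_prop) hz.1 hx''
    have e2 : (q (x', z.2) - q (x', y₀)) ^ 2 ≤ B x' :=
      sq_sub_le_integral_sq_deriv (f := fun t => q (x', t)) (f' := fun t => pdy q (x', t))
        (fun t => hasDerivAt_pdy hd x' t) (by fun_prop) hz.2 hy₀
    have e3 := hM x' hx'
    have ez : q z = q (z.1, z.2) := rfl
    rw [ez]
    nlinarith [sq_nonneg (q (z.1, z.2) - 2 * q (x', y₀)),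
      sq_nonneg (q (z.1, z.2) - 2 * q (x', z.2) + q (x', y₀))]
  have pt2 : ∀ z ∈ unitSquare, (β - α) * q z ^ 2
      ≤ (β - α) * (2 * M) + (β - α) * 4 * A z.2 + 4 * ∫ z in unitSquare, pdy q z ^ 2 := by
    intro z hz
    have iB : IntegrableOn B (Icc 0 1) := cB.continuousOn.integrableOn_compact isCompact_Icc
    have iB' : IntegrableOn B (Icc α β) := cB.continuousOn.integrableOn_compact isCompact_Icc
    have ic : ∀ c : ℝ, IntegrableOn (fun _ : ℝ => c) (Icc α β) :=
      fun c => continuousOn_const.integrableOn_compact isCompact_Icc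
    have e := setIntegral_mono_on (ic _) ((ic (2 * M + 4 * A z.2)).add (iB'.const_mul 4))
      measurableSet_Icc (pt z hz)
    simp only [Pi.add_apply] at e
    rw [integral_add (ic _) (iB'.const_mul 4), integral_const_mul] at e
    simp [hαβ.le] at e
    have e' : ∫ x in Icc α β, B x ≤ ∫ x in Icc (0 : ℝ) 1, B x :=
      setIntegral_mono_set iB (Filter.Eventually.of_forall hB0)
        (Icc_subset_Icc hα hβ).eventuallyLE
    rw [hBi] at e'
    nlinarith
  have e := setIntegral_unitSquare_mono (by fun_prop) (by fun_prop) pt2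
  have i1 : IntegrableOn (fun z : ℝ × ℝ => (β - α) * 4 * A z.2) unitSquare :=
    integrableOn_unitSquare (by fun_prop)
  have ic : ∀ c : ℝ, IntegrableOn (fun _ : ℝ × ℝ => c) unitSquare :=
    fun c => integrableOn_unitSquare continuous_const
  have i2 : IntegrableOn (fun z : ℝ × ℝ => (β - α) * (2 * M) + (β - α) * 4 * A z.2) unitSquare :=
    integrableOn_unitSquare (by fun_prop)
  rw [integral_add i2 (ic _), integral_add (ic _) i1, integral_const_mul,
    integral_const_mul ((β - α) * 4), hAi, setIntegral_const, setIntegral_const,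
    volume_unitSquare, one_smul,
    one_smul, ← hN] at e
  rw [integral_add (integrableOn_unitSquare (by fun_prop))
    (integrableOn_unitSquare (by fun_prop))] at h
  have hx0 : 0 ≤ ∫ z in unitSquare, pdx q z ^ 2 := integral_nonneg fun _ => sq_nonneg _
  have hl : β - α ≤ 1 := by linarith
  have h1 : (β - α) * 4 * ∫ z in unitSquare, pdx q z ^ 2
      ≤ 4 * ∫ z in unitSquare, pdx q z ^ 2 := by nlinarith
  have h2 : (β - α) * N ≤ (β - α) * (2 * M) + (β - α) / 2 * N := by nlinarith
  have hpos : 0 < β - α := by linarith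
  have h3 : (β - α) * N ≤ (β - α) * (4 * M) := by linarith
  exact le_of_mul_le_mul_left h3 hpos

lemma le_of_forall_integral_pow_le {f : ℝ × ℝ → ℝ} (hf : Continuous f) (h0 : ∀ z, 0 ≤ f z)
    {B : ℝ} (hB : 0 < B)
    (h : ∀ k : ℕ, ∫ z in unitSquare, f z ^ (2 ^ k) ≤ B ^ (2 ^ k)) {z : ℝ × ℝ}
    (hz : z ∈ unitSquare) : f z ≤ B := by
  by_contra! hlt
  obtain ⟨B', hB1, hB2⟩ := exists_between hlt
  set V := {w | B' < f w} ∩ (Ioo (0 : ℝ) 1 ×ˢ Ioo (0 : ℝ) 1) with hV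
  have hVo : IsOpen V := (isOpen_lt continuous_const hf).inter (isOpen_Ioo.prod isOpen_Ioo)
  have hVn : V.Nonempty := by
    have hc : z ∈ closure (Ioo (0 : ℝ) 1 ×ˢ Ioo (0 : ℝ) 1) := by
      rw [closure_prod_eq, closure_Ioo (by norm_num)]; exact hz
    exact mem_closure_iff.1 hc _ (isOpen_lt continuous_const hf) hB2
  have hVs : V ⊆ unitSquare := fun w hw =>
    ⟨Ioo_subset_Icc_self hw.2.1, Ioo_subset_Icc_self hw.2.2⟩
  have hVfin : volume V ≠ ⊤ :=
    ((measure_mono hVs).trans_lt isCompact_unitSquare.measure_lt_top).ne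
  have hm : 0 < volume.real V :=
    ENNReal.toReal_pos (hVo.measure_pos volume hVn).ne' hVfin
  have key : ∀ k : ℕ, volume.real V * B' ^ (2 ^ k) ≤ B ^ (2 ^ k) := by
    intro k
    have i := integrableOn_unitSquare (hf.pow (2 ^ k))
    calc volume.real V * B' ^ (2 ^ k) = ∫ z in V, B' ^ (2 ^ k) := by
          rw [setIntegral_const]; rfl
      _ ≤ ∫ z in V, f z ^ (2 ^ k) :=
          setIntegral_mono_on (integrableOn_const hVfin (by simp)) (i.mono_set hVs)
            hVo.measurableSet fun w hw => pow_le_pow_left₀ (hB.trans hB1).le hw.1.le _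
      _ ≤ ∫ z in unitSquare, f z ^ (2 ^ k) :=
          setIntegral_mono_set i (Filter.Eventually.of_forall fun w => pow_nonneg (h0 w) _)
            hVs.eventuallyLE
      _ ≤ _ := h k
  have hB' : 0 < B' := hB.trans hB1
  have lim : Filter.Tendsto (fun k : ℕ => (B / B') ^ (2 ^ k)) Filter.atTop (nhds 0) :=
    (tendsto_pow_atTop_nhds_zero_of_lt_one (by positivity) ((div_lt_one hB').2 hB1)).comp
      (tendsto_pow_atTop_atTop_of_one_lt (by norm_num))
  have := ge_of_tendsto' lim (b := volume.real V) fun k => by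
    rw [div_pow, le_div_iff₀ (by positivity)]; exact key k
  linarith

/-- Energy inequality for the negative powers of the regularised squared modulus `a² + b² + κ²` of
a planar map `(a, b)` which is quasiregular up to a controlled error. -/
lemma integral_grad_rpow_le {a b : ℝ × ℝ → ℝ} (ha : ContDiff ℝ 2 a) (hb : ContDiff ℝ 2 b)
    (hap : IsPeriodic a) (hbp : IsPeriodic b) {κ M C : ℝ} (hκ : 0 < κ)
    (hquasi : ∀ z ∈ unitSquare, pdx a z ^ 2 + pdy a z ^ 2 + pdx b z ^ 2 + pdy b z ^ 2
      ≤ M ^ 2 * (a z ^ 2 + b z ^ 2 + κ ^ 2) - C * jac a b z) (r : ℝ) :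
    ∫ z in unitSquare, (pdx (fun w => (a w ^ 2 + b w ^ 2 + κ ^ 2) ^ (-r)) z ^ 2
        + pdy (fun w => (a w ^ 2 + b w ^ 2 + κ ^ 2) ^ (-r)) z ^ 2)
      ≤ (2 * r * M) ^ 2 * ∫ z in unitSquare, ((a z ^ 2 + b z ^ 2 + κ ^ 2) ^ (-r)) ^ 2 := by
  set S : ℝ × ℝ → ℝ := fun z => a z ^ 2 + b z ^ 2 + κ ^ 2 with hS
  have hSpos : ∀ z, 0 < S z := fun z => by simp only [hS]; positivity
  have hSd : ContDiff ℝ 2 S := ((ha.pow 2).add (hb.pow 2)).add contDiff_const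
  have hqd : ∀ p : ℝ, ContDiff ℝ 1 fun z => S z ^ p := fun p =>
    ContDiff.rpow_const_of_ne (hSd.of_le (by norm_num)) fun z => (hSpos z).ne'
  have ha1 : ContDiff ℝ 1 a := ha.of_le (by norm_num)
  have hb1 : ContDiff ℝ 1 b := hb.of_le (by norm_num)
  have da := ha1.differentiable (by norm_num)
  have db := hb1.differentiable (by norm_num)
  have hJ := continuous_jac ha1 hb1
  have hJ0 : ∫ z in unitSquare, S z ^ (-2 * r - 1) * jac a b z = 0 := by
    refine integral_comp_normSq_mul_jac (G := fun t => (t + κ ^ 2) ^ (-2 * r - 1)) ha hb hap hbp ?_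
    refine ContinuousOn.rpow_const (by fun_prop) fun t ht => Or.inl ?_
    have : 0 ≤ t := ht
    positivity
  have hSx : ∀ z, pdx S z = 2 * a z * pdx a z + 2 * b z * pdx b z := fun z => by
    have e1 := pdx_comp (φ := fun s => s ^ 2) (by simpa using hasDerivAt_pow 2 (a z)) (da z)
    have e2 := pdx_comp (φ := fun s => s ^ 2) (by simpa using hasDerivAt_pow 2 (b z)) (db z)
    rw [← e1, ← e2]
    simp only [pdx, hS]
    rw [fderiv_add_const, fderiv_fun_add ((da z).fun_pow 2) ((db z).fun_pow 2)]; rfl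
  have hSy : ∀ z, pdy S z = 2 * a z * pdy a z + 2 * b z * pdy b z := fun z => by
    have e1 := pdy_comp (φ := fun s => s ^ 2) (by simpa using hasDerivAt_pow 2 (a z)) (da z)
    have e2 := pdy_comp (φ := fun s => s ^ 2) (by simpa using hasDerivAt_pow 2 (b z)) (db z)
    rw [← e1, ← e2]
    simp only [pdy, hS]
    rw [fderiv_add_const, fderiv_fun_add ((da z).fun_pow 2) ((db z).fun_pow 2)]; rfl
  have hφ : ∀ z, HasDerivAt (fun s : ℝ => s ^ (-r)) (-r * S z ^ (-r - 1)) (S z) := fun z =>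
    Real.hasDerivAt_rpow_const (Or.inl (hSpos z).ne')
  have dS := hSd.differentiable (by norm_num)
  have pt : ∀ z ∈ unitSquare, pdx (fun w => S w ^ (-r)) z ^ 2 + pdy (fun w => S w ^ (-r)) z ^ 2
      ≤ (2 * r * M) ^ 2 * (S z ^ (-r)) ^ 2 - 4 * r ^ 2 * C * (S z ^ (-2 * r - 1) * jac a b z) := by
    intro z hz
    rw [pdx_comp (hφ z) (dS z), pdy_comp (hφ z) (dS z), hSx, hSy]
    have p1 : (S z ^ (-r - 1)) ^ 2 * S z = S z ^ (-2 * r - 1) := by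
      rw [← Real.rpow_natCast, ← Real.rpow_mul (hSpos z).le]
      nth_rewrite 2 [← Real.rpow_one (S z)]
      rw [← Real.rpow_add (hSpos z)]
      congr 1; push_cast; ring
    have p2 : S z ^ (-2 * r - 1) * S z = (S z ^ (-r)) ^ 2 := by
      rw [← Real.rpow_natCast (S z ^ (-r)), ← Real.rpow_mul (hSpos z).le]
      nth_rewrite 2 [← Real.rpow_one (S z)]
      rw [← Real.rpow_add (hSpos z)]
      congr 1; push_cast; ring
    have hq := hquasi z hz
    have hp0 : 0 ≤ S z ^ (-2 * r - 1) := (Real.rpow_pos_of_pos (hSpos z) _).le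
    have hw0 : 0 ≤ (S z ^ (-r - 1)) ^ 2 := sq_nonneg _
    have cs : (a z * pdx a z + b z * pdx b z) ^ 2 + (a z * pdy a z + b z * pdy b z) ^ 2
        ≤ S z * (pdx a z ^ 2 + pdy a z ^ 2 + pdx b z ^ 2 + pdy b z ^ 2) := by
      simp only [hS]
      nlinarith [sq_nonneg (a z * pdx b z - b z * pdx a z),
        sq_nonneg (a z * pdy b z - b z * pdy a z), mul_nonneg (sq_nonneg κ)
          (by positivity : 0 ≤ pdx a z ^ 2 + pdy a z ^ 2 + pdx b z ^ 2 + pdy b z ^ 2)]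
    calc _ = 4 * r ^ 2 * ((S z ^ (-r - 1)) ^ 2 *
          ((a z * pdx a z + b z * pdx b z) ^ 2 + (a z * pdy a z + b z * pdy b z) ^ 2)) := by ring
      _ ≤ 4 * r ^ 2 * ((S z ^ (-r - 1)) ^ 2 *
          (S z * (pdx a z ^ 2 + pdy a z ^ 2 + pdx b z ^ 2 + pdy b z ^ 2))) := by gcongr
      _ = 4 * r ^ 2 * (S z ^ (-2 * r - 1) *
          (pdx a z ^ 2 + pdy a z ^ 2 + pdx b z ^ 2 + pdy b z ^ 2)) := by rw [← p1]; ring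
      _ ≤ 4 * r ^ 2 * (S z ^ (-2 * r - 1) * (M ^ 2 * S z - C * jac a b z)) := by gcongr
      _ = _ := by rw [← p2]; ring
  have cq := (hqd (-r)).continuous
  have cx := continuous_pdx (hqd (-r))
  have cy := continuous_pdy (hqd (-r))
  have cp := (hqd (-2 * r - 1)).continuous
  have i1 : IntegrableOn (fun z => (S z ^ (-r)) ^ 2) unitSquare :=
    integrableOn_unitSquare (cq.pow 2)
  have i2 : IntegrableOn (fun z => S z ^ (-2 * r - 1) * jac a b z) unitSquare :=
    integrableOn_unitSquare (cp.mul hJ)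
  have cL : Continuous fun z => pdx (fun w => S w ^ (-r)) z ^ 2 + pdy (fun w => S w ^ (-r)) z ^ 2 :=
    (cx.pow 2).add (cy.pow 2)
  have cR : Continuous fun z =>
      (2 * r * M) ^ 2 * (S z ^ (-r)) ^ 2 - 4 * r ^ 2 * C * (S z ^ (-2 * r - 1) * jac a b z) :=
    (continuous_const.mul (cq.pow 2)).sub (continuous_const.mul (cp.mul hJ))
  refine (setIntegral_unitSquare_mono cL cR pt).trans ?_
  rw [integral_sub (i1.const_mul _) (i2.const_mul _), integral_const_mul, integral_const_mul, hJ0,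
    mul_zero, sub_zero]

/-- A map of degree zero from the torus to the plane which is quasiregular up to a controlled error
and is bounded below on a segment is bounded below everywhere, quantitatively. -/
theorem exists_uniform_lower_bound {M α β y₀ c₀ : ℝ} (hM : 0 < M) (C : ℝ)
    (hα : 0 ≤ α) (hαβ : α < β) (hβ : β ≤ 1) (hy₀ : y₀ ∈ Icc (0 : ℝ) 1) (hc₀ : 0 < c₀) :
    ∃ δ > 0, ∀ a b : ℝ × ℝ → ℝ, ContDiff ℝ 2 a → ContDiff ℝ 2 b → IsPeriodic a → IsPeriodic b →
      ∀ κ > 0,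
      (∀ z ∈ unitSquare, pdx a z ^ 2 + pdy a z ^ 2 + pdx b z ^ 2 + pdy b z ^ 2
        ≤ M ^ 2 * (a z ^ 2 + b z ^ 2 + κ ^ 2) - C * jac a b z) →
      (∀ x ∈ Icc α β, c₀ ≤ a (x, y₀) ^ 2 + b (x, y₀) ^ 2) →
      ∀ z ∈ unitSquare, δ ≤ a z ^ 2 + b z ^ 2 + κ ^ 2 := by
  obtain ⟨r, hr0, hr1, hr⟩ : ∃ r : ℝ, 0 < r ∧ r ≤ 1 ∧ 8 * (2 * r * M) ^ 2 ≤ β - α := by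
    have hl : 0 < β - α := by linarith
    have hlim : Filter.Tendsto (fun r : ℝ => 8 * (2 * r * M) ^ 2) (nhdsWithin 0 (Ioi 0))
        (nhds (8 * (2 * 0 * M) ^ 2)) :=
      (Continuous.tendsto (by fun_prop) 0).mono_left nhdsWithin_le_nhds
    have e1 := hlim.eventually_lt_const (u := β - α) (by simpa using hl)
    have e2 : ∀ᶠ r : ℝ in nhdsWithin 0 (Ioi 0), r ∈ Ioo (0 : ℝ) 1 :=
      Ioo_mem_nhdsGT one_pos
    obtain ⟨r, h1, h2⟩ := (e1.and e2).exists
    exact ⟨r, h2.1, h2.2.le, h1.le⟩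
  set C₀ := (1 + 4 * M) ^ 2 with hC₀
  have hC₀1 : 1 ≤ C₀ := by rw [hC₀]; nlinarith
  set B := 4 * C₀ * (4 * (c₀ ^ (-r)) ^ 2) with hB
  have hBpos : 0 < B := by have := Real.rpow_pos_of_pos hc₀ (-r); positivity
  refine ⟨B ^ (-(2 * r)⁻¹), Real.rpow_pos_of_pos hBpos _, ?_⟩
  intro a b ha hb hap hbp κ hκ hquasi hseg z hz
  set S : ℝ × ℝ → ℝ := fun z => a z ^ 2 + b z ^ 2 + κ ^ 2 with hS
  have hSpos : ∀ z, 0 < S z := fun z => by simp only [hS]; positivity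
  have hSd : ContDiff ℝ 2 S := ((ha.pow 2).add (hb.pow 2)).add contDiff_const
  have hqd : ∀ p : ℝ, ContDiff ℝ 1 fun z => S z ^ p := fun p =>
    ContDiff.rpow_const_of_ne (hSd.of_le (by norm_num)) fun z => (hSpos z).ne'
  have energy := integral_grad_rpow_le ha hb hap hbp hκ hquasi
  have start : ∫ z in unitSquare, (S z ^ (-r)) ^ 2 ≤ 4 * (c₀ ^ (-r)) ^ 2 := by
    refine integral_sq_le_of_le_on_segment (hqd (-r)) hα hαβ hβ hy₀ (fun x hx => ?_) hr (energy r)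
    have h1 : c₀ ≤ S (x, y₀) := (hseg x hx).trans (by simp only [hS]; nlinarith [sq_nonneg κ])
    have := Real.rpow_le_rpow_of_nonpos hc₀ h1 (by linarith : -r ≤ 0)
    exact pow_le_pow_left₀ (Real.rpow_pos_of_pos (hSpos _) _).le this 2
  have hexp : ∀ k : ℕ, ∀ z, (S z ^ (-(r * 2 ^ k))) ^ 2 = (S z ^ (-(2 * r))) ^ (2 ^ k) := by
    intro k z
    rw [← Real.rpow_natCast (S z ^ (-(r * 2 ^ k))) 2,
      ← Real.rpow_natCast (S z ^ (-(2 * r))) (2 ^ k), ← Real.rpow_mul (hSpos z).le,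
      ← Real.rpow_mul (hSpos z).le]
    congr 1; push_cast; ring
  have step : ∀ k : ℕ, ∫ z in unitSquare, (S z ^ (-(2 * r))) ^ (2 ^ (k + 1))
      ≤ C₀ * 4 ^ k * (∫ z in unitSquare, (S z ^ (-(2 * r))) ^ (2 ^ k)) ^ 2 := by
    intro k
    have hrk : 0 < r * 2 ^ k := by positivity
    have h := integral_pow_four_le (hqd (-(r * 2 ^ k))) (K := 2 * (r * 2 ^ k) * M) (by positivity)
      (energy (r * 2 ^ k))
    have h4 : ∀ z, (S z ^ (-(r * 2 ^ k))) ^ 4 = (S z ^ (-(2 * r))) ^ (2 ^ (k + 1)) := by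
      intro z
      rw [pow_succ 2 k, pow_mul, ← hexp k z]; ring
    simp_rw [h4, hexp k] at h
    refine h.trans (mul_le_mul_of_nonneg_right ?_ (sq_nonneg _))
    have h2k : (1 : ℝ) ≤ 2 ^ k := one_le_pow₀ (by norm_num)
    have e4 : (4 : ℝ) ^ k = (2 ^ k) ^ 2 := by rw [← pow_mul, mul_comm, pow_mul]; norm_num
    rw [hC₀, e4, ← mul_pow]
    refine pow_le_pow_left₀ (by positivity) ?_ 2
    have : r * 2 ^ k * M ≤ 1 * 2 ^ k * M := by gcongr
    nlinarith
  have moser : ∀ k : ℕ, C₀ * 4 ^ (k + 1) * ∫ z in unitSquare, (S z ^ (-(2 * r))) ^ (2 ^ k)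
      ≤ B ^ (2 ^ k) := by
    intro k
    induction k with
    | zero =>
      have e : ∀ z, (S z ^ (-(2 * r))) ^ (2 ^ 0) = (S z ^ (-r)) ^ 2 := fun z => by
        rw [← hexp 0 z]; simp
      simp_rw [e]
      simp only [zero_add, pow_one, pow_zero]
      rw [hB, mul_comm 4 C₀]
      gcongr
    | succ k ih =>
      have hN : 0 ≤ ∫ z in unitSquare, (S z ^ (-(2 * r))) ^ (2 ^ k) :=
        integral_nonneg fun z => pow_nonneg (Real.rpow_pos_of_pos (hSpos z) _).le _
      calc _ ≤ C₀ * 4 ^ (k + 1 + 1) *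
            (C₀ * 4 ^ k * (∫ z in unitSquare, (S z ^ (-(2 * r))) ^ (2 ^ k)) ^ 2) := by
              gcongr; exact step k
        _ = (C₀ * 4 ^ (k + 1) * ∫ z in unitSquare, (S z ^ (-(2 * r))) ^ (2 ^ k)) ^ 2 := by ring
        _ ≤ (B ^ (2 ^ k)) ^ 2 := pow_le_pow_left₀ (by positivity) ih 2
        _ = B ^ (2 ^ (k + 1)) := by rw [← pow_mul, pow_succ 2 k]
  have sup : S z ^ (-(2 * r)) ≤ B := by
    refine le_of_forall_integral_pow_le (f := fun z => S z ^ (-(2 * r))) (hqd _).continuous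
      (fun z => (Real.rpow_pos_of_pos (hSpos z) _).le) hBpos (fun k => ?_) hz
    refine le_trans ?_ (moser k)
    have hN : 0 ≤ ∫ z in unitSquare, (S z ^ (-(2 * r))) ^ (2 ^ k) :=
      integral_nonneg fun z => pow_nonneg (Real.rpow_pos_of_pos (hSpos z) _).le _
    have h4 : (1 : ℝ) ≤ 4 ^ (k + 1) := one_le_pow₀ (by norm_num)
    exact le_mul_of_one_le_left hN (one_le_mul_of_one_le_of_one_le hC₀1 h4)
  have hfin := Real.rpow_le_rpow_of_nonpos (Real.rpow_pos_of_pos (hSpos z) _) sup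
    (by have : 0 < (2 * r)⁻¹ := by positivity
        linarith : -(2 * r)⁻¹ ≤ 0)
  rw [← Real.rpow_mul (hSpos z).le] at hfin
  have : -(2 * r) * -(2 * r)⁻¹ = 1 := by field_simp
  rw [this, Real.rpow_one] at hfin
  exact hfin

/-- For positive definite `s`, the form `(tr (s h))² - 2 det s det h` is positive definite on
symmetric matrices `h = (p, q; q, r)`. -/
lemma sq_trace_sub_two_mul_det_pos {s₁₁ s₁₂ s₂₂ p q r : ℝ} (h₁ : 0 < s₁₁)
    (hD : 0 < s₁₁ * s₂₂ - s₁₂ ^ 2) (h : (p, q, r) ≠ 0) :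
    0 < (s₁₁ * p + 2 * s₁₂ * q + s₂₂ * r) ^ 2
      - 2 * (s₁₁ * s₂₂ - s₁₂ ^ 2) * (p * r - q ^ 2) := by
  set D := s₁₁ * s₂₂ - s₁₂ ^ 2 with hDdef
  have key : s₁₁ ^ 2 * ((s₁₁ * p + 2 * s₁₂ * q + s₂₂ * r) ^ 2 - 2 * D * (p * r - q ^ 2)) =
      (s₁₁ ^ 2 * p + 2 * s₁₁ * s₁₂ * q + s₁₂ ^ 2 * r) ^ 2 + 2 * D * (s₁₁ * q + s₁₂ * r) ^ 2
        + (D * r) ^ 2 := by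
    rw [hDdef]; ring
  refine pos_of_mul_pos_right ?_ (sq_nonneg s₁₁)
  rw [key]
  by_contra! hle
  have t1 := sq_nonneg (s₁₁ ^ 2 * p + 2 * s₁₁ * s₁₂ * q + s₁₂ ^ 2 * r)
  have t2 : 0 ≤ 2 * D * (s₁₁ * q + s₁₂ * r) ^ 2 := by positivity
  have t3 := sq_nonneg (D * r)
  have hr : r = 0 := by
    have : (D * r) ^ 2 = 0 := by linarith
    simpa [hD.ne'] using this
  have hq : q = 0 := by
    have : 2 * D * (s₁₁ * q + s₁₂ * r) ^ 2 = 0 := by linarith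
    simpa [hD.ne', hr, h₁.ne'] using this
  have hp : p = 0 := by
    have : (s₁₁ ^ 2 * p + 2 * s₁₁ * s₁₂ * q + s₁₂ ^ 2 * r) ^ 2 = 0 := by linarith
    simpa [hq, hr, h₁.ne'] using this
  exact h (by simp [hp, hq, hr])

/-- Quantitative form of `sq_trace_sub_two_mul_det_pos`, uniform over the unit square. -/
lemma exists_normSq_le_sq_trace_sub_det {s₁₁ s₁₂ s₂₂ : ℝ × ℝ → ℝ} (c₁₁ : Continuous s₁₁)
    (c₁₂ : Continuous s₁₂) (c₂₂ : Continuous s₂₂) (h₁ : ∀ z, 0 < s₁₁ z)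
    (hD : ∀ z, 0 < s₁₁ z * s₂₂ z - s₁₂ z ^ 2) :
    ∃ C₁ > 0, ∃ C₂, ∀ z ∈ unitSquare, ∀ p q r : ℝ, p ^ 2 + q ^ 2 + q ^ 2 + r ^ 2
      ≤ C₁ * (s₁₁ z * p + 2 * s₁₂ z * q + s₂₂ z * r) ^ 2 - C₂ * (p * r - q ^ 2) := by
  set D : ℝ × ℝ → ℝ := fun z => s₁₁ z * s₂₂ z - s₁₂ z ^ 2 with hDdef
  have cD : Continuous D := by fun_prop
  have cDi : Continuous fun z => (D z)⁻¹ := cD.inv₀ fun z => (hD z).ne'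
  set F : (ℝ × ℝ) × (ℝ × ℝ × ℝ) → ℝ := fun w =>
    (D w.1)⁻¹ * (s₁₁ w.1 * w.2.1 + 2 * s₁₂ w.1 * w.2.2.1 + s₂₂ w.1 * w.2.2.2) ^ 2
      - 2 * (w.2.1 * w.2.2.2 - w.2.2.1 ^ 2) with hF
  have cF : Continuous F := by
    have : Continuous fun w : (ℝ × ℝ) × (ℝ × ℝ × ℝ) => (D w.1)⁻¹ := cDi.comp continuous_fst
    fun_prop
  have Fpos : ∀ z h, h ≠ 0 → 0 < F (z, h) := by
    intro z h hh
    have := sq_trace_sub_two_mul_det_pos (p := h.1) (q := h.2.1) (r := h.2.2) (h₁ z) (hD z) hh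
    have e : F (z, h) = (D z)⁻¹ * ((s₁₁ z * h.1 + 2 * s₁₂ z * h.2.1 + s₂₂ z * h.2.2) ^ 2
        - 2 * D z * (h.1 * h.2.2 - h.2.1 ^ 2)) := by
      have : D z ≠ 0 := (hD z).ne'
      simp only [hF]; field_simp
    rw [e]
    exact mul_pos (inv_pos.2 (hD z)) this
  obtain ⟨w₀, hw₀, hmin⟩ := (isCompact_unitSquare.prod
    (isCompact_sphere (0 : ℝ × ℝ × ℝ) 1)).exists_isMinOn
      ⟨((0, 0), (1, 0, 0)), by simp [unitSquare]⟩ cF.continuousOn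
  obtain ⟨B, hB⟩ := (isCompact_unitSquare.bddAbove_image (f := fun z => (D z)⁻¹)
    cDi.continuousOn)
  have hB' : ∀ z ∈ unitSquare, (D z)⁻¹ ≤ B := fun z hz => hB (mem_image_of_mem _ hz)
  have hB0 : 0 < B := lt_of_lt_of_le (inv_pos.2 (hD (0, 0))) (hB' (0, 0) (by simp [unitSquare]))
  set m := F w₀ with hm
  have hm0 : 0 < m := Fpos w₀.1 w₀.2 (by
    intro h0
    have := hw₀.2
    rw [h0] at this
    simp at this)
  refine ⟨4 * B / m, by positivity, 8 / m, fun z hz p q r => ?_⟩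
  have hlow : m * ‖(p, q, r)‖ ^ 2 ≤ F (z, (p, q, r)) := by
    rcases eq_or_ne (p, q, r) 0 with h0 | h0
    · rw [h0]; simp [hF]
    · set n := ‖(p, q, r)‖ with hn
      have hn0 : 0 < n := norm_pos_iff.2 h0
      have hmem : (z, n⁻¹ • (p, q, r)) ∈ unitSquare ×ˢ Metric.sphere (0 : ℝ × ℝ × ℝ) 1 := by
        refine ⟨hz, ?_⟩
        rw [mem_sphere_zero_iff_norm, norm_smul, norm_inv, Real.norm_of_nonneg hn0.le, ← hn,
          inv_mul_cancel₀ hn0.ne']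
      have h1 : m ≤ F (z, n⁻¹ • (p, q, r)) := hmin hmem
      have h2 : F (z, n⁻¹ • (p, q, r)) = F (z, (p, q, r)) / n ^ 2 := by
        simp only [hF, Prod.smul_mk, smul_eq_mul]; field_simp
      rw [h2, le_div_iff₀ (by positivity)] at h1
      exact h1
  have n1 : p ^ 2 ≤ ‖(p, q, r)‖ ^ 2 := by
    rw [← sq_abs]; exact pow_le_pow_left₀ (abs_nonneg _) (norm_fst_le (p, q, r)) 2
  have n2 : q ^ 2 ≤ ‖(p, q, r)‖ ^ 2 := by
    rw [← sq_abs]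
    exact pow_le_pow_left₀ (abs_nonneg _)
      ((norm_fst_le (q, r)).trans (norm_snd_le (p, q, r))) 2
  have n3 : r ^ 2 ≤ ‖(p, q, r)‖ ^ 2 := by
    rw [← sq_abs]
    exact pow_le_pow_left₀ (abs_nonneg _)
      ((norm_snd_le (q, r)).trans (norm_snd_le (p, q, r))) 2
  have hup : F (z, (p, q, r)) ≤ B * (s₁₁ z * p + 2 * s₁₂ z * q + s₂₂ z * r) ^ 2
      - 2 * (p * r - q ^ 2) := by
    simp only [hF]
    gcongr
    exact hB' z hz
  have : m * (p ^ 2 + q ^ 2 + q ^ 2 + r ^ 2) ≤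
      4 * (B * (s₁₁ z * p + 2 * s₁₂ z * q + s₂₂ z * r) ^ 2 - 2 * (p * r - q ^ 2)) := by
    nlinarith
  rw [← mul_le_mul_iff_right₀ hm0]
  refine this.trans (le_of_eq ?_)
  field_simp
  ring

/-- Convolution `η ⋆ f` of real functions on the plane. -/
noncomputable def mollify (η f : ℝ × ℝ → ℝ) (x : ℝ × ℝ) : ℝ := ∫ t, η t * f (x - t)

section Mollify

variable {η f : ℝ × ℝ → ℝ}

lemma integrable_mul_of_hasCompactSupport (hη : Continuous η) (hc : HasCompactSupport η)
    (hf : Continuous f) : Integrable fun t => η t * f t :=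
  (hη.mul hf).integrable_of_hasCompactSupport hc.mul_right

lemma integrable_mollify (hη : Continuous η) (hc : HasCompactSupport η)
    (hf : Continuous f) (x : ℝ × ℝ) : Integrable fun t => η t * f (x - t) :=
  integrable_mul_of_hasCompactSupport hη hc (f := fun t => f (x - t)) (by fun_prop)

lemma contDiff_mollify (hη : ContDiff ℝ (⊤ : ℕ∞) η) (hc : HasCompactSupport η)
    (hf : Continuous f) : ContDiff ℝ (⊤ : ℕ∞) (mollify η f) :=
  hc.contDiff_convolution_left (ContinuousLinearMap.mul ℝ ℝ) hη hf.locallyIntegrable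

lemma fderiv_mollify (hη : ContDiff ℝ 1 η) (hc : HasCompactSupport η)
    (hf : Continuous f) (x v : ℝ × ℝ) :
    fderiv ℝ (mollify η f) x v = mollify (fun t => fderiv ℝ η t v) f x := by
  have h := (hc.hasFDerivAt_convolution_left (μ := volume) (ContinuousLinearMap.mul ℝ ℝ) hη
    hf.locallyIntegrable x).fderiv
  have e : mollify η f = convolution η f (ContinuousLinearMap.mul ℝ ℝ) volume := rfl
  rw [e, h, convolution, ContinuousLinearMap.integral_apply]
  · rfl
  · have := ((hc.fderiv ℝ).convolutionExists_left (μ := volume)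
      (ContinuousLinearMap.precompL (ℝ × ℝ) (ContinuousLinearMap.mul ℝ ℝ))
      (hη.continuous_fderiv (by norm_num)) hf.locallyIntegrable) x
    exact this

lemma IsPeriodic.mollify (hf : IsPeriodic f) : IsPeriodic (mollify η f) := by
  intro z k l
  refine integral_congr_ae (Filter.Eventually.of_forall fun t => ?_)
  have := hf (z - t) k l
  simp only [Prod.fst_sub, Prod.snd_sub] at this
  simp only
  rw [← this]
  congr 2
  ext <;> simp <;> ring

lemma mollify_fderiv_comm (hη : ContDiff ℝ 1 η) (hc : HasCompactSupport η)
    (hf : ContDiff ℝ 1 f) (x v : ℝ × ℝ) :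
    mollify (fun t => fderiv ℝ η t v) f x = mollify η (fun t => fderiv ℝ f t v) x := by
  have hg : ContDiff ℝ 1 fun t => f (x - t) := hf.comp (contDiff_const.sub contDiff_id)
  have hder : ∀ t, fderiv ℝ (fun t => f (x - t)) t v = - fderiv ℝ f (x - t) v := by
    intro t
    have h1 : HasFDerivAt f (fderiv ℝ f (x - t)) (x - t) :=
      (hf.differentiable (by norm_num) _).hasFDerivAt
    have := (h1.comp t ((hasFDerivAt_id t).const_sub x)).fderiv
    simp only [Function.comp_def] at this
    rw [this]; simp
  have cη' : Continuous fun t => fderiv ℝ η t v :=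
    (hη.continuous_fderiv (by norm_num)).clm_apply continuous_const
  have cg' : Continuous fun t => fderiv ℝ (fun t => f (x - t)) t v :=
    (hg.continuous_fderiv (by norm_num)).clm_apply continuous_const
  have := integral_mul_fderiv_eq_neg_fderiv_mul_of_integrable (μ := volume) (f := η)
    (g := fun t => f (x - t)) (v := v)
    (integrable_mul_of_hasCompactSupport cη' (hc.fderiv_apply ℝ v) hg.continuous)
    (integrable_mul_of_hasCompactSupport hη.continuous hc cg')
    (integrable_mul_of_hasCompactSupport hη.continuous hc hg.continuous)
    (fun t _ => hη.differentiable (by norm_num) t) (fun t _ => hg.differentiable (by norm_num) t)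
  simp only [hder, mul_neg, integral_neg, neg_inj] at this
  exact this.symm

end Mollify

/-- The rescaled kernel `t ↦ ε⁻² φ (t / ε)`. -/
noncomputable def rescale (φ : ℝ × ℝ → ℝ) (ε : ℝ) (t : ℝ × ℝ) : ℝ := (ε⁻¹) ^ 2 * φ (ε⁻¹ • t)

section Rescale

variable {φ : ℝ × ℝ → ℝ}

lemma contDiff_rescale {n : WithTop ℕ∞} (hφ : ContDiff ℝ n φ) (ε : ℝ) :
    ContDiff ℝ n (rescale φ ε) :=
  contDiff_const.mul (hφ.comp (contDiff_const_smul ε⁻¹))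

lemma hasCompactSupport_rescale (hc : HasCompactSupport φ) (ε : ℝ) :
    HasCompactSupport (rescale φ ε) := by
  rcases eq_or_ne ε 0 with rfl | hε
  · have : rescale φ 0 = 0 := by ext t; simp [rescale]
    rw [this]; exact HasCompactSupport.zero
  · exact (hc.comp_smul (inv_ne_zero hε)).mul_left

lemma integral_rescale_mul {ε : ℝ} (hε : 0 < ε) (g : ℝ × ℝ → ℝ) :
    ∫ t, rescale φ ε t * g t = ∫ z, φ z * g (ε • z) := by
  have h := Measure.integral_comp_smul (volume : Measure (ℝ × ℝ))
    (fun z => φ z * g (ε • z)) ε⁻¹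
  have hf : Module.finrank ℝ (ℝ × ℝ) = 2 := by simp
  rw [hf, abs_of_pos (by positivity), smul_eq_mul] at h
  simp only [smul_smul, mul_inv_cancel₀ hε.ne', one_smul] at h
  simp only [rescale, mul_assoc]
  rw [integral_const_mul, h, ← mul_assoc]
  have : ε⁻¹ ^ 2 * (ε⁻¹ ^ 2)⁻¹ = 1 := by field_simp
  rw [this, one_mul]

lemma fderiv_rescale (hφ : ContDiff ℝ 1 φ) (ε : ℝ) (t v : ℝ × ℝ) :
    fderiv ℝ (rescale φ ε) t v = ε⁻¹ * rescale (fun z => fderiv ℝ φ z v) ε t := by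
  have h1 : HasFDerivAt φ (fderiv ℝ φ (ε⁻¹ • t)) (ε⁻¹ • t) :=
    (hφ.differentiable (by norm_num) _).hasFDerivAt
  have := ((h1.comp t ((hasFDerivAt_id t).const_smul ε⁻¹)).const_mul ((ε⁻¹) ^ 2)).fderiv
  have e : rescale φ ε = fun y => ε⁻¹ ^ 2 * (φ ∘ HSMul.hSMul ε⁻¹) y := rfl
  rw [e, this]
  simp [rescale]; ring

end Rescale

/-- Parametric integrals with a jointly continuous, compactly supported integrand depend
continuously on the parameter, uniformly over the unit square. -/
lemma eventually_abs_integral_sub_lt {g : ℝ → ℝ × ℝ → ℝ × ℝ → ℝ} {K : Set (ℝ × ℝ)}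
    (hK : IsCompact K) (hg : Continuous fun w : (ℝ × (ℝ × ℝ)) × (ℝ × ℝ) => g w.1.1 w.1.2 w.2)
    (h0 : ∀ ε x, ∀ z ∉ K, g ε x z = 0) {Q : Set (ℝ × ℝ)} (hQ : IsCompact Q) {δ : ℝ} (hδ : 0 < δ) :
    ∀ᶠ ε in nhds (0 : ℝ), ∀ x ∈ Q, |(∫ z, g ε x z) - ∫ z, g 0 x z| < δ := by
  have hc : Continuous fun w : ℝ × (ℝ × ℝ) => ∫ z, g w.1 w.2 z := by
    have := continuous_parametric_integral_of_continuous (μ := (volume : Measure (ℝ × ℝ)))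
      (f := fun w : ℝ × (ℝ × ℝ) => fun z => g w.1 w.2 z) hg hK
    convert this using 2 with w
    exact (setIntegral_eq_integral_of_forall_compl_eq_zero (h0 w.1 w.2)).symm
  refine hQ.eventually_forall_of_forall_eventually fun x _ => ?_
  have hd : Continuous fun w : ℝ × (ℝ × ℝ) => |(∫ z, g w.1 w.2 z) - ∫ z, g 0 w.2 z| :=
    (hc.sub (hc.comp (continuous_const.prodMk continuous_snd))).abs
  exact (hd.tendsto (0, x)).eventually_lt_const (by simpa using hδ)

section Limits

variable {φ : ℝ × ℝ → ℝ}

lemma eventually_abs_mollify_sub_lt (hφ : Continuous φ) (hc : HasCompactSupport φ)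
    (h1 : ∫ z, φ z = 1) {f : ℝ × ℝ → ℝ} (hf : Continuous f) {Q : Set (ℝ × ℝ)} (hQ : IsCompact Q)
    {δ : ℝ} (hδ : 0 < δ) :
    ∀ᶠ ε in nhdsWithin (0 : ℝ) (Ioi 0), ∀ x ∈ Q, |mollify (rescale φ ε) f x - f x| < δ := by
  have h := eventually_abs_integral_sub_lt (g := fun ε x z => φ z * f (x - ε • z)) hc
    (by fun_prop) (fun ε x z hz => by rw [image_eq_zero_of_notMem_tsupport hz, zero_mul]) hQ hδ
  filter_upwards [nhdsWithin_le_nhds h, self_mem_nhdsWithin] with ε hε hpos x hx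
  have := hε x hx
  simp only [zero_smul, sub_zero, integral_mul_const, h1, one_mul] at this
  rwa [mollify, integral_rescale_mul hpos (fun t => f (x - t))]

/-- Friedrichs' commutator lemma in the uniform norm. -/
lemma eventually_abs_commutator_lt (hφ : ContDiff ℝ 1 φ) (hc : HasCompactSupport φ)
    {s f : ℝ × ℝ → ℝ} (hs : ContDiff ℝ 1 s) (hf : Continuous f) (v : ℝ × ℝ) {Q : Set (ℝ × ℝ)}
    (hQ : IsCompact Q) {δ : ℝ} (hδ : 0 < δ) :
    ∀ᶠ ε in nhdsWithin (0 : ℝ) (Ioi 0), ∀ x ∈ Q,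
      |s x * fderiv ℝ (mollify (rescale φ ε) f) x v
        - fderiv ℝ (mollify (rescale φ ε) fun t => s t * f t) x v
        + fderiv ℝ s x v * mollify (rescale φ ε) f x| < δ := by
  have cs' : Continuous (fderiv ℝ s) := hs.continuous_fderiv (by norm_num)
  have cφ' : Continuous fun z => fderiv ℝ φ z v :=
    (hφ.continuous_fderiv (by norm_num)).clm_apply continuous_const
  have hφc := hφ.continuous
  have hsc := hs.continuous
  set D : ℝ → ℝ × ℝ → ℝ × ℝ → ℝ := fun ε x z => ∫ θ in (0 : ℝ)..1, fderiv ℝ s (x - (θ * ε) • z) z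
    with hD
  have cD : Continuous fun w : (ℝ × (ℝ × ℝ)) × (ℝ × ℝ) => D w.1.1 w.1.2 w.2 := by
    refine intervalIntegral.continuous_parametric_intervalIntegral_of_continuous'
      (f := fun (w : (ℝ × (ℝ × ℝ)) × (ℝ × ℝ)) θ => fderiv ℝ s (w.1.2 - (θ * w.1.1) • w.2) w.2)
      ?_ 0 1
    exact (cs'.comp (by fun_prop)).clm_apply (by fun_prop)
  have Deq : ∀ ε x z, s x - s (x - ε • z) = ε * D ε x z := by
    intro ε x z
    have hder : ∀ θ ∈ uIcc (0 : ℝ) 1, HasDerivAt (fun θ : ℝ => s (x - (θ * ε) • z))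
        (-ε * fderiv ℝ s (x - (θ * ε) • z) z) θ := by
      intro θ _
      have h1 : HasFDerivAt s (fderiv ℝ s (x - (θ * ε) • z)) (x - (θ * ε) • z) :=
        (hs.differentiable (by norm_num) _).hasFDerivAt
      have h2 : HasDerivAt (fun θ : ℝ => x - (θ * ε) • z) (-(ε • z)) θ := by
        simpa using (((hasDerivAt_id θ).mul_const ε).smul_const z).const_sub x
      have := h1.comp_hasDerivAt θ h2
      simpa [Function.comp_def] using this
    have := intervalIntegral.integral_eq_sub_of_hasDerivAt hder
      (Continuous.intervalIntegrable (continuous_const.mul ((cs'.comp (by fun_prop)).clm_apply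
        continuous_const)) _ _)
    rw [intervalIntegral.integral_const_mul] at this
    simp only [one_mul, zero_mul, zero_smul, sub_zero] at this
    simp only [hD]
    linarith
  have h := eventually_abs_integral_sub_lt (K := tsupport φ)
    (g := fun ε x z => (D ε x z * fderiv ℝ φ z v + fderiv ℝ s x v * φ z) * f (x - ε • z)) hc
    ((((cD.mul (cφ'.comp continuous_snd)).add (((cs'.comp (by fun_prop)).clm_apply
      continuous_const).mul (by fun_prop))).mul (by fun_prop)))
    (fun ε x z hz => by
      have : fderiv ℝ φ z = 0 :=
        image_eq_zero_of_notMem_tsupport fun h => hz (tsupport_fderiv_subset ℝ h)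
      rw [image_eq_zero_of_notMem_tsupport hz, this]; simp) hQ hδ
  have hzero : ∀ x, ∫ z, (D 0 x z * fderiv ℝ φ z v + fderiv ℝ s x v * φ z) * f (x - (0 : ℝ) • z)
      = 0 := by
    intro x
    have hD0 : ∀ z, D 0 x z = fderiv ℝ s x z := fun z => by simp [hD]
    have cL : Continuous fun z => fderiv ℝ s x z := (fderiv ℝ s x).continuous
    have i1 : Integrable fun z => fderiv ℝ s x z * fderiv ℝ φ z v := by
      simpa [mul_comm] using
        integrable_mul_of_hasCompactSupport cφ' (hc.fderiv_apply ℝ v) cL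
    have i2 : Integrable fun z => fderiv ℝ s x v * φ z :=
      (hφc.integrable_of_hasCompactSupport hc).const_mul _
    have i3 : Integrable fun z => fderiv ℝ s x z * φ z := by
      simpa [mul_comm] using integrable_mul_of_hasCompactSupport hφc hc cL
    have ibp := integral_mul_fderiv_eq_neg_fderiv_mul_of_integrable (μ := volume)
      (f := fun z => fderiv ℝ s x z) (g := φ) (v := v)
      (by simpa using i2) i1 i3 (fun t _ => (fderiv ℝ s x).differentiableAt)
      (fun t _ => hφ.differentiable (by norm_num) t)
    simp only [ContinuousLinearMap.fderiv] at ibp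
    simp only [zero_smul, sub_zero, hD0]
    rw [integral_mul_const, integral_add i1 i2, ibp]
    simp
  filter_upwards [nhdsWithin_le_nhds h, self_mem_nhdsWithin] with ε hε hpos x hx
  have hlt := hε x hx
  rw [hzero, sub_zero] at hlt
  have hpos' : 0 < ε := hpos
  have hη := contDiff_rescale hφ ε
  have hηc := hasCompactSupport_rescale hc ε
  have hmol : ∀ {g : ℝ × ℝ → ℝ}, Continuous g → fderiv ℝ (mollify (rescale φ ε) g) x v
      = ε⁻¹ * ∫ z, fderiv ℝ φ z v * g (x - ε • z) := by
    intro g hg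
    rw [fderiv_mollify hη hηc hg, mollify]
    simp only [fderiv_rescale hφ, mul_assoc]
    rw [integral_const_mul, integral_rescale_mul hpos (fun t => g (x - t))]
  have hsf : Continuous fun t => s t * f t := hsc.mul hf
  have hshift : ∀ {g : ℝ × ℝ → ℝ}, Continuous g → Continuous fun z => g (x - ε • z) :=
    fun hg => hg.comp (by fun_prop)
  have j1 := integrable_mul_of_hasCompactSupport cφ' (hc.fderiv_apply ℝ v) (hshift hf)
  have j2 := integrable_mul_of_hasCompactSupport cφ' (hc.fderiv_apply ℝ v) (hshift hsf)
  have j3 := integrable_mul_of_hasCompactSupport hφc hc (hshift hf)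
  rw [hmol hf, hmol hsf, mollify, integral_rescale_mul hpos (fun t => f (x - t))]
  convert hlt using 2
  rw [← mul_assoc, ← integral_const_mul, ← integral_const_mul, ← integral_const_mul,
    ← integral_sub (j1.const_mul _) (j2.const_mul _), ← integral_add _ (j3.const_mul _)]
  rotate_left
  · exact (j1.const_mul _).sub (j2.const_mul _)
  congr 1 with z
  have : D ε x z = ε⁻¹ * (s x - s (x - ε • z)) := by rw [Deq]; field_simp
  rw [this]; ring

end Limits

/-- `(q₁, q₂)` is divergence free in the sense of distributions. -/
def IsWeaklyDivFree (q₁ q₂ : ℝ × ℝ → ℝ) : Prop :=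
  ∀ ψ : ℝ × ℝ → ℝ, ContDiff ℝ (⊤ : ℕ∞) ψ → HasCompactSupport ψ →
    ∫ z, (q₁ z * pdx ψ z + q₂ z * pdy ψ z) = 0

lemma IsWeaklyDivFree.mollify {q₁ q₂ η : ℝ × ℝ → ℝ} (h : IsWeaklyDivFree q₁ q₂)
    (c₁ : Continuous q₁) (c₂ : Continuous q₂) (hη : ContDiff ℝ (⊤ : ℕ∞) η)
    (hc : HasCompactSupport η) (x : ℝ × ℝ) :
    pdx (mollify η q₁) x + pdy (PeriodicPlane.mollify η q₂) x = 0 := by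
  have hη1 : ContDiff ℝ 1 η := hη.of_le (by exact_mod_cast le_top)
  have hder : ∀ y v, fderiv ℝ (fun y => η (x - y)) y v = - fderiv ℝ η (x - y) v := by
    intro y v
    have h1 : HasFDerivAt η (fderiv ℝ η (x - y)) (x - y) :=
      (hη1.differentiable (by norm_num) _).hasFDerivAt
    have := (h1.comp y ((hasFDerivAt_id y).const_sub x)).fderiv
    simp only [Function.comp_def] at this
    rw [this]; simp
  have key := h (fun y => η (x - y)) (hη.comp (contDiff_const.sub contDiff_id))
    (hc.comp_homeomorph (Homeomorph.subLeft x))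
  have hx : Continuous (pdx η) := continuous_pdx hη1
  have hy : Continuous (pdy η) := continuous_pdy hη1
  have e := integral_sub_left_eq_self
    (fun t => pdx η t * q₁ (x - t) + pdy η t * q₂ (x - t)) volume x
  simp only [sub_sub_cancel] at e
  have e2 : ∫ y, (q₁ y * pdx (fun y => η (x - y)) y + q₂ y * pdy (fun y => η (x - y)) y)
      = - ∫ y, (pdx η (x - y) * q₁ y + pdy η (x - y) * q₂ y) := by
    rw [← integral_neg]
    congr 1 with y
    simp only [pdx, pdy, hder]; ring
  rw [e2, e, neg_eq_zero, integral_add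
    (integrable_mollify hx (hc.fderiv_apply ℝ _) c₁ x)
    (integrable_mollify hy (hc.fderiv_apply ℝ _) c₂ x)] at key
  simp only [pdx, pdy]
  rw [fderiv_mollify hη1 hc c₁, fderiv_mollify hη1 hc c₂]
  exact key

lemma pdx_add {f g : ℝ × ℝ → ℝ} {z : ℝ × ℝ} (hf : DifferentiableAt ℝ f z)
    (hg : DifferentiableAt ℝ g z) : pdx (fun w => f w + g w) z = pdx f z + pdx g z := by
  simp only [pdx]; rw [fderiv_fun_add hf hg]; rfl

lemma pdy_add {f g : ℝ × ℝ → ℝ} {z : ℝ × ℝ} (hf : DifferentiableAt ℝ f z)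
    (hg : DifferentiableAt ℝ g z) : pdy (fun w => f w + g w) z = pdy f z + pdy g z := by
  simp only [pdy]; rw [fderiv_fun_add hf hg]; rfl

lemma mollify_add {η f g : ℝ × ℝ → ℝ} (hη : Continuous η) (hc : HasCompactSupport η)
    (hf : Continuous f) (hg : Continuous g) :
    mollify η (fun z => f z + g z) = fun z => mollify η f z + mollify η g z := by
  ext x
  simp only [mollify, mul_add]
  exact integral_add (integrable_mollify hη hc hf x) (integrable_mollify hη hc hg x)

/-- Mollified partial derivatives satisfy the symmetry of second derivatives. -/
lemma pdy_mollify_pdx {U η : ℝ × ℝ → ℝ} (hU : ContDiff ℝ 1 U) (hη : ContDiff ℝ 2 η)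
    (hc : HasCompactSupport η) (x : ℝ × ℝ) :
    pdy (mollify η (pdx U)) x = pdx (mollify η (pdy U)) x := by
  have hη1 : ContDiff ℝ 1 η := hη.of_le (by norm_num)
  have hx : ContDiff ℝ 1 (pdx η) := contDiff_pdx hη (by norm_num)
  have hy : ContDiff ℝ 1 (pdy η) := contDiff_pdy hη (by norm_num)
  calc pdy (mollify η (pdx U)) x = mollify (pdy η) (pdx U) x :=
        fderiv_mollify hη1 hc (continuous_pdx hU) x _
    _ = mollify (pdx (pdy η)) U x :=
        (mollify_fderiv_comm hy (hc.fderiv_apply ℝ _) hU x _).symm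
    _ = mollify (pdy (pdx η)) U x := by
        congr 1; ext z; exact (pdx_pdy_comm hη z)
    _ = mollify (pdx η) (pdy U) x := mollify_fderiv_comm hx (hc.fderiv_apply ℝ _) hU x _
    _ = pdx (mollify η (pdy U)) x := (fderiv_mollify hη1 hc (continuous_pdy hU) x _).symm

lemma exists_mollifier : ∃ φ : ℝ × ℝ → ℝ, ContDiff ℝ (⊤ : ℕ∞) φ ∧ HasCompactSupport φ ∧
    ∫ z, φ z = 1 :=
  let f : ContDiffBump (0 : ℝ × ℝ) := default
  ⟨f.normed volume, f.contDiff_normed, f.hasCompactSupport_normed, f.integral_normed⟩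

/-- A periodic gradient field which is nonzero somewhere on the plane is nonzero on a horizontal
segment of the unit square. -/
lemma exists_segment_lt {P : ℝ × ℝ → ℝ} (hP : Continuous P) (hper : IsPeriodic P) {z₀ : ℝ × ℝ}
    {c : ℝ} (hz₀ : c < P z₀) :
    ∃ α β y₀ : ℝ, 0 ≤ α ∧ α < β ∧ β ≤ 1 ∧ y₀ ∈ Icc (0 : ℝ) 1 ∧ ∀ x ∈ Icc α β, c < P (x, y₀) := by
  obtain ⟨k, l, hx, hy⟩ := exists_int_shift_mem_unitSquare z₀
  set y₀ := z₀.2 + (l : ℝ)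
  have hopen : IsOpen {x | c < P (x, y₀)} := isOpen_lt continuous_const (by fun_prop)
  have hcl : z₀.1 + (k : ℝ) ∈ closure (Ioo (0 : ℝ) 1) := by
    rw [closure_Ioo zero_ne_one]; exact hx
  have hmem : z₀.1 + (k : ℝ) ∈ {x | c < P (x, y₀)} := by
    change c < P (z₀.1 + k, z₀.2 + l)
    rw [hper]; exact hz₀
  obtain ⟨x₁, hx₁⟩ := mem_closure_iff.1 hcl _ hopen hmem
  obtain ⟨r, hr, hsub⟩ := Metric.nhds_basis_closedBall.mem_iff.1
    ((hopen.inter isOpen_Ioo).mem_nhds hx₁)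
  rw [Real.closedBall_eq_Icc] at hsub
  refine ⟨x₁ - r, x₁ + r, y₀, ?_, by linarith, ?_, hy, fun x hx => (hsub hx).1⟩
  · exact (hsub (left_mem_Icc.2 (by linarith))).2.1.le
  · exact (hsub (right_mem_Icc.2 (by linarith))).2.2.le

lemma sq_le_of_abs_add_le {τ d₁ d₂ a b N κ : ℝ} (hd : d₁ ^ 2 + d₂ ^ 2 ≤ N)
    (h : |τ + (d₁ * a + d₂ * b)| ≤ κ) : τ ^ 2 ≤ 3 * (N + 1) * (a ^ 2 + b ^ 2 + κ ^ 2) := by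
  set s := d₁ * a + d₂ * b with hs
  have h1 : (τ + s) ^ 2 ≤ κ ^ 2 := by
    rw [← sq_abs]; exact pow_le_pow_left₀ (abs_nonneg _) h 2
  have h2 : s ^ 2 ≤ N * (a ^ 2 + b ^ 2) := by
    have := mul_le_mul_of_nonneg_right hd (by positivity : 0 ≤ a ^ 2 + b ^ 2)
    rw [hs]; nlinarith [sq_nonneg (d₁ * b - d₂ * a)]
  have h3 : τ ^ 2 ≤ 2 * (τ + s) ^ 2 + 2 * s ^ 2 := by nlinarith [sq_nonneg (τ + 2 * s)]
  have hN : 0 ≤ N := le_trans (by positivity) hd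
  have h4 : 0 ≤ N * κ ^ 2 := by positivity
  have h5 : 0 ≤ N * (a ^ 2 + b ^ 2) := by positivity
  nlinarith [sq_nonneg a, sq_nonneg b, sq_nonneg κ]

lemma sq_le_of_abs_sub_lt {p m κ : ℝ} (h : |m - p| < κ) : p ^ 2 ≤ 2 * m ^ 2 + 2 * κ ^ 2 := by
  have : (m - p) ^ 2 ≤ κ ^ 2 := by
    rw [← sq_abs]; exact pow_le_pow_left₀ (abs_nonneg _) h.le 2
  nlinarith [sq_nonneg (2 * m - p)]

/-- A weak solution on the plane of a divergence form elliptic equation with `C¹` coefficients whose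
gradient is continuous, periodic and not identically zero has no critical point. -/
theorem normSq_grad_pos {U s₁₁ s₁₂ s₂₂ : ℝ × ℝ → ℝ} (hU : ContDiff ℝ 1 U)
    (hp₁ : IsPeriodic (pdx U)) (hp₂ : IsPeriodic (pdy U)) (hs₁₁ : ContDiff ℝ 1 s₁₁)
    (hs₁₂ : ContDiff ℝ 1 s₁₂) (hs₂₂ : ContDiff ℝ 1 s₂₂) (hpos : ∀ z, 0 < s₁₁ z)
    (hdet : ∀ z, 0 < s₁₁ z * s₂₂ z - s₁₂ z ^ 2)
    (hdiv : IsWeaklyDivFree (fun z => s₁₁ z * pdx U z + s₁₂ z * pdy U z)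
      (fun z => s₁₂ z * pdx U z + s₂₂ z * pdy U z))
    (hne : ∃ z, 0 < pdx U z ^ 2 + pdy U z ^ 2) (z : ℝ × ℝ) :
    0 < pdx U z ^ 2 + pdy U z ^ 2 := by
  by_contra hz
  obtain ⟨z₀, hz₀⟩ := hne
  have c₁ := continuous_pdx hU
  have c₂ := continuous_pdy hU
  set P : ℝ × ℝ → ℝ := fun z => pdx U z ^ 2 + pdy U z ^ 2 with hP
  have cP : Continuous P := by fun_prop
  have hPp : IsPeriodic P := fun z k l => by simp only [hP, hp₁ z k l, hp₂ z k l]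
  obtain ⟨k, l, hz₁⟩ := exists_int_shift_mem_unitSquare z
  set z₁ : ℝ × ℝ := (z.1 + k, z.2 + l)
  have hPz₁ : P z₁ ≤ 0 := (hPp z k l).trans_le (not_lt.1 hz)
  obtain ⟨α, β, y₀, hα, hαβ, hβ, hy₀, hseg⟩ := exists_segment_lt cP hPp
    (z₀ := z₀) (c := P z₀ / 2) (by simp only [hP]; linarith)
  set c₀ := P z₀ / 8 with hc₀
  have hc₀pos : 0 < c₀ := by simp only [hc₀, hP]; linarith
  obtain ⟨C₁, hC₁, C₂, hell⟩ := exists_normSq_le_sq_trace_sub_det hs₁₁.continuous hs₁₂.continuous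
    hs₂₂.continuous hpos hdet
  set d₁ : ℝ × ℝ → ℝ := fun z => pdx s₁₁ z + pdy s₁₂ z with hd₁
  set d₂ : ℝ × ℝ → ℝ := fun z => pdx s₁₂ z + pdy s₂₂ z with hd₂
  have cd : Continuous fun z => d₁ z ^ 2 + d₂ z ^ 2 :=
    (((continuous_pdx hs₁₁).add (continuous_pdy hs₁₂)).pow 2).add
      (((continuous_pdx hs₁₂).add (continuous_pdy hs₂₂)).pow 2)
  obtain ⟨N, hN⟩ := isCompact_unitSquare.bddAbove_image cd.continuousOn
  have hN' : ∀ z ∈ unitSquare, d₁ z ^ 2 + d₂ z ^ 2 ≤ N := fun z hz => hN (mem_image_of_mem _ hz)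
  have hN0 : 0 ≤ N := le_trans (by positivity) (hN' z₁ hz₁)
  have hM2 : 0 < 3 * C₁ * (N + 1) := by positivity
  obtain ⟨δ, hδ, hbound⟩ := exists_uniform_lower_bound (Real.sqrt_pos.2 hM2) C₂ hα hαβ hβ hy₀ hc₀pos
  rw [Real.sq_sqrt hM2.le] at hbound
  obtain ⟨κ, hκ, hκ1, hκ2⟩ : ∃ κ : ℝ, 0 < κ ∧ κ ^ 2 ≤ c₀ / 2 ∧ κ ^ 2 ≤ δ / 4 := by
    have hm : 0 < min (c₀ / 2) (δ / 4) := by positivity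
    refine ⟨√(min (c₀ / 2) (δ / 4)), Real.sqrt_pos.2 hm, ?_, ?_⟩ <;> rw [Real.sq_sqrt hm.le]
    · exact min_le_left _ _
    · exact min_le_right _ _
  obtain ⟨φ, hφ, hφc, hφ1⟩ := exists_mollifier
  have hφ' : ContDiff ℝ 1 φ := hφ.of_le (by exact_mod_cast le_top)
  have hκ4 : 0 < κ / 4 := by positivity
  have Q := isCompact_unitSquare
  obtain ⟨ε, E₁, E₂, E₃, E₄, E₅, E₆⟩ := (
    (eventually_abs_commutator_lt hφ' hφc hs₁₁ c₁ (1, 0) Q hκ4).and <|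
    (eventually_abs_commutator_lt hφ' hφc hs₁₂ c₂ (1, 0) Q hκ4).and <|
    (eventually_abs_commutator_lt hφ' hφc hs₁₂ c₁ (0, 1) Q hκ4).and <|
    (eventually_abs_commutator_lt hφ' hφc hs₂₂ c₂ (0, 1) Q hκ4).and <|
    (eventually_abs_mollify_sub_lt hφ.continuous hφc hφ1 c₁ Q hκ).and <|
    (eventually_abs_mollify_sub_lt hφ.continuous hφc hφ1 c₂ Q hκ)).exists
  have hη := contDiff_rescale hφ ε
  have hηc := hasCompactSupport_rescale hφc ε
  set η := rescale φ ε
  set a := mollify η (pdx U)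
  set b := mollify η (pdy U)
  have ha : ContDiff ℝ 2 a := contDiff_infty.1 (contDiff_mollify hη hηc c₁) 2
  have hb : ContDiff ℝ 2 b := contDiff_infty.1 (contDiff_mollify hη hηc c₂) 2
  have hsym : ∀ z, pdy a z = pdx b z :=
    pdy_mollify_pdx hU (contDiff_infty.1 hη 2) hηc
  have h11 : Continuous fun z => s₁₁ z * pdx U z := hs₁₁.continuous.mul c₁
  have h12 : Continuous fun z => s₁₂ z * pdy U z := hs₁₂.continuous.mul c₂
  have h21 : Continuous fun z => s₁₂ z * pdx U z := hs₁₂.continuous.mul c₁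
  have h22 : Continuous fun z => s₂₂ z * pdy U z := hs₂₂.continuous.mul c₂
  have hquasi : ∀ z ∈ unitSquare, pdx a z ^ 2 + pdy a z ^ 2 + pdx b z ^ 2 + pdy b z ^ 2
      ≤ 3 * C₁ * (N + 1) * (a z ^ 2 + b z ^ 2 + κ ^ 2) - C₂ * jac a b z := by
    intro z hz
    have hdf := hdiv.mollify (h11.add h12) (h21.add h22) hη hηc z
    have df : ∀ {f : ℝ × ℝ → ℝ}, Continuous f → DifferentiableAt ℝ (mollify η f) z := fun hf =>
      (contDiff_mollify hη hηc hf).differentiable (by simp) z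
    rw [mollify_add hη.continuous hηc h11 h12, mollify_add hη.continuous hηc h21 h22,
      pdx_add (df h11) (df h12), pdy_add (df h21) (df h22)] at hdf
    have e1 : |s₁₁ z * pdx a z - pdx (mollify η fun z => s₁₁ z * pdx U z) z + pdx s₁₁ z * a z|
      < κ / 4 := E₁ z hz
    have e2 : |s₁₂ z * pdx b z - pdx (mollify η fun z => s₁₂ z * pdy U z) z + pdx s₁₂ z * b z|
      < κ / 4 := E₂ z hz
    have e3 : |s₁₂ z * pdy a z - pdy (mollify η fun z => s₁₂ z * pdx U z) z + pdy s₁₂ z * a z|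
      < κ / 4 := E₃ z hz
    have e4 : |s₂₂ z * pdy b z - pdy (mollify η fun z => s₂₂ z * pdy U z) z + pdy s₂₂ z * b z|
      < κ / 4 := E₄ z hz
    rw [abs_lt] at e1 e2 e3 e4
    set τ := s₁₁ z * pdx a z + 2 * s₁₂ z * pdy a z + s₂₂ z * pdy b z with hτ
    have herr : |τ + (d₁ z * a z + d₂ z * b z)| ≤ κ := by
      have ht : τ + (d₁ z * a z + d₂ z * b z) =
          (s₁₁ z * pdx a z + s₁₂ z * pdx b z + s₁₂ z * pdy a z + s₂₂ z * pdy b z)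
          + (d₁ z * a z + d₂ z * b z) := by rw [hτ, ← hsym z]; ring
      rw [ht]
      simp only [hd₁, hd₂]
      rw [abs_le]
      constructor <;> linarith [e1.1, e1.2, e2.1, e2.2, e3.1, e3.2, e4.1, e4.2]
    have hτ2 := sq_le_of_abs_add_le (hN' z hz) herr
    have hfin := hell z hz (pdx a z) (pdy a z) (pdy b z)
    have hj : jac a b z = pdx a z * pdy b z - pdy a z ^ 2 := by rw [jac, ← hsym z]; ring
    rw [hj, ← hsym z]
    have := mul_le_mul_of_nonneg_left hτ2 hC₁.le
    rw [← mul_assoc, ← mul_assoc, mul_comm C₁ 3] at this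
    exact hfin.trans (sub_le_sub_right this _)
  have hlow : ∀ x ∈ Icc α β, c₀ ≤ a (x, y₀) ^ 2 + b (x, y₀) ^ 2 := by
    intro x hx
    have hmem : (x, y₀) ∈ unitSquare := ⟨⟨hα.trans hx.1, hx.2.trans hβ⟩, hy₀⟩
    have h1 := sq_le_of_abs_sub_lt (E₅ _ hmem)
    have h2 := sq_le_of_abs_sub_lt (E₆ _ hmem)
    have h3 : 4 * c₀ < pdx U (x, y₀) ^ 2 + pdy U (x, y₀) ^ 2 := by
      have := hseg x hx
      simp only [hP] at this ⊢
      rw [hc₀]; simp only [hP]; linarith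
    linarith
  have hfin := hbound a b ha hb hp₁.mollify hp₂.mollify κ hκ hquasi hlow z₁ hz₁
  have h1 := E₅ z₁ hz₁
  have h2 := E₆ z₁ hz₁
  have g1 : pdx U z₁ = 0 := by
    have : pdx U z₁ ^ 2 + pdy U z₁ ^ 2 ≤ 0 := hPz₁
    nlinarith [sq_nonneg (pdx U z₁), sq_nonneg (pdy U z₁)]
  have g2 : pdy U z₁ = 0 := by
    have : pdx U z₁ ^ 2 + pdy U z₁ ^ 2 ≤ 0 := hPz₁
    nlinarith [sq_nonneg (pdx U z₁), sq_nonneg (pdy U z₁)]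
  rw [g1, sub_zero] at h1
  rw [g2, sub_zero] at h2
  have h1' : a z₁ ^ 2 ≤ κ ^ 2 := by
    rw [← sq_abs]; exact pow_le_pow_left₀ (abs_nonneg _) h1.le 2
  have h2' : b z₁ ^ 2 ≤ κ ^ 2 := by
    rw [← sq_abs]; exact pow_le_pow_left₀ (abs_nonneg _) h2.le 2
  linarith

open Filter Topology

/-- The covector `a dx + b dy`. -/
noncomputable def covec (a b : ℝ) : ℝ × ℝ →L[ℝ] ℝ :=
  a • ContinuousLinearMap.fst ℝ ℝ ℝ + b • ContinuousLinearMap.snd ℝ ℝ ℝ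

lemma covec_apply (a b : ℝ) (w : ℝ × ℝ) : covec a b w = a * w.1 + b * w.2 := by
  simp [covec]

lemma norm_covec_le (a b : ℝ) : ‖covec a b‖ ≤ |a| + |b| := by
  refine ContinuousLinearMap.opNorm_le_bound _ (by positivity) fun w => ?_
  rw [covec_apply, add_mul]
  refine (norm_add_le _ _).trans (add_le_add ?_ ?_)
  · rw [norm_mul]
    exact mul_le_mul_of_nonneg_left (norm_fst_le w) (abs_nonneg _)
  · rw [norm_mul]
    exact mul_le_mul_of_nonneg_left (norm_snd_le w) (abs_nonneg _)

lemma covec_sub (a b c d : ℝ) : covec a b - covec c d = covec (a - c) (b - d) := by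
  ext <;> simp [covec]

lemma fderiv_apply_eq {f : ℝ × ℝ → ℝ} (z w : ℝ × ℝ) :
    fderiv ℝ f z w = pdx f z * w.1 + pdy f z * w.2 := by
  have : w = w.1 • ((1 : ℝ), (0 : ℝ)) + w.2 • ((0 : ℝ), (1 : ℝ)) := by ext <;> simp
  conv_lhs => rw [this]
  rw [map_add, map_smul, map_smul]
  simp [pdx, pdy, mul_comm]

/-- The Poincaré lemma for smooth fields in the plane. -/
lemma exists_hasFDerivAt_covec {m₁ m₂ : ℝ × ℝ → ℝ} (h₁ : Differentiable ℝ m₁)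
    (h₂ : Differentiable ℝ m₂) (h : ∀ z, pdx m₁ z + pdy m₂ z = 0) :
    ∃ f : ℝ × ℝ → ℝ, f 0 = 0 ∧ ∀ z, HasFDerivAt f (covec (-m₂ z) (m₁ z)) z := by
  have hd : ∀ z, HasFDerivAt (fun z => covec (-m₂ z) (m₁ z))
      ((-fderiv ℝ m₂ z).smulRight (ContinuousLinearMap.fst ℝ ℝ ℝ)
        + (fderiv ℝ m₁ z).smulRight (ContinuousLinearMap.snd ℝ ℝ ℝ)) z := fun z =>
    ((h₂ z).hasFDerivAt.neg.smul_const (ContinuousLinearMap.fst ℝ ℝ ℝ)).add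
      ((h₁ z).hasFDerivAt.smul_const (ContinuousLinearMap.snd ℝ ℝ ℝ))
  obtain ⟨f, hf⟩ := convex_univ.exists_forall_hasFDerivAt_of_fderiv_symmetric
    (ω := fun z => covec (-m₂ z) (m₁ z)) isOpen_univ
    (fun z _ => (hd z).differentiableAt.differentiableWithinAt) (by
      intro z _ v w
      rw [(hd z).fderiv]
      simp only [add_apply, ContinuousLinearMap.smulRight_apply,
        neg_apply, smul_apply,
        ContinuousLinearMap.coe_fst', ContinuousLinearMap.coe_snd', smul_eq_mul,
        fderiv_apply_eq]
      linear_combination (v.1 * w.2 - v.2 * w.1) * h z)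
  exact ⟨fun z => f z - f 0, sub_self _, fun z => (hf z (mem_univ z)).sub_const _⟩

/-- A continuous field that is divergence free in the sense of distributions has a stream
function. -/
theorem exists_stream_function {q₁ q₂ : ℝ × ℝ → ℝ} (c₁ : Continuous q₁) (c₂ : Continuous q₂)
    (h : IsWeaklyDivFree q₁ q₂) :
    ∃ V : ℝ × ℝ → ℝ, ∀ z, HasFDerivAt V (covec (-q₂ z) (q₁ z)) z := by
  obtain ⟨φ, hφ, hc, h1⟩ := exists_mollifier
  have hs : ∀ ε, ContDiff ℝ (⊤ : ℕ∞) (rescale φ ε) := contDiff_rescale hφ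
  have hcs : ∀ ε, HasCompactSupport (rescale φ ε) := hasCompactSupport_rescale hc
  have hd : ∀ ε {f : ℝ × ℝ → ℝ}, Continuous f → Differentiable ℝ (mollify (rescale φ ε) f) :=
    fun ε f hf => (contDiff_mollify (hs ε) (hcs ε) hf).differentiable (by simp)
  choose F hF0 hF using fun ε => exists_hasFDerivAt_covec (hd ε c₁) (hd ε c₂)
    (h.mollify c₁ c₂ (hs ε) (hcs ε))
  set ω : ℝ → ℝ × ℝ → (ℝ × ℝ →L[ℝ] ℝ) := fun ε z =>
    covec (-mollify (rescale φ ε) q₂ z) (mollify (rescale φ ε) q₁ z)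
  have hu : ∀ Q : Set (ℝ × ℝ), IsCompact Q →
      TendstoUniformlyOn ω (fun z => covec (-q₂ z) (q₁ z)) (𝓝[>] 0) Q := by
    intro Q hQ
    rw [Metric.tendstoUniformlyOn_iff]
    intro δ hδ
    filter_upwards [eventually_abs_mollify_sub_lt hφ.continuous hc h1 c₁ hQ (half_pos hδ),
      eventually_abs_mollify_sub_lt hφ.continuous hc h1 c₂ hQ (half_pos hδ)] with ε e₁ e₂ z hz
    rw [dist_comm, dist_eq_norm, covec_sub]
    refine (norm_covec_le _ _).trans_lt ?_
    have h₁ := e₁ z hz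
    have h₂ := e₂ z hz
    rw [neg_sub_neg, abs_sub_comm]
    linarith
  have hlim : ∀ z, ∃ l, Tendsto (fun ε => F ε z) (𝓝[>] 0) (𝓝 l) := by
    intro z
    refine CompleteSpace.complete (cauchy_map_of_uniformCauchySeqOn_fderiv
      (s := Metric.ball 0 (‖z‖ + 1)) Metric.isOpen_ball (convex_ball _ _).isPreconnected
      ((hu _ (isCompact_closedBall 0 (‖z‖ + 1))).mono Metric.ball_subset_closedBall
        |>.uniformCauchySeqOn) (fun ε y _ => hF ε y) (x₀ := 0) ?_ ?_ ?_)
    · exact Metric.mem_ball_self (by positivity)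
    · simp
    · simp only [hF0]
      exact tendsto_const_nhds.cauchy_map
  choose V hV using hlim
  refine ⟨V, fun z => hasFDerivAt_of_tendstoLocallyUniformlyOn (g' := fun z => covec (-q₂ z) (q₁ z))
    (l := 𝓝[>] (0 : ℝ)) (s := univ) isOpen_univ ?_ (fun ε y _ => hF ε y) (fun y _ => hV y)
    (mem_univ z)⟩
  rw [tendstoLocallyUniformlyOn_iff_forall_isCompact isOpen_univ]
  exact fun K _ hK => hu K hK

lemma sub_shift_eq_const {V : ℝ × ℝ → ℝ} (hV : Differentiable ℝ V) (w : ℝ × ℝ)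
    (hp : ∀ z, fderiv ℝ V (z + w) = fderiv ℝ V z) (z z' : ℝ × ℝ) :
    V (z + w) - V z = V (z' + w) - V z' := by
  have hs : Differentiable ℝ fun z => V (z + w) := hV.comp (differentiable_id.add_const w)
  refine is_const_of_fderiv_eq_zero (𝕜 := ℝ) (hs.sub hV) (fun y => ?_) z z'
  rw [fderiv_sub (hs y) (hV y), fderiv_comp_add_right, hp, sub_self]

lemma shift_fst_eq {V : ℝ × ℝ → ℝ} (hV : ContDiff ℝ 1 V) (hp : IsPeriodic (fderiv ℝ V))
    (h0 : ∫ z in unitSquare, pdx V z = 0) (z : ℝ × ℝ) : V (z.1 + 1, z.2) = V z := by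
  have hd := hV.differentiable one_ne_zero
  have hc : ∀ y, ∫ x in Icc (0 : ℝ) 1, pdx V (x, y) = V (z.1 + 1, z.2) - V z := by
    intro y
    rw [integral_Icc_eq_integral_Ioc, ← intervalIntegral.integral_of_le zero_le_one,
      intervalIntegral.integral_eq_sub_of_hasDerivAt (fun x _ => hasDerivAt_pdx hd x y)
        ((continuous_pdx hV).comp (by fun_prop : Continuous fun x : ℝ => (x, y))
          |>.intervalIntegrable _ _)]
    have := sub_shift_eq_const hd (1, 0) (fun w => by simpa [Prod.add_def] using hp w 1 0) (0, y) z
    simpa [Prod.add_def] using this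
  rw [← integral_slices_fst (continuous_pdx hV)] at h0
  simp only [hc] at h0
  simp at h0
  linarith

lemma shift_snd_eq {V : ℝ × ℝ → ℝ} (hV : ContDiff ℝ 1 V) (hp : IsPeriodic (fderiv ℝ V))
    (h0 : ∫ z in unitSquare, pdy V z = 0) (z : ℝ × ℝ) : V (z.1, z.2 + 1) = V z := by
  have hd := hV.differentiable one_ne_zero
  have hc : ∀ x, ∫ y in Icc (0 : ℝ) 1, pdy V (x, y) = V (z.1, z.2 + 1) - V z := by
    intro x
    rw [integral_Icc_eq_integral_Ioc, ← intervalIntegral.integral_of_le zero_le_one,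
      intervalIntegral.integral_eq_sub_of_hasDerivAt (fun y _ => hasDerivAt_pdy hd x y)
        ((continuous_pdy hV).comp (by fun_prop : Continuous fun y : ℝ => (x, y))
          |>.intervalIntegrable _ _)]
    have := sub_shift_eq_const hd (0, 1) (fun w => by simpa [Prod.add_def] using hp w 0 1) (x, 0) z
    simpa [Prod.add_def] using this
  rw [← integral_slices_snd (continuous_pdy hV)] at h0
  simp only [hc] at h0
  simp at h0
  linarith

lemma exists_fderiv_eq_zero {V : ℝ × ℝ → ℝ} (hV : ContDiff ℝ 1 V)
    (hp : IsPeriodic (fderiv ℝ V)) (hx : ∫ z in unitSquare, pdx V z = 0)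
    (hy : ∫ z in unitSquare, pdy V z = 0) : ∃ z, fderiv ℝ V z = 0 := by
  have hper : IsPeriodic V := by
    intro z k l
    have h₁ : Function.Periodic (fun s => V (s, z.2 + l)) 1 :=
      fun s => shift_fst_eq hV hp hx (s, z.2 + l)
    have h₂ : Function.Periodic (fun s => V (z.1, s)) 1 := fun s => shift_snd_eq hV hp hy (z.1, s)
    have e₁ := h₁.int_mul k z.1
    have e₂ := h₂.int_mul l z.2
    simp only [mul_one] at e₁ e₂
    exact e₁.trans e₂
  obtain ⟨z, -, hz⟩ := isCompact_unitSquare.exists_isMaxOn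
    ⟨(0, 0), by simp [unitSquare]⟩ hV.continuous.continuousOn
  refine ⟨z, IsLocalMax.fderiv_eq_zero (Filter.Eventually.of_forall fun w => ?_)⟩
  obtain ⟨k, l, hkl⟩ := exists_int_shift_mem_unitSquare w
  exact (hper w k l).symm.trans_le (hz hkl)

/-- The stream function of `σ∇U`, for a divergence form elliptic equation with periodic
coefficients. -/
theorem exists_conjugate {U s₁₁ s₁₂ s₂₂ : ℝ × ℝ → ℝ} (hU : ContDiff ℝ 1 U)
    (hp : IsPeriodic (fderiv ℝ U)) (hs₁₁ : ContDiff ℝ 1 s₁₁) (hs₁₂ : ContDiff ℝ 1 s₁₂)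
    (hs₂₂ : ContDiff ℝ 1 s₂₂) (hp₁₁ : IsPeriodic s₁₁) (hp₁₂ : IsPeriodic s₁₂)
    (hp₂₂ : IsPeriodic s₂₂) (hpos : ∀ z, 0 < s₁₁ z)
    (hdet : ∀ z, 0 < s₁₁ z * s₂₂ z - s₁₂ z ^ 2)
    (hdiv : IsWeaklyDivFree (fun z => s₁₁ z * pdx U z + s₁₂ z * pdy U z)
      (fun z => s₁₂ z * pdx U z + s₂₂ z * pdy U z))
    (hne : ∃ z, fderiv ℝ U z ≠ 0) :
    ∃ V : ℝ × ℝ → ℝ, ContDiff ℝ 1 V ∧ IsPeriodic (fderiv ℝ V) ∧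
      ¬ (∫ z in unitSquare, pdx V z = 0 ∧ ∫ z in unitSquare, pdy V z = 0) ∧
      ∀ z, 0 < pdx U z * pdy V z - pdy U z * pdx V z := by
  have hp₁ : IsPeriodic (pdx U) := fun z k l => by rw [pdx, hp z k l, pdx]
  have hp₂ : IsPeriodic (pdy U) := fun z k l => by rw [pdy, hp z k l, pdy]
  have hcx := continuous_pdx hU
  have hcy := continuous_pdy hU
  have c₁ : Continuous (fun z => s₁₁ z * pdx U z + s₁₂ z * pdy U z) :=
    (hs₁₁.continuous.mul hcx).add (hs₁₂.continuous.mul hcy)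
  have c₂ : Continuous (fun z => s₁₂ z * pdx U z + s₂₂ z * pdy U z) :=
    (hs₁₂.continuous.mul hcx).add (hs₂₂.continuous.mul hcy)
  have hne' : ∃ z, 0 < pdx U z ^ 2 + pdy U z ^ 2 := by
    obtain ⟨z, hz⟩ := hne
    refine ⟨z, ?_⟩
    by_contra! h
    have h₁ : pdx U z = 0 := by nlinarith [sq_nonneg (pdx U z), sq_nonneg (pdy U z)]
    have h₂ : pdy U z = 0 := by nlinarith [sq_nonneg (pdx U z), sq_nonneg (pdy U z)]
    exact hz (ContinuousLinearMap.ext fun w => by simp [fderiv_apply_eq, h₁, h₂])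
  have hP := normSq_grad_pos hU hp₁ hp₂ hs₁₁ hs₁₂ hs₂₂ hpos hdet hdiv hne'
  obtain ⟨V, hV⟩ := exists_stream_function c₁ c₂ hdiv
  have hfd := fun z => (hV z).fderiv
  have hx : ∀ z, pdx V z = -(s₁₂ z * pdx U z + s₂₂ z * pdy U z) := fun z => by
    simp [pdx, hfd, covec_apply]
  have hy : ∀ z, pdy V z = s₁₁ z * pdx U z + s₁₂ z * pdy U z := fun z => by
    simp [pdy, hfd, covec_apply]
  have hVC : ContDiff ℝ 1 V := by
    refine contDiff_one_iff_fderiv.2 ⟨fun z => (hV z).differentiableAt, ?_⟩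
    rw [funext hfd]
    exact (c₂.neg.smul continuous_const).add (c₁.smul continuous_const)
  have hVp : IsPeriodic (fderiv ℝ V) := fun z k l => by
    rw [hfd, hfd, hp₁ z k l, hp₂ z k l, hp₁₁ z k l, hp₁₂ z k l, hp₂₂ z k l]
  have hJ : ∀ z, 0 < pdx U z * pdy V z - pdy U z * pdx V z := by
    intro z
    rw [hx, hy]
    have h₁ := hpos z
    have h₂ := hdet z
    refine pos_of_mul_pos_right (a := s₁₁ z) ?_ h₁.le
    have e : s₁₁ z * (pdx U z * (s₁₁ z * pdx U z + s₁₂ z * pdy U z)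
        - pdy U z * -(s₁₂ z * pdx U z + s₂₂ z * pdy U z))
        = (s₁₁ z * pdx U z + s₁₂ z * pdy U z) ^ 2
          + (s₁₁ z * s₂₂ z - s₁₂ z ^ 2) * pdy U z ^ 2 := by ring
    rw [e]
    rcases eq_or_ne (pdy U z) 0 with h0 | h0
    · have := hP z
      have h3 : pdx U z ≠ 0 := by rintro h3; simp [h0, h3] at this
      rw [h0]
      simp only [mul_zero, add_zero, ne_eq, OfNat.ofNat_ne_zero, not_false_eq_true, zero_pow]
      positivity
    · positivity
  refine ⟨V, hVC, hVp, fun h => ?_, hJ⟩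
  obtain ⟨z, hz⟩ := exists_fderiv_eq_zero hVC hVp h.1 h.2
  have := hJ z
  simp [pdx, pdy, hz] at this

/-- The identification of `ℝ × ℝ` with the Euclidean plane. -/
noncomputable def euclideanOfProd : (ℝ × ℝ) ≃L[ℝ] EuclideanSpace ℝ (Fin 2) :=
  (ContinuousLinearEquiv.finTwoArrow ℝ ℝ).symm.trans
    (PiLp.continuousLinearEquiv 2 ℝ fun _ : Fin 2 => ℝ).symm

lemma euclideanOfProd_apply_zero (z : ℝ × ℝ) : euclideanOfProd z 0 = z.1 := rfl

lemma euclideanOfProd_apply_one (z : ℝ × ℝ) : euclideanOfProd z 1 = z.2 := rfl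

lemma euclideanOfProd_shift (z : ℝ × ℝ) (k : Fin 2 → ℤ) :
    euclideanOfProd (z.1 + k 0, z.2 + k 1)
      = euclideanOfProd z + (WithLp.equiv 2 (Fin 2 → ℝ)).symm (fun i => (k i : ℝ)) := by
  ext i
  fin_cases i <;> rfl

lemma measurePreserving_euclideanOfProd : MeasurePreserving euclideanOfProd :=
  (PiLp.volume_preserving_toLp (Fin 2)).comp (volume_preserving_finTwoArrow ℝ).symm

lemma measurableEmbedding_euclideanOfProd : MeasurableEmbedding euclideanOfProd :=
  euclideanOfProd.toHomeomorph.measurableEmbedding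

lemma euclideanOfProd_preimage_cube :
    euclideanOfProd ⁻¹' {x | ∀ i, x i ∈ Icc (0 : ℝ) 1} = unitSquare := by
  ext z
  simp only [unitSquare, mem_preimage, mem_ofPred_eq, Fin.forall_fin_two, mem_prod,
    euclideanOfProd_apply_zero, euclideanOfProd_apply_one]

lemma setIntegral_cube {G : Type*} [NormedAddCommGroup G] [NormedSpace ℝ G]
    (g : EuclideanSpace ℝ (Fin 2) → G) :
    ∫ x in {x : EuclideanSpace ℝ (Fin 2) | ∀ i, x i ∈ Icc (0 : ℝ) 1}, g x
      = ∫ z in unitSquare, g (euclideanOfProd z) := by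
  rw [← euclideanOfProd_preimage_cube]
  exact (measurePreserving_euclideanOfProd.setIntegral_preimage_emb
    measurableEmbedding_euclideanOfProd g _).symm

lemma euclideanOfProd_one_zero : euclideanOfProd (1, 0) = EuclideanSpace.single 0 1 := by
  ext i
  fin_cases i <;> simp [euclideanOfProd_apply_zero, euclideanOfProd_apply_one]

lemma euclideanOfProd_zero_one : euclideanOfProd (0, 1) = EuclideanSpace.single 1 1 := by
  ext i
  fin_cases i <;> simp [euclideanOfProd_apply_zero, euclideanOfProd_apply_one]

lemma gradient_apply (f : EuclideanSpace ℝ (Fin 2) → ℝ) (x : EuclideanSpace ℝ (Fin 2))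
    (i : Fin 2) : gradient f x i = fderiv ℝ f x (EuclideanSpace.single i 1) := by
  rw [← inner_gradient_left (𝕜 := ℝ), EuclideanSpace.inner_single_right]
  simp

lemma fderiv_comp_euclideanOfProd (f : EuclideanSpace ℝ (Fin 2) → ℝ) (z w : ℝ × ℝ) :
    fderiv ℝ (f ∘ euclideanOfProd) z w = fderiv ℝ f (euclideanOfProd z) (euclideanOfProd w) := by
  rw [euclideanOfProd.comp_right_fderiv]
  rfl

lemma pdx_comp_euclideanOfProd (f : EuclideanSpace ℝ (Fin 2) → ℝ) (z : ℝ × ℝ) :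
    pdx (f ∘ euclideanOfProd) z = gradient f (euclideanOfProd z) 0 := by
  rw [pdx, fderiv_comp_euclideanOfProd, euclideanOfProd_one_zero, gradient_apply]

lemma pdy_comp_euclideanOfProd (f : EuclideanSpace ℝ (Fin 2) → ℝ) (z : ℝ × ℝ) :
    pdy (f ∘ euclideanOfProd) z = gradient f (euclideanOfProd z) 1 := by
  rw [pdy, fderiv_comp_euclideanOfProd, euclideanOfProd_zero_one, gradient_apply]

lemma isPeriodic_fderiv_comp_euclideanOfProd_iff {f : EuclideanSpace ℝ (Fin 2) → ℝ} :
    IsPeriodic (fderiv ℝ (f ∘ euclideanOfProd)) ↔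
      ∀ (x : EuclideanSpace ℝ (Fin 2)) (k : Fin 2 → ℤ),
        gradient f (x + (WithLp.equiv 2 (Fin 2 → ℝ)).symm (fun i => (k i : ℝ)))
          = gradient f x := by
  constructor
  · intro h x k
    obtain ⟨z, rfl⟩ := euclideanOfProd.surjective x
    have := h z (k 0) (k 1)
    rw [← euclideanOfProd_shift]
    ext i
    fin_cases i
    · simp only [Fin.zero_eta, ← pdx_comp_euclideanOfProd, pdx, this]
    · simp only [Fin.mk_one, ← pdy_comp_euclideanOfProd, pdy, this]
  · intro h z k l
    have := h (euclideanOfProd z) ![k, l]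
    rw [← euclideanOfProd_shift] at this
    simp only [Matrix.cons_val_zero, Matrix.cons_val_one] at this
    refine ContinuousLinearMap.ext fun w => ?_
    simp only [fderiv_apply_eq, pdx_comp_euclideanOfProd, pdy_comp_euclideanOfProd, this]

end PeriodicPlane

open PeriodicPlane

/-- **Theorem 2.2** (necessity): if `∇u` is `ℤ²`-periodic with nonzero average and is realizable
with a smooth `ℤ²`-periodic symmetric positive definite matrix conductivity, then there is a
`C¹` function `v` with `ℤ²`-periodic gradient and nonzero average such that
`det(∇u, ∇v) = R⊥∇u · ∇v > 0` everywhere in `ℝ²`. -/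
theorem exists_conjugate_of_periodic_realizable
    (u : EuclideanSpace ℝ (Fin 2) → ℝ) (hu : ContDiff ℝ 1 u)
    (hper : ∀ (x : EuclideanSpace ℝ (Fin 2)) (k : Fin 2 → ℤ),
      gradient u (x + (WithLp.equiv 2 (Fin 2 → ℝ)).symm (fun i => (k i : ℝ))) = gradient u x)
    (havg : (∫ x in {x : EuclideanSpace ℝ (Fin 2) | ∀ i, x i ∈ Set.Icc (0:ℝ) 1},
      gradient u x) ≠ 0)
    (σ : EuclideanSpace ℝ (Fin 2) → Matrix (Fin 2) (Fin 2) ℝ)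
    (hσsmooth : ∀ i j, ContDiff ℝ (⊤ : ℕ∞) fun x => σ x i j)
    (hσper : ∀ (x : EuclideanSpace ℝ (Fin 2)) (k : Fin 2 → ℤ),
      σ (x + (WithLp.equiv 2 (Fin 2 → ℝ)).symm (fun i => (k i : ℝ))) = σ x)
    (hσsym : ∀ x, (σ x).IsSymm)
    (hσpos : ∀ x, (σ x).PosDef)
    (hdiv : ∀ φ : EuclideanSpace ℝ (Fin 2) → ℝ, ContDiff ℝ (⊤ : ℕ∞) φ → HasCompactSupport φ →
      (∫ x : EuclideanSpace ℝ (Fin 2),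
        ∑ i, (∑ j, σ x i j * gradient u x j) * gradient φ x i) = 0) :
    ∃ v : EuclideanSpace ℝ (Fin 2) → ℝ, ContDiff ℝ 1 v ∧
      (∀ (x : EuclideanSpace ℝ (Fin 2)) (k : Fin 2 → ℤ),
        gradient v (x + (WithLp.equiv 2 (Fin 2 → ℝ)).symm (fun i => (k i : ℝ))) = gradient v x) ∧
      (∫ x in {x : EuclideanSpace ℝ (Fin 2) | ∀ i, x i ∈ Set.Icc (0:ℝ) 1},
        gradient v x) ≠ 0 ∧
      ∀ x, 0 < gradient u x 0 * gradient v x 1 - gradient u x 1 * gradient v x 0 := by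
  have hs : ∀ i j, ContDiff ℝ 1 fun z => σ (euclideanOfProd z) i j := fun i j =>
    ((hσsmooth i j).of_le (by exact_mod_cast le_top)).comp euclideanOfProd.contDiff
  have hsp : ∀ i j, IsPeriodic fun z => σ (euclideanOfProd z) i j := fun i j z k l => by
    have := hσper (euclideanOfProd z) ![k, l]
    rw [← euclideanOfProd_shift] at this
    simpa using congr_fun (congr_fun this i) j
  have hne : ∃ z, fderiv ℝ (u ∘ euclideanOfProd) z ≠ 0 := by
    by_contra! h
    have h0 : ∀ x, gradient u x = 0 := fun x => by
      obtain ⟨z, rfl⟩ := euclideanOfProd.surjective x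
      ext i
      fin_cases i
      · simp [← pdx_comp_euclideanOfProd, pdx, h]
      · simp [← pdy_comp_euclideanOfProd, pdy, h]
    simp [h0] at havg
  have hweak : IsWeaklyDivFree
      (fun z => σ (euclideanOfProd z) 0 0 * pdx (u ∘ euclideanOfProd) z
        + σ (euclideanOfProd z) 0 1 * pdy (u ∘ euclideanOfProd) z)
      (fun z => σ (euclideanOfProd z) 0 1 * pdx (u ∘ euclideanOfProd) z
        + σ (euclideanOfProd z) 1 1 * pdy (u ∘ euclideanOfProd) z) := by
    intro ψ hψ hc
    have := hdiv (ψ ∘ euclideanOfProd.symm) (hψ.comp euclideanOfProd.symm.contDiff)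
      (hc.comp_homeomorph euclideanOfProd.symm.toHomeomorph)
    rw [← measurePreserving_euclideanOfProd.integral_comp measurableEmbedding_euclideanOfProd] at this
    rw [← this]
    congr 1 with z
    have hψe : ψ = (ψ ∘ euclideanOfProd.symm) ∘ euclideanOfProd := by ext; simp
    conv_lhs => rw [hψe]
    simp only [pdx_comp_euclideanOfProd, pdy_comp_euclideanOfProd, Fin.sum_univ_two,
      (hσsym (euclideanOfProd z)).apply 0 1]
  obtain ⟨V, hV, hVp, hVint, hJ⟩ := exists_conjugate (hu.comp euclideanOfProd.contDiff)
    (isPeriodic_fderiv_comp_euclideanOfProd_iff.2 hper) (hs 0 0) (hs 0 1) (hs 1 1) (hsp 0 0) (hsp 0 1)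
    (hsp 1 1) (fun z => (hσpos _).diag_pos) (fun z => by
      have := (hσpos (euclideanOfProd z)).det_pos
      rw [Matrix.det_fin_two, (hσsym (euclideanOfProd z)).apply 0 1] at this
      linarith) hweak hne
  have hVe : V = (V ∘ euclideanOfProd.symm) ∘ euclideanOfProd := by ext; simp
  have hv : ContDiff ℝ 1 (V ∘ euclideanOfProd.symm) := hV.comp euclideanOfProd.symm.contDiff
  rw [hVe] at hVp hVint hJ
  refine ⟨V ∘ euclideanOfProd.symm, hv, isPeriodic_fderiv_comp_euclideanOfProd_iff.1 hVp,
    fun h0 => hVint ?_, fun x => ?_⟩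
  · rw [setIntegral_cube] at h0
    have hi : IntegrableOn (fun z => gradient (V ∘ euclideanOfProd.symm) (euclideanOfProd z))
        unitSquare := by
      refine ContinuousOn.integrableOn_compact isCompact_unitSquare (Continuous.continuousOn ?_)
      exact ((InnerProductSpace.toDual ℝ _).symm.continuous.comp
        (hv.continuous_fderiv one_ne_zero)).comp euclideanOfProd.continuous
    have hcoord : ∀ i : Fin 2,
        ∫ z in unitSquare, gradient (V ∘ euclideanOfProd.symm) (euclideanOfProd z) i = 0 := fun i => by
      have := (EuclideanSpace.proj i : EuclideanSpace ℝ (Fin 2) →L[ℝ] ℝ).integral_comp_comm hi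
      rw [h0] at this
      simpa using this
    exact ⟨by simpa only [pdx_comp_euclideanOfProd] using hcoord 0,
      by simpa only [pdy_comp_euclideanOfProd] using hcoord 1⟩
  · obtain ⟨z, rfl⟩ := euclideanOfProd.surjective x
    simpa only [pdx_comp_euclideanOfProd, pdy_comp_euclideanOfProd] using hJ z
end

section
/- Let u : ℝ^d → ℝ be twice continuously differentiable with ∇u ℤ^d-periodic, ⟨∇u⟩ ≠ 0, and ∇u(x) ≠ 0 for every x. Let X : ℝ × ℝ^d → ℝ^d be continuously differentiable with X(0,x) = x, ∂X/∂t(t,x) = ∇u(X(t,x)) for all (t,x), and X(s, X(t,x)) = X(s+t,x) for all s,t ∈ ℝ and x ∈ ℝ^d. Let ν ∈ ℝ^d be a unit vector, h ∈ ℝ, and H := {x ∈ ℝ^d : x·ν = h}. Assume there is a function τ_H : ℝ^d → ℝ such that for every x ∈ ℝ^d, τ_H(x) is the unique time t ∈ ℝ with X(t,x) ∈ H, and assume ∇u(X(τ_H(x),x)) · ν ≠ 0 for every x. Then there exists a continuous function σ : ℝ^d → ℝ with σ(x) > 0 for all x such that ∫_{ℝ^d} σ (∇u · ∇φ) dx =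 0 for every φ ∈ C_c^∞(ℝ^d). (Proposition 2.1: global isotropic realizability under the transversal hyperplane condition.) -/
open MeasureTheory
open scoped RealInnerProductSpace

section Flow

variable {E : Type*} [NormedAddCommGroup E] [NormedSpace ℝ E]

/-- The Jacobian determinant of the time-`p.1` map `y ↦ X (p.1, y)` at `p.2`. -/
noncomputable def flowJacobian (X : ℝ × E → E) (p : ℝ × E) : ℝ :=
  ((fderiv ℝ X p).comp (ContinuousLinearMap.inr ℝ ℝ E)).det

theorem hasFDerivAt_flow_space {X : ℝ × E → E} (hX : ContDiff ℝ 1 X) (t : ℝ) (x : E) :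
    HasFDerivAt (fun y => X (t, y))
      ((fderiv ℝ X (t, x)).comp (ContinuousLinearMap.inr ℝ ℝ E)) x :=
  ((hX.differentiable one_ne_zero) (t, x)).hasFDerivAt.comp x (hasFDerivAt_prodMk_right t x)

theorem continuous_flowJacobian {X : ℝ × E → E} (hX : ContDiff ℝ 1 X) :
    Continuous (flowJacobian X) :=
  ContinuousLinearMap.continuous_det.comp
    ((hX.continuous_fderiv one_ne_zero).clm_comp continuous_const)

/-- The cocycle property of the Jacobian of a flow. -/
theorem flowJacobian_add {X : ℝ × E → E} (hX : ContDiff ℝ 1 X)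
    (hadd : ∀ s t x, X (s, X (t, x)) = X (s + t, x)) (s t : ℝ) (x : E) :
    flowJacobian X (s + t, x) = flowJacobian X (s, X (t, x)) * flowJacobian X (t, x) := by
  have hcomp := (hasFDerivAt_flow_space hX s (X (t, x))).comp x (hasFDerivAt_flow_space hX t x)
  have heq : (fun y => X (s, y)) ∘ (fun y => X (t, y)) = fun y => X (s + t, y) :=
    funext fun y => hadd s t y
  rw [heq] at hcomp
  have huniq := (hasFDerivAt_flow_space hX (s + t) x).unique hcomp
  simp only [flowJacobian]
  rw [huniq]
  exact LinearMap.det_comp _ _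

theorem flowJacobian_zero {X : ℝ × E → E} (hX : ContDiff ℝ 1 X) (h0 : ∀ x, X (0, x) = x)
    (x : E) : flowJacobian X (0, x) = 1 := by
  have hid := hasFDerivAt_flow_space hX 0 x
  simp only [h0] at hid
  simp only [flowJacobian]
  rw [hid.unique (hasFDerivAt_id x)]
  exact LinearMap.det_id

theorem flowJacobian_ne_zero {X : ℝ × E → E} (hX : ContDiff ℝ 1 X) (h0 : ∀ x, X (0, x) = x)
    (hadd : ∀ s t x, X (s, X (t, x)) = X (s + t, x)) (t : ℝ) (x : E) :
    flowJacobian X (t, x) ≠ 0 := by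
  intro hzero
  have h1 := flowJacobian_add hX hadd (-t) t x
  rw [neg_add_cancel, flowJacobian_zero hX h0, hzero, mul_zero] at h1
  exact one_ne_zero h1

/-- If `|J| σ ∘ X_t = σ` for the Jacobian `J` of the time-`t` map `X_t` of a flow, then the measure
with density `σ` is invariant under `X_t`. -/
theorem integral_mul_comp_flow [FiniteDimensional ℝ E] [MeasurableSpace E] [BorelSpace E]
    (μ : Measure E) [μ.IsAddHaarMeasure] {X : ℝ × E → E} (hX : ContDiff ℝ 1 X)
    (h0 : ∀ x, X (0, x) = x) (hadd : ∀ s t x, X (s, X (t, x)) = X (s + t, x))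
    {σ : E → ℝ} (t : ℝ) (hσ : ∀ x, |flowJacobian X (t, x)| * σ (X (t, x)) = σ x) (φ : E → ℝ) :
    ∫ x, σ x * φ (X (t, x)) ∂μ = ∫ x, σ x * φ x ∂μ := by
  have hleft : Function.LeftInverse (fun y => X (-t, y)) (fun y => X (t, y)) := fun y => by
    simp [hadd, h0]
  have hright : Function.RightInverse (fun y => X (-t, y)) (fun y => X (t, y)) := fun y => by
    simp [hadd, h0]
  have hcv := integral_image_eq_integral_abs_det_fderiv_smul μ MeasurableSet.univ
    (fun x _ => (hasFDerivAt_flow_space hX t x).hasFDerivWithinAt)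
    hleft.injective.injOn (fun y => σ y * φ y)
  rw [Set.image_univ, hright.surjective.range_eq, setIntegral_univ, setIntegral_univ] at hcv
  rw [hcv]
  refine integral_congr_ae (Filter.Eventually.of_forall fun x => ?_)
  simp only [smul_eq_mul]
  rw [← mul_assoc]
  exact congrArg (· * φ (X (t, x))) (hσ x).symm

/-- A continuous density invariant under a flow with velocity field `b` is weakly divergence free
along `b`. -/
theorem integral_mul_fderiv_eq_zero_of_flow_invariant [FiniteDimensional ℝ E] [MeasurableSpace E]
    [BorelSpace E] (μ : Measure E) [IsFiniteMeasureOnCompacts μ] {X : ℝ × E → E}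
    (hXc : Continuous X) (h0 : ∀ x, X (0, x) = x)
    (hadd : ∀ s t x, X (s, X (t, x)) = X (s + t, x)) {b : E → E} (hb : Continuous b)
    (hXt : ∀ t x, HasDerivAt (fun s => X (s, x)) (b (X (t, x))) t)
    {σ φ : E → ℝ} (hσ : Continuous σ) (hφ : ContDiff ℝ 1 φ) (hφc : HasCompactSupport φ)
    (hinv : ∀ t, ∫ x, σ x * φ (X (t, x)) ∂μ = ∫ x, σ x * φ x ∂μ) :
    ∫ x, σ x * fderiv ℝ φ x (b x) ∂μ = 0 := by
  set G : ℝ × E → ℝ := fun p => σ p.2 * fderiv ℝ φ (X p) (b (X p)) with hG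
  have hGc : Continuous G := (hσ.comp continuous_snd).mul
    (((hφ.continuous_fderiv one_ne_zero).comp hXc).clm_apply (hb.comp hXc))
  set K : Set E := X '' (Set.Icc (-1) 1 ×ˢ tsupport φ)
  have hKc : IsCompact K := (isCompact_Icc.prod hφc).image hXc
  have hzero : ∀ t ∈ Set.Icc (-1 : ℝ) 1, ∀ x ∉ K, G (t, x) = 0 := by
    intro t ht x hx
    have hnot : X (t, x) ∉ tsupport φ := fun hmem =>
      hx ⟨(-t, X (t, x)), ⟨⟨by linarith [ht.2], by linarith [ht.1]⟩, hmem⟩, by simp [hadd, h0]⟩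
    simp [hG, fderiv_of_notMem_tsupport ℝ hnot]
  obtain ⟨C, hC⟩ := ((isCompact_Icc (a := (-1 : ℝ)) (b := 1)).prod hKc).exists_bound_of_continuousOn
    hGc.continuousOn
  have hderiv := (hasDerivAt_integral_of_dominated_loc_of_deriv_le (μ := μ)
    (F := fun t x => σ x * φ (X (t, x))) (F' := fun t x => G (t, x)) (x₀ := 0)
    (s := Set.Icc (-1) 1) (bound := K.indicator fun _ => C)
    (Icc_mem_nhds (by norm_num) (by norm_num))
    (Filter.Eventually.of_forall fun t => (hσ.mul (hφ.continuous.comp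
      (hXc.comp (Continuous.prodMk_right t)))).aestronglyMeasurable)
    ?_ (hGc.comp (Continuous.prodMk_right 0)).aestronglyMeasurable
    (Filter.Eventually.of_forall fun x t ht => ?_) ?_
    (Filter.Eventually.of_forall fun x t _ => ?_)).2
  · simp only [hinv] at hderiv
    have := hderiv.unique (hasDerivAt_const 0 _)
    simpa [hG, h0] using this
  · simp only [h0]
    exact (hσ.mul hφ.continuous).integrable_of_hasCompactSupport hφc.mul_left
  · by_cases hx : x ∈ K
    · rw [Set.indicator_of_mem hx]
      exact hC (t, x) ⟨ht, hx⟩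
    · rw [Set.indicator_of_notMem hx, hzero t ht x hx, norm_zero]
  · exact (integrable_indicator_iff hKc.measurableSet).2
      (integrableOn_const hKc.measure_lt_top.ne)
  · exact (((hφ.differentiable one_ne_zero) _).hasFDerivAt.comp_hasDerivAt t
      (hXt t x)).const_mul (σ x)

end Flow

/-- The unique zero of a continuous family of real functions depends continuously on the parameter
near a parameter for which the derivative at the zero is positive. -/
theorem continuousAt_of_unique_zero {Y : Type*} [TopologicalSpace Y] {g : ℝ × Y → ℝ}
    (hg : Continuous g) {τ : Y → ℝ} (huniq : ∀ y t, g (t, y) = 0 ↔ t = τ y) {y₀ : Y}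
    (hpos : 0 < deriv (fun t => g (t, y₀)) (τ y₀)) : ContinuousAt τ y₀ := by
  have hsign := eventually_nhdsWithin_sign_eq_of_deriv_pos hpos ((huniq y₀ (τ y₀)).2 rfl)
  have hcont : ∀ t, Continuous fun y => g (t, y) := fun t => hg.comp (Continuous.prodMk_right t)
  refine Metric.tendsto_nhds.2 fun ε hε => ?_
  obtain ⟨t₁, hsign₁, ht₁⟩ := ((hsign.filter_mono nhdsWithin_le_nhds).and
    (Ioo_mem_nhdsLT (sub_lt_self (τ y₀) hε))).exists
  obtain ⟨t₂, hsign₂, ht₂⟩ := ((hsign.filter_mono nhdsWithin_le_nhds).and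
    (Ioo_mem_nhdsGT (lt_add_of_pos_right (τ y₀) hε))).exists
  rw [sign_neg (sub_neg.2 ht₁.2), sign_eq_neg_one_iff] at hsign₁
  rw [sign_pos (sub_pos.2 ht₂.1), sign_eq_one_iff] at hsign₂
  filter_upwards [(hcont t₁).continuousAt.eventually_lt_const hsign₁,
    (hcont t₂).continuousAt.eventually_const_lt hsign₂] with y hy₁ hy₂
  obtain ⟨t, ht, hzero⟩ := intermediate_value_Icc (ht₁.2.trans ht₂.1).le
    (hg.comp (Continuous.prodMk_left y)).continuousOn ⟨hy₁.le, hy₂.le⟩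
  rw [← (huniq y t).1 hzero, Real.dist_eq, abs_lt]
  constructor <;> linarith [ht.1, ht.2, ht₁.1, ht₂.2]

/-- The unique zero of a continuous family of real functions depends continuously on the parameter
if each function has nonzero derivative at its zero. -/
theorem continuous_of_unique_zero {Y : Type*} [TopologicalSpace Y] {g : ℝ × Y → ℝ}
    (hg : Continuous g) {τ : Y → ℝ} (huniq : ∀ y t, g (t, y) = 0 ↔ t = τ y)
    (hne : ∀ y, deriv (fun t => g (t, y)) (τ y) ≠ 0) : Continuous τ := by
  refine continuous_iff_continuousAt.2 fun y => ?_
  rcases (hne y).lt_or_gt with hneg | hpos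
  · refine continuousAt_of_unique_zero (g := fun p => -g p) hg.neg
      (fun y t => neg_eq_zero.trans (huniq y t)) ?_
    rw [deriv.fun_neg]
    exact neg_pos.2 hneg
  · exact continuousAt_of_unique_zero hg huniq hpos

/-- **Proposition 2.1** (global isotropic realizability under the transversal hyperplane
condition): if `u` is `C²` with `ℤ^d`-periodic, nonzero-average, nonvanishing gradient, `X` is
the (C¹, semigroup) flow of `dX/dt = ∇u(X)`, and every trajectory meets the hyperplane
`H = {x · ν = h}` at a unique time `τ_H(x)` with `∇u` non-tangential to `H` there, then `∇u` is
isotropically realizable in all of `ℝ^d` with a continuous positive conductivity. -/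
theorem global_isotropic_realizability_hyperplane (d : ℕ)
    (u : EuclideanSpace ℝ (Fin d) → ℝ) (hu : ContDiff ℝ 2 u)
    (hper : ∀ (x : EuclideanSpace ℝ (Fin d)) (k : Fin d → ℤ),
      gradient u (x + (WithLp.equiv 2 (Fin d → ℝ)).symm (fun i => (k i : ℝ))) = gradient u x)
    (havg : (∫ x in {x : EuclideanSpace ℝ (Fin d) | ∀ i, x i ∈ Set.Icc (0:ℝ) 1},
      gradient u x) ≠ 0)
    (hnz : ∀ x, gradient u x ≠ 0)
    (X : ℝ × EuclideanSpace ℝ (Fin d) → EuclideanSpace ℝ (Fin d))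
    (hX : ContDiff ℝ 1 X)
    (hX0 : ∀ x, X (0, x) = x)
    (hXt : ∀ t x, HasDerivAt (fun s => X (s, x)) (gradient u (X (t, x))) t)
    (hXsemigroup : ∀ s t x, X (s, X (t, x)) = X (s + t, x))
    (ν : EuclideanSpace ℝ (Fin d)) (hν : ‖ν‖ = 1) (h : ℝ)
    (τH : EuclideanSpace ℝ (Fin d) → ℝ)
    (hτH : ∀ x, ⟪X (τH x, x), ν⟫ = h)
    (hτHuniq : ∀ x t, ⟪X (t, x), ν⟫ = h → t = τH x)
    (htransversal : ∀ x, ⟪gradient u (X (τH x, x)), ν⟫ ≠ 0) :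
    ∃ σ : EuclideanSpace ℝ (Fin d) → ℝ, Continuous σ ∧ (∀ x, 0 < σ x) ∧
      ∀ φ : EuclideanSpace ℝ (Fin d) → ℝ, ContDiff ℝ (⊤ : ℕ∞) φ → HasCompactSupport φ →
        (∫ x : EuclideanSpace ℝ (Fin d), σ x * ⟪gradient u x, gradient φ x⟫) = 0 := by
  have hb : Continuous (gradient u) :=
    (InnerProductSpace.toDual ℝ (EuclideanSpace ℝ (Fin d))).symm.continuous.comp
      (hu.continuous_fderiv two_ne_zero)
  have hτ : Continuous τH := by
    refine continuous_of_unique_zero (g := fun p => ⟪X p, ν⟫ - h)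
      ((hX.continuous.inner continuous_const).sub continuous_const)
      (fun x t => ⟨fun ht => hτHuniq x t (sub_eq_zero.1 ht), ?_⟩)
      (fun x => ?_)
    · rintro rfl
      exact sub_eq_zero.2 (hτH x)
    · rw [(((hXt (τH x) x).inner ℝ (hasDerivAt_const _ ν)).sub_const h).deriv]
      simpa using htransversal x
  have hτX : ∀ t x, τH (X (t, x)) = τH x - t := fun t x =>
    (hτHuniq _ _ (by rw [hXsemigroup, sub_add_cancel, hτH])).symm
  set σ : EuclideanSpace ℝ (Fin d) → ℝ := fun x => |flowJacobian X (τH x, x)| with hσ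
  have hσc : Continuous σ := ((continuous_flowJacobian hX).comp (hτ.prodMk continuous_id)).abs
  refine ⟨σ, hσc, fun x => abs_pos.2 (flowJacobian_ne_zero hX hX0 hXsemigroup _ _),
    fun φ hφ hφc => ?_⟩
  have hinv : ∀ t x, |flowJacobian X (t, x)| * σ (X (t, x)) = σ x := fun t x => by
    simp only [hσ, hτX]
    rw [mul_comm, ← abs_mul, ← flowJacobian_add hX hXsemigroup, sub_add_cancel]
  have hφ1 : ContDiff ℝ 1 φ := hφ.of_le (by exact_mod_cast le_top)
  rw [← integral_mul_fderiv_eq_zero_of_flow_invariant volume hX.continuous hX0 hXsemigroup hb hXt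
    hσc hφ1 hφc fun t => integral_mul_comp_flow volume hX hX0 hXsemigroup t (hinv t) φ]
  refine integral_congr_ae (Filter.Eventually.of_forall fun x => ?_)
  simp only
  rw [real_inner_comm, gradient, InnerProductSpace.toDual_symm_apply]
end

section
/- Let u : ℝ^d → ℝ be three times continuously differentiable with ∇u ℤ^d-periodic, ⟨∇u⟩ ≠ 0, and ∇u(x) ≠ 0 for every x ∈ ℝ^d. Then ∇u is an isotropically realizable electric field in ℝ^d: there exists a continuously differentiable function σ : ℝ^d → ℝ with σ(x) > 0 for all x such that div(σ∇u) = σ Δu + ∇σ · ∇u = 0 everywhere in ℝ^d. (Theorem 2.3: isotropic realizability in the whole space.) -/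
open MeasureTheory
open scoped RealInnerProductSpace

section

open Set Filter Topology
open scoped NNReal

/-- A `C¹` contraction `P` perturbs the identity to a map with a `C¹` right inverse. -/
theorem exists_contDiff_fixedPoint_of_contraction {E : Type*} [NormedAddCommGroup E]
    [NormedSpace ℝ E] [CompleteSpace E] {P : E → E} (hP : ContDiff ℝ 1 P) {c : ℝ≥0} (hc : c < 1)
    (hlip : LipschitzWith c P) :
    ∃ R : E → E, ContDiff ℝ 1 R ∧ ∀ y, R y = y + P (R y) := by
  cases subsingleton_or_nontrivial E with
  | inl h => exact ⟨id, contDiff_id, fun y => Subsingleton.elim _ _⟩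
  | inr h =>
  have happrox : ApproximatesLinearOn (fun x => x - P x)
      ((ContinuousLinearEquiv.refl ℝ E : E ≃L[ℝ] E) : E →L[ℝ] E) univ c := by
    intro x _ y _
    have : x - P x - (y - P y) - (x - y) = -(P x - P y) := by abel
    simpa [this, norm_sub_rev (P y)] using hlip.norm_sub_le x y
  have hc' : Subsingleton E ∨
      c < ‖((ContinuousLinearEquiv.refl ℝ E).symm : E →L[ℝ] E)‖₊⁻¹ := by
    right
    have : ‖((ContinuousLinearEquiv.refl ℝ E).symm : E →L[ℝ] E)‖₊ = 1 := by
      rw [← NNReal.coe_inj]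
      exact ContinuousLinearMap.norm_id
    simpa [this] using hc
  let H := happrox.toHomeomorph _ hc'
  have hH : ∀ x, H x = x - P x := fun x => rfl
  have hder : ∀ a, ∃ L : E ≃L[ℝ] E, HasFDerivAt H (L : E →L[ℝ] E) a := by
    intro a
    have hPa := (hP.differentiable one_ne_zero a).hasFDerivAt
    have hn : ‖fderiv ℝ P a‖ < 1 :=
      (norm_fderiv_le_of_lipschitz ℝ hlip).trans_lt (by exact_mod_cast hc)
    refine ⟨ContinuousLinearEquiv.ofUnit (Units.oneSub _ hn), ?_⟩
    exact (hasFDerivAt_id a).sub hPa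
  choose L hL using hder
  refine ⟨H.symm, H.contDiff_symm hL (contDiff_id.sub hP), fun y => ?_⟩
  have := hH (H.symm y)
  rw [H.apply_symm_apply] at this
  exact eq_add_of_sub_eq this.symm

namespace ContinuousMap

variable {X F G : Type*} [TopologicalSpace X] [CompactSpace X] [NormedAddCommGroup F]
  [NormedSpace ℝ F] [NormedAddCommGroup G] [NormedSpace ℝ G]

/-- Pointwise application of operators, as a bilinear map on spaces of continuous functions. -/
noncomputable def pointwiseApply :
    C(X, F →L[ℝ] G) →L[ℝ] C(X, F) →L[ℝ] C(X, G) :=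
  LinearMap.mkContinuous₂
    (LinearMap.mk₂ ℝ
      (fun (A : C(X, F →L[ℝ] G)) (η : C(X, F)) => (⟨fun s => A s (η s), by fun_prop⟩ : C(X, G)))
      (fun A B η => by ext; simp) (fun c A η => by ext; simp)
      (fun A η ξ => by ext; simp) (fun c A η => by ext; simp)) 1
    (fun A η => by
      rw [ContinuousMap.norm_le _ (by positivity)]
      intro s
      rw [one_mul]
      exact (A s).le_of_opNorm_le_of_le (A.norm_coe_le_norm s) (η.norm_coe_le_norm s))

/-- The superposition operator of a `C¹` map is `C¹`. -/
theorem contDiff_one_postcomp (W : C(F, G)) (hW : ContDiff ℝ 1 W) :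
    ContDiff ℝ 1 (fun γ : C(X, F) => W.comp γ) := by
  have hcont : Continuous (fderiv ℝ W) := hW.continuous_fderiv one_ne_zero
  rw [contDiff_one_iff_hasFDerivAt]
  refine ⟨fun γ => pointwiseApply (X := X)
    ((⟨fderiv ℝ W, hcont⟩ : C(F, F →L[ℝ] G)).comp γ), ?_, ?_⟩
  · exact (pointwiseApply (X := X)).continuous.comp (ContinuousMap.continuous_postcomp _)
  intro γ
  rw [hasFDerivAt_iff_isLittleO, Asymptotics.isLittleO_iff]
  intro ε hε
  have hu := (isCompact_range γ.continuous).uniformContinuousAt_of_continuousAt (fderiv ℝ W)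
    (fun a _ => hcont.continuousAt) (Metric.dist_mem_uniformity hε)
  obtain ⟨δ, hδ, hδu⟩ := Metric.mem_uniformity_dist.1 hu
  filter_upwards [Metric.ball_mem_nhds γ hδ] with η hη
  rw [ContinuousMap.norm_le _ (by positivity)]
  intro s
  have hs : dist (γ s) (η s) < δ := by
    rw [dist_comm]
    exact (ContinuousMap.dist_apply_le_dist s).trans_lt hη
  have hseg : ∀ y ∈ Metric.ball (γ s) δ, ‖fderiv ℝ W y - fderiv ℝ W (γ s)‖ ≤ ε := by
    intro y hy
    have := hδu (a := γ s) (b := y) (by rw [dist_comm]; exact hy) ⟨s, rfl⟩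
    rw [← dist_eq_norm, dist_comm]
    exact this.le
  have := (convex_ball (γ s) δ).norm_image_sub_le_of_norm_hasFDerivWithin_le'
    (fun y _ => (hW.differentiable one_ne_zero y).hasFDerivAt.hasFDerivWithinAt) hseg
    (Metric.mem_ball_self hδ) (show η s ∈ _ by rw [Metric.mem_ball, dist_comm]; exact hs)
  exact this.trans (mul_le_mul_of_nonneg_left ((η - γ).norm_coe_le_norm s) hε.le)

/-- Pointwise multiplication by a fixed continuous scalar function. -/
noncomputable def smulCLM (ρ : C(X, ℝ)) : C(X, F) →L[ℝ] C(X, F) :=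
  LinearMap.mkContinuous
    { toFun := fun η => ⟨fun s => ρ s • η s, by fun_prop⟩
      map_add' := fun η ξ => by ext; simp
      map_smul' := fun c η => by ext s; simp [smul_comm (ρ s) c] } ‖ρ‖
    (fun η => by
      rw [ContinuousMap.norm_le _ (by positivity)]
      intro s
      simp only [LinearMap.coe_mk, AddHom.coe_mk, ContinuousMap.coe_mk, norm_smul]
      exact mul_le_mul (ρ.norm_coe_le_norm s) (η.norm_coe_le_norm s) (norm_nonneg _)
        (norm_nonneg _))

theorem smulCLM_apply (ρ : C(X, ℝ)) (η : C(X, F)) (s : X) : smulCLM ρ η s = ρ s • η s := rfl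

/-- The Volterra operator `η ↦ (t ↦ ∫₀ᵗ η)` on continuous functions on `[-T, T]`. -/
noncomputable def primitiveCLM (T : ℝ≥0) [CompleteSpace F] :
    C(Icc (-T : ℝ) T, F) →L[ℝ] C(Icc (-T : ℝ) T, F) :=
  LinearMap.mkContinuous
    { toFun := fun η =>
        ⟨fun t => ∫ s in (0 : ℝ)..t, IccExtend (neg_le_self T.coe_nonneg) η s,
          (intervalIntegral.continuous_primitive (fun a b =>
            (Continuous.Icc_extend' η.continuous).intervalIntegrable a b) 0).comp
            continuous_subtype_val⟩
      map_add' := fun η ξ => by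
        ext t
        exact intervalIntegral.integral_add
          ((Continuous.Icc_extend' η.continuous).intervalIntegrable _ _)
          ((Continuous.Icc_extend' ξ.continuous).intervalIntegrable _ _)
      map_smul' := fun c η => by
        ext t
        exact intervalIntegral.integral_smul c _ } T
    (fun η => by
      rw [ContinuousMap.norm_le _ (by positivity)]
      intro t
      have := intervalIntegral.norm_integral_le_of_norm_le_const (a := 0) (b := (t : ℝ))
        (f := IccExtend (neg_le_self T.coe_nonneg) η) (C := ‖η‖)
        (fun s _ => η.norm_coe_le_norm _)
      refine this.trans ?_
      rw [mul_comm]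
      gcongr
      rw [sub_zero]
      exact abs_le.2 t.2)

end ContinuousMap

open Real in
/-- The integral equation of a `C¹` globally Lipschitz vector field is solvable on `[-T, T]`, with
solution depending in a `C¹` way on the initial value. -/
theorem exists_contDiff_picard_solution {F : Type*} [NormedAddCommGroup F] [NormedSpace ℝ F]
    [CompleteSpace F] {W : F → F} (hW : ContDiff ℝ 1 W) {K : ℝ≥0} (hK : LipschitzWith K W)
    (T : ℝ≥0) :
    ∃ φ : F → C(Icc (-T : ℝ) T, F), ContDiff ℝ 1 φ ∧ ∀ z t,
      φ z t = z + ∫ s in (0 : ℝ)..t, W (IccExtend (neg_le_self T.coe_nonneg) (φ z) s) := by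
  set k : ℝ := 2 * K + 1
  have hk0 : 0 < k := by positivity
  let ρ : C(Icc (-T : ℝ) T, ℝ) := ⟨fun t => cosh (k * t), by fun_prop⟩
  let ρ' : C(Icc (-T : ℝ) T, ℝ) :=
    ⟨fun t => (cosh (k * t))⁻¹, Continuous.inv₀ (by fun_prop) fun t => (cosh_pos _).ne'⟩
  let N : C(Icc (-T : ℝ) T, F) → C(Icc (-T : ℝ) T, F) :=
    fun γ => (⟨W, hW.continuous⟩ : C(F, F)).comp γ
  have hN : ContDiff ℝ 1 N := ContinuousMap.contDiff_one_postcomp _ hW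
  let P : C(Icc (-T : ℝ) T, F) → C(Icc (-T : ℝ) T, F) := fun β =>
    ContinuousMap.smulCLM ρ' (ContinuousMap.primitiveCLM T (N (ContinuousMap.smulCLM ρ β)))
  have hP : ContDiff ℝ 1 P :=
    (ContinuousMap.smulCLM ρ').contDiff.comp ((ContinuousMap.primitiveCLM T).contDiff.comp
      (hN.comp (ContinuousMap.smulCLM ρ).contDiff))
  have hlip : LipschitzWith (1 / 2) P := by
    refine LipschitzWith.of_dist_le_mul fun β ξ => ?_
    rw [ContinuousMap.dist_le (by positivity)]
    intro t
    have hcosh := cosh_pos (k * t)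
    have hint : ‖∫ s in (0 : ℝ)..t, (IccExtend (neg_le_self T.coe_nonneg)
          (N (ContinuousMap.smulCLM ρ β)) s - IccExtend (neg_le_self T.coe_nonneg)
          (N (ContinuousMap.smulCLM ρ ξ)) s)‖
        ≤ |∫ s in (0 : ℝ)..t, K * dist β ξ * cosh (k * s)| := by
      refine intervalIntegral.norm_integral_le_abs_of_norm_le ?_
        (Continuous.intervalIntegrable (by fun_prop) _ _)
      refine (ae_restrict_iff' measurableSet_uIoc).2 (Eventually.of_forall fun s hs => ?_)
      have hs' : s ∈ Icc (-T : ℝ) T := by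
        have h0 : (0 : ℝ) ∈ Icc (-T : ℝ) T := ⟨by simp, T.coe_nonneg⟩
        exact (uIoc_subset_uIcc.trans (uIcc_subset_Icc h0 t.2)) hs
      rw [IccExtend_of_mem _ _ hs', IccExtend_of_mem _ _ hs', ← dist_eq_norm]
      refine (hK.dist_le_mul _ _).trans ?_
      rw [ContinuousMap.smulCLM_apply, ContinuousMap.smulCLM_apply, dist_smul₀, norm_eq_abs,
        show ρ ⟨s, hs'⟩ = cosh (k * s) from rfl, abs_of_pos (cosh_pos _), mul_assoc,
        mul_comm (dist β ξ)]
      gcongr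
      exact ContinuousMap.dist_apply_le_dist _
    have hcoshint : ∫ s in (0 : ℝ)..t, K * dist β ξ * cosh (k * s)
        = K * dist β ξ * (sinh (k * t) / k) := by
      rw [intervalIntegral.integral_const_mul, intervalIntegral.integral_comp_mul_left _ hk0.ne']
      rw [intervalIntegral.integral_eq_sub_of_hasDerivAt (fun x _ => hasDerivAt_sinh x)
        (continuous_cosh.intervalIntegrable _ _)]
      simp [div_eq_inv_mul]
    have habs : |sinh (k * t)| ≤ cosh (k * t) := by
      rw [abs_le]
      constructor
      · linarith [exp_pos (k * t), cosh_add_sinh (k * t)]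
      · exact (sinh_lt_cosh _).le
    rw [intervalIntegral.integral_sub
      ((Continuous.Icc_extend' (ContinuousMap.continuous _)).intervalIntegrable _ _)
      ((Continuous.Icc_extend' (ContinuousMap.continuous _)).intervalIntegrable _ _),
      ← dist_eq_norm, hcoshint, abs_mul, abs_div, abs_of_pos hk0,
      abs_of_nonneg (by positivity : 0 ≤ K * dist β ξ)] at hint
    have hval : ∀ ζ, P ζ t = (cosh (k * t))⁻¹ • ∫ s in (0 : ℝ)..t,
        IccExtend (neg_le_self T.coe_nonneg) (N (ContinuousMap.smulCLM ρ ζ)) s := fun _ => rfl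
    rw [hval, hval, dist_smul₀, norm_inv, norm_eq_abs, abs_of_pos hcosh, inv_mul_le_iff₀ hcosh]
    refine hint.trans ?_
    have hKk : K / k ≤ 1 / 2 := by
      rw [div_le_div_iff₀ hk0 two_pos]
      linarith
    calc K * dist β ξ * (|sinh (k * t)| / k)
        = (K / k) * dist β ξ * |sinh (k * t)| := by ring
      _ ≤ (1 / 2) * dist β ξ * cosh (k * t) := by gcongr
      _ = cosh (k * t) * (((1 / 2 : ℝ≥0) : ℝ) * dist β ξ) := by push_cast; ring
  obtain ⟨R, hR, hRP⟩ := exists_contDiff_fixedPoint_of_contraction hP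
    (by rw [← NNReal.coe_lt_coe]; norm_num) hlip
  have hconst : ContDiff ℝ 1 (fun z : F => ContinuousMap.const (Icc (-T : ℝ) T) z) :=
    (ContinuousLinearMap.const ℝ (Icc (-T : ℝ) T) : F →L[ℝ] C(Icc (-T : ℝ) T, F)).contDiff
  refine ⟨fun z => ContinuousMap.smulCLM ρ
    (R (ContinuousMap.smulCLM ρ' (ContinuousMap.const _ z))), ?_, fun z t => ?_⟩
  · exact (ContinuousMap.smulCLM ρ).contDiff.comp
      (hR.comp ((ContinuousMap.smulCLM ρ').contDiff.comp hconst))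
  · have hcosh := cosh_pos (k * t)
    set β := R (ContinuousMap.smulCLM ρ' (ContinuousMap.const _ z))
    have h1 : β t = (cosh (k * t))⁻¹ • z
        + (cosh (k * t))⁻¹ • ∫ s in (0 : ℝ)..t, IccExtend (neg_le_self T.coe_nonneg)
          (N (ContinuousMap.smulCLM ρ β)) s :=
      congrArg (fun η : C(Icc (-T : ℝ) T, F) => η t) (hRP _)
    change cosh (k * t) • β t = _
    rw [h1, smul_add, smul_inv_smul₀ hcosh.ne', smul_inv_smul₀ hcosh.ne']
    rfl

/-- A `C¹` globally Lipschitz vector field has a flow that is jointly `C¹` on `(-T, T)`. -/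
theorem exists_contDiffAt_flow_Ioo {F : Type*} [NormedAddCommGroup F] [NormedSpace ℝ F]
    [FiniteDimensional ℝ F] {W : F → F} (hW : ContDiff ℝ 1 W) {K : ℝ≥0} (hK : LipschitzWith K W)
    {T : ℝ} (hT : 0 < T) :
    ∃ Φ : ℝ → F → F, (∀ z, Φ 0 z = z) ∧
      ∀ t ∈ Ioo (-T) T, ∀ z, HasDerivAt (fun s => Φ s z) (W (Φ t z)) t ∧
        ContDiffAt ℝ 1 (Function.uncurry Φ) (t, z) := by
  have := FiniteDimensional.complete ℝ F
  lift T to ℝ≥0 using hT.le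
  obtain ⟨φ, hφ, hφint⟩ := exists_contDiff_picard_solution hW hK T
  have hle : (-T : ℝ) ≤ T := neg_le_self T.coe_nonneg
  let Φ : ℝ → F → F := fun t z => IccExtend hle (φ z) t
  have hΦ_eq : ∀ t ∈ Icc (-T : ℝ) T, ∀ z, Φ t z = z + ∫ s in (0 : ℝ)..t, W (Φ s z) := by
    intro t ht z
    change IccExtend hle (φ z) t = _
    rw [IccExtend_of_mem _ _ ht]
    exact hφint z ⟨t, ht⟩
  have hΦcont : Continuous (Function.uncurry Φ) := by
    change Continuous fun p : ℝ × F => φ p.2 (projIcc _ _ hle p.1)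
    have := hφ.continuous
    have := continuous_projIcc (h := hle)
    fun_prop
  have hderiv : ∀ t ∈ Ioo (-T : ℝ) T, ∀ z, HasDerivAt (fun s => Φ s z) (W (Φ t z)) t := by
    intro t ht z
    have hc : Continuous fun s => W (Φ s z) :=
      hW.continuous.comp (hΦcont.comp (continuous_id.prodMk continuous_const))
    have h1 := (hc.integral_hasStrictDerivAt 0 t).hasDerivAt.const_add z
    refine h1.congr_of_eventuallyEq ?_
    filter_upwards [Icc_mem_nhds ht.1 ht.2] with s hs using hΦ_eq s hs z
  let f₁ : ℝ → F → ℝ →L[ℝ] F := fun t z => ContinuousLinearMap.toSpanSingleton ℝ (W (Φ t z))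
  let f₂ : ℝ → F → F →L[ℝ] F := fun t z =>
    (ContinuousMap.evalCLM ℝ (projIcc _ _ hle t)).comp (fderiv ℝ φ z)
  have hf₁ : Continuous (Function.uncurry f₁) := by
    refine continuous_clm_apply.2 fun r => ?_
    change Continuous fun p : ℝ × F => r • W (Φ p.1 p.2)
    exact (hW.continuous.comp hΦcont).const_smul r
  have hf₂ : Continuous (Function.uncurry f₂) := by
    refine continuous_clm_apply.2 fun v => ?_
    change Continuous fun p : ℝ × F => (fderiv ℝ φ p.2 v) (projIcc _ _ hle p.1)
    have := hφ.continuous_fderiv one_ne_zero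
    have := continuous_projIcc (h := hle)
    fun_prop
  have hstrict : ∀ p ∈ Ioo (-T : ℝ) T ×ˢ (univ : Set F), HasFDerivAt (Function.uncurry Φ)
      ((Function.uncurry f₁ p).coprod (Function.uncurry f₂ p)) p := by
    intro p hp
    have hmem : Ioo (-T : ℝ) T ×ˢ (univ : Set F) ∈ 𝓝 p :=
      (isOpen_Ioo.prod isOpen_univ).mem_nhds hp
    refine (hasStrictFDerivAt_uncurry_coprod (u := p) (f := Φ) (f₁ := f₁) (f₂ := f₂) ?_ ?_
      hf₁.continuousAt hf₂.continuousAt).hasFDerivAt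
    · filter_upwards [hmem] with v hv using (hderiv v.1 hv.1 v.2).hasFDerivAt
    · filter_upwards with v
      exact (ContinuousMap.evalCLM ℝ (projIcc _ _ hle v.1)).hasFDerivAt.comp v.2
        (hφ.differentiable one_ne_zero v.2).hasFDerivAt
  refine ⟨Φ, fun z => ?_, fun t ht z => ⟨hderiv t ht z, ?_⟩⟩
  · rw [hΦ_eq 0 ⟨by simp, by simp⟩]
    simp
  · rw [contDiffAt_one_iff]
    exact ⟨_, _, (isOpen_Ioo.prod isOpen_univ).mem_nhds ⟨ht, mem_univ z⟩,
      ((ContinuousLinearMap.coprodEquivL (S := ℝ) (𝕜 := ℝ)).continuous.comp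
        (hf₁.prodMk hf₂)).continuousOn, hstrict⟩

/-- A `C¹` globally Lipschitz vector field has a complete flow which is jointly `C¹`. -/
theorem exists_contDiff_flow {F : Type*} [NormedAddCommGroup F] [NormedSpace ℝ F]
    [FiniteDimensional ℝ F] {W : F → F} (hW : ContDiff ℝ 1 W) {K : ℝ≥0} (hK : LipschitzWith K W) :
    ∃ Φ : ℝ → F → F, (∀ z, Φ 0 z = z) ∧
      (∀ t z, HasDerivAt (fun s => Φ s z) (W (Φ t z)) t) ∧
      ContDiff ℝ 1 (Function.uncurry Φ) := by
  choose! Φ hΦ0 hΦ using fun (T : ℝ) (hT : 0 < T) => exists_contDiffAt_flow_Ioo hW hK hT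
  have hcompat : ∀ S T t : ℝ, t ∈ Ioo (-S) S → S ≤ T → ∀ z, Φ S t z = Φ T t z := by
    intro S T t ht hST z
    have hS : 0 < S := by linarith [ht.1, ht.2]
    refine ODE_solution_unique_of_mem_Ioo (v := fun _ => W) (s := fun _ => univ) (K := K)
      (f := fun t => Φ S t z) (g := fun t => Φ T t z)
      (fun _ _ => hK.lipschitzOnWith) (t₀ := 0) ⟨by linarith, hS⟩
      (fun s hs => ⟨(hΦ S hS s hs z).1, mem_univ _⟩)
      (fun s hs => ⟨(hΦ T (by linarith) s ⟨by linarith [hs.1], by linarith [hs.2]⟩ z).1,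
        mem_univ _⟩) ?_ ht
    simp only [hΦ0 S hS, hΦ0 T (hS.trans_le hST)]
  let Ψ : ℝ → F → F := fun t z => Φ (|t| + 1) t z
  have hself : ∀ t : ℝ, t ∈ Ioo (-(|t| + 1)) (|t| + 1) := fun t => abs_lt.1 (lt_add_one _)
  have hΨ : ∀ T t : ℝ, t ∈ Ioo (-T) T → ∀ z, Ψ t z = Φ T t z := by
    intro T t ht z
    rcases le_total (|t| + 1) T with h | h
    · exact hcompat _ _ t (hself t) h z
    · exact (hcompat _ _ t ht h z).symm
  refine ⟨Ψ, fun z => hΦ0 _ (by positivity) z, fun t z => ?_,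
    contDiff_iff_contDiffAt.2 fun p => ?_⟩
  · refine ((hΦ (|t| + 1) (by positivity) t (hself t) z).1).congr_of_eventuallyEq ?_
    filter_upwards [Ioo_mem_nhds (hself t).1 (hself t).2] with s hs using hΨ _ s hs z
  · refine ((hΦ (|p.1| + 1) (by positivity) p.1 (hself p.1) p.2).2).congr_of_eventuallyEq ?_
    filter_upwards [(isOpen_Ioo.prod isOpen_univ).mem_nhds
      (show p ∈ Ioo (-(|p.1| + 1)) (|p.1| + 1) ×ˢ (univ : Set F) from ⟨hself p.1, mem_univ _⟩)]
      with q hq using hΨ _ q.1 hq.1 q.2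

/-- A continuous function on `ℝ^d` which is periodic under integer translations is bounded. -/
theorem exists_norm_le_of_continuous_of_int_periodic {d : ℕ} {G : Type*} [NormedAddCommGroup G]
    {f : EuclideanSpace ℝ (Fin d) → G} (hf : Continuous f)
    (hper : ∀ (x : EuclideanSpace ℝ (Fin d)) (k : Fin d → ℤ),
      f (x + (WithLp.equiv 2 (Fin d → ℝ)).symm (fun i => (k i : ℝ))) = f x) :
    ∃ C : ℝ, ∀ x, ‖f x‖ ≤ C := by
  have hcomp : IsCompact (WithLp.toLp 2 '' Icc (0 : Fin d → ℝ) 1) :=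
    isCompact_Icc.image (PiLp.continuous_toLp 2 _)
  obtain ⟨C, hC⟩ := hcomp.exists_bound_of_continuousOn hf.continuousOn
  refine ⟨C, fun x => ?_⟩
  have hx : x = WithLp.toLp 2 (fun i => Int.fract (x i))
      + (WithLp.equiv 2 (Fin d → ℝ)).symm (fun i => (⌊x i⌋ : ℝ)) := by
    ext i
    simp [Int.fract_add_floor]
  rw [hx, hper]
  exact hC _ ⟨_, ⟨fun i => Int.fract_nonneg _, fun i => (Int.fract_lt_one _).le⟩, rfl⟩

/-- A `C¹` function on `ℝ^d` which is periodic under integer translations is Lipschitz. -/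
theorem exists_lipschitzWith_of_contDiff_of_int_periodic {d : ℕ} {G : Type*}
    [NormedAddCommGroup G] [NormedSpace ℝ G]
    {f : EuclideanSpace ℝ (Fin d) → G} (hf : ContDiff ℝ 1 f)
    (hper : ∀ (x : EuclideanSpace ℝ (Fin d)) (k : Fin d → ℤ),
      f (x + (WithLp.equiv 2 (Fin d → ℝ)).symm (fun i => (k i : ℝ))) = f x) :
    ∃ K : ℝ≥0, LipschitzWith K f := by
  obtain ⟨C, hC⟩ := exists_norm_le_of_continuous_of_int_periodic
    (hf.continuous_fderiv one_ne_zero) (fun x k => by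
      rw [← fderiv_comp_add_right, funext (fun y => hper y k)])
  refine ⟨C.toNNReal, lipschitzWith_of_nnnorm_fderiv_le (𝕜 := ℝ) (hf.differentiable one_ne_zero)
    fun x => ?_⟩
  rw [← NNReal.coe_le_coe, coe_nnnorm]
  exact (hC x).trans (Real.le_coe_toNNReal C)

/-- If `V` and `g` are `C¹` and Lipschitz and `u` is a `C¹` function growing at unit speed along
`V`, then the transport equation `∂_V w = -g` has a global `C¹` solution. -/
theorem exists_contDiff_transport_solution {E : Type*} [NormedAddCommGroup E] [NormedSpace ℝ E]
    [FiniteDimensional ℝ E] {V : E → E} {g u : E → ℝ} (hV : ContDiff ℝ 1 V) (hg : ContDiff ℝ 1 g)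
    {K L : ℝ≥0} (hVK : LipschitzWith K V) (hgL : LipschitzWith L g) (hu : ContDiff ℝ 1 u)
    (huV : ∀ x, fderiv ℝ u x (V x) = 1) :
    ∃ w : E → ℝ, ContDiff ℝ 1 w ∧ ∀ x, fderiv ℝ w x (V x) = -g x := by
  let W : E × ℝ → E × ℝ := fun p => (V p.1, g p.1)
  have hW : ContDiff ℝ 1 W := (hV.comp contDiff_fst).prodMk (hg.comp contDiff_fst)
  have hfst : LipschitzWith 1 (Prod.fst : E × ℝ → E) := LipschitzWith.prod_fst
  have hWK : LipschitzWith (max (K * 1) (L * 1)) W := (hVK.comp hfst).prodMk (hgL.comp hfst)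
  obtain ⟨Φ, hΦ0, hΦ, hΦC⟩ := exists_contDiff_flow hW hWK
  let w : E → ℝ := fun x => (Φ (-u x) (x, 0)).2
  have hwC : ContDiff ℝ 1 w := contDiff_snd.comp
    (hΦC.comp (hu.neg.prodMk (contDiff_id.prodMk contDiff_const)))
  refine ⟨w, hwC, fun x => ?_⟩
  let X : ℝ → E := fun t => (Φ t (x, 0)).1
  let A : ℝ → ℝ := fun t => (Φ t (x, 0)).2
  have hX : ∀ t, HasDerivAt X (V (X t)) t := fun t =>
    (hasFDerivAt_fst.comp_hasDerivAt t (hΦ t (x, 0)) :)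
  have hA : ∀ t, HasDerivAt A (g (X t)) t := fun t =>
    (hasFDerivAt_snd.comp_hasDerivAt t (hΦ t (x, 0)) :)
  have hX0 : X 0 = x := by simp [X, hΦ0]
  have huX : ∀ t, u (X t) = u x + t := by
    have h1 : ∀ t, HasDerivAt (fun t => u (X t) - t) 0 t := fun t => by
      have := (((hu.differentiable one_ne_zero) (X t)).hasFDerivAt.comp_hasDerivAt t
        (hX t)).sub (hasDerivAt_id t)
      rwa [huV, sub_self] at this
    intro t
    have := is_const_of_deriv_eq_zero (fun t => (h1 t).differentiableAt)
      (fun t => (h1 t).deriv) t 0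
    simp only [hX0] at this
    linarith
  have hshift : ∀ t s, Φ s (X t, 0) + (0, A t) = Φ (s + t) (x, 0) := by
    intro t s
    refine congrFun (ODE_solution_unique_univ (v := fun _ => W) (s := fun _ => univ)
      (t₀ := 0) (f := fun s => Φ s (X t, 0) + (0, A t)) (g := fun s => Φ (s + t) (x, 0))
      (fun _ => hWK.lipschitzOnWith) (fun s => ⟨?_, mem_univ _⟩)
      (fun s => ⟨(hΦ (s + t) (x, 0)).comp_add_const s t, mem_univ _⟩) ?_) s
    · simpa [W] using (hΦ s (X t, 0)).add_const (0, A t)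
    · simp [hΦ0, X, A]
  have hwX : ∀ t, w (X t) = w x - A t := by
    intro t
    have := congrArg Prod.snd (hshift t (-u (X t)))
    simp only [Prod.snd_add] at this
    rw [show -u (X t) + t = -u x by rw [huX]; ring] at this
    simp only [w]
    linarith
  have h1 : HasDerivAt (fun t => w (X t)) (fderiv ℝ w x (V x)) 0 := by
    have := ((hwC.differentiable one_ne_zero) (X 0)).hasFDerivAt.comp_hasDerivAt 0 (hX 0)
    rwa [hX0] at this
  have h2 : HasDerivAt (fun t => w (X t)) (-g x) 0 := by
    have := (hA 0).const_sub (w x)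
    rw [hX0] at this
    exact this.congr_of_eventuallyEq (Eventually.of_forall hwX)
  exact h1.unique h2

end

/-- **Theorem 2.3** (isotropic realizability in the whole space): if `u` is `C³` on `ℝ^d` with
`ℤ^d`-periodic gradient, nonzero average, and `∇u(x) ≠ 0` everywhere, then there is a positive
`C¹` function `σ` with `div(σ∇u) = σ Δu + ∇σ · ∇u = 0` everywhere in `ℝ^d`
(`Δu` being the trace of the derivative of `∇u`). -/
theorem isotropic_realizability_whole_space (d : ℕ)
    (u : EuclideanSpace ℝ (Fin d) → ℝ) (hu : ContDiff ℝ 3 u)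
    (hper : ∀ (x : EuclideanSpace ℝ (Fin d)) (k : Fin d → ℤ),
      gradient u (x + (WithLp.equiv 2 (Fin d → ℝ)).symm (fun i => (k i : ℝ))) = gradient u x)
    (havg : (∫ x in {x : EuclideanSpace ℝ (Fin d) | ∀ i, x i ∈ Set.Icc (0:ℝ) 1},
      gradient u x) ≠ 0)
    (hnz : ∀ x, gradient u x ≠ 0) :
    ∃ σ : EuclideanSpace ℝ (Fin d) → ℝ, ContDiff ℝ 1 σ ∧ (∀ x, 0 < σ x) ∧
      ∀ x, σ x * LinearMap.trace ℝ (EuclideanSpace ℝ (Fin d))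
          (fderiv ℝ (gradient u) x : EuclideanSpace ℝ (Fin d) →ₗ[ℝ] EuclideanSpace ℝ (Fin d))
        + ⟪gradient σ x, gradient u x⟫ = 0 := by
  have hC : ContDiff ℝ 2 (gradient u) :=
    (InnerProductSpace.toDual ℝ _).symm.contDiff.comp (hu.fderiv_right (by norm_num))
  have hC1 : ContDiff ℝ 1 (gradient u) := hC.of_le (by norm_num)
  let tr : (EuclideanSpace ℝ (Fin d) →L[ℝ] EuclideanSpace ℝ (Fin d)) →L[ℝ] ℝ :=
    LinearMap.toContinuousLinearMap
      ((LinearMap.trace ℝ (EuclideanSpace ℝ (Fin d))).comp (ContinuousLinearMap.coeLM ℝ))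
  let lap : EuclideanSpace ℝ (Fin d) → ℝ := fun x => tr (fderiv ℝ (gradient u) x)
  have hlapC : ContDiff ℝ 1 lap := tr.contDiff.comp (hC.fderiv_right (by norm_num))
  have hnC : ContDiff ℝ 1 (fun x => (‖gradient u x‖ ^ 2)⁻¹) :=
    (hC1.norm_sq ℝ).inv fun x => pow_ne_zero 2 (norm_ne_zero_iff.2 (hnz x))
  let V : EuclideanSpace ℝ (Fin d) → EuclideanSpace ℝ (Fin d) :=
    fun x => (‖gradient u x‖ ^ 2)⁻¹ • gradient u x
  let g : EuclideanSpace ℝ (Fin d) → ℝ := fun x => (‖gradient u x‖ ^ 2)⁻¹ * lap x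
  have hVC : ContDiff ℝ 1 V := hnC.smul hC1
  have hgC : ContDiff ℝ 1 g := hnC.mul hlapC
  obtain ⟨K, hK⟩ := exists_lipschitzWith_of_contDiff_of_int_periodic hVC
    (fun x k => by simp only [V, hper])
  obtain ⟨L, hL⟩ := exists_lipschitzWith_of_contDiff_of_int_periodic hgC
    (fun x k => by
      simp only [g, lap, hper]
      rw [← fderiv_comp_add_right, funext (fun y => hper y k)])
  have hn : ∀ x, ‖gradient u x‖ ^ 2 ≠ 0 := fun x => pow_ne_zero 2 (norm_ne_zero_iff.2 (hnz x))
  have huV : ∀ x, fderiv ℝ u x (V x) = 1 := by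
    intro x
    rw [← InnerProductSpace.toDual_symm_apply]
    change ⟪gradient u x, (‖gradient u x‖ ^ 2)⁻¹ • gradient u x⟫ = 1
    rw [real_inner_smul_right, real_inner_self_eq_norm_sq, inv_mul_cancel₀ (hn x)]
  obtain ⟨w, hwC, hw⟩ := exists_contDiff_transport_solution hVC hgC hK hL
    (hu.of_le (by norm_num)) huV
  refine ⟨fun x => Real.exp (w x), hwC.exp, fun x => Real.exp_pos _, fun x => ?_⟩
  have hgrad : ⟪gradient (fun x => Real.exp (w x)) x, gradient u x⟫
      = Real.exp (w x) * fderiv ℝ w x (gradient u x) := by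
    have h := ((hwC.differentiable one_ne_zero) x).hasFDerivAt.exp
    rw [gradient, InnerProductSpace.toDual_symm_apply, h.fderiv]
    rfl
  have hlap : fderiv ℝ w x (gradient u x) = -lap x := by
    have h := hw x
    simp only [V, g, map_smul, smul_eq_mul] at h
    rw [← mul_neg] at h
    exact mul_left_cancel₀ (inv_ne_zero (hn x)) h
  rw [hgrad, hlap]
  change Real.exp (w x) * lap x + Real.exp (w x) * -lap x = 0
  ring
end

section
/- Let u : ℝ^d → ℝ be continuously differentiable with ∇u continuous, ℤ^d-periodic, and ∇u(x) ≠ 0 for every x ∈ ℝ^d. Let X : ℝ × ℝ^d → ℝ^d satisfy X(0,x) = x and ∂X/∂t(t,x) = ∇u(X(t,x)) for all (t,x). Then for every x ∈ ℝ^d the function t ↦ u(X(t,x)) is strictly increasing with derivative |∇u(X(t,x))|² bounded below by a positive constant m (independent of x and t), it tends to +∞ as t → +∞ and to −∞ as t → −∞, and there exists a unique τ(x) ∈ ℝ such that u(X(τ(x),x)) = 0. (Unique hitting time of the equipotential {u = 0}, from the proof of Theorem 2.3.) -/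
open MeasureTheory Filter

/-- A continuous nowhere vanishing `ℤ^d`-periodic vector field has norm squared bounded below. -/
theorem exists_pos_le_norm_sq_of_periodic {d : ℕ} {F : Type*} [NormedAddCommGroup F]
    {g : EuclideanSpace ℝ (Fin d) → F} (hg : Continuous g)
    (hper : ∀ (x : EuclideanSpace ℝ (Fin d)) (k : Fin d → ℤ),
      g (x + (WithLp.equiv 2 (Fin d → ℝ)).symm (fun i => (k i : ℝ))) = g x)
    (hnz : ∀ x, g x ≠ 0) : ∃ m : ℝ, 0 < m ∧ ∀ x, m ≤ ‖g x‖ ^ 2 := by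
  have hcube : IsCompact (Set.pi Set.univ fun _ : Fin d => Set.Icc (0 : ℝ) 1) :=
    isCompact_univ_pi fun _ => isCompact_Icc
  obtain ⟨y, -, hy⟩ := hcube.exists_isMinOn ⟨0, fun _ _ => ⟨le_rfl, zero_le_one⟩⟩
    (f := fun v => ‖g (WithLp.toLp 2 v)‖ ^ 2)
    ((hg.comp (PiLp.continuous_toLp 2 _)).norm.pow 2).continuousOn
  refine ⟨_, pow_pos (norm_pos_iff.2 (hnz (WithLp.toLp 2 y))) 2, fun x => ?_⟩
  have hx : g (WithLp.toLp 2 fun i => Int.fract (x i)) = g x := by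
    rw [← hper _ fun i => ⌊x i⌋]
    congr 1
    ext i
    simp
  rw [← hx]
  exact isMinOn_iff.1 hy _ fun i _ => ⟨Int.fract_nonneg _, (Int.fract_lt_one _).le⟩

/-- If `f' ≥ m` everywhere, then `t ↦ f t - m * t` is monotone. -/
theorem monotone_sub_mul_of_le_deriv {f f' : ℝ → ℝ} {m : ℝ}
    (hf : ∀ t, HasDerivAt f (f' t) t) (hm : ∀ t, m ≤ f' t) :
    Monotone fun t => f t - m * t := by
  have h : ∀ t, HasDerivAt (fun t => f t - m * t) (f' t - m * 1) t := fun t =>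
    (hf t).sub ((hasDerivAt_id t).const_mul m)
  refine monotone_of_deriv_nonneg (fun t => (h t).differentiableAt) fun t => ?_
  rw [(h t).deriv]
  linarith [hm t]

/-- Unique hitting time of the equipotential `{u = 0}` (from the proof of Theorem 2.3): along
the gradient flow, `t ↦ u(X(t,x))` is strictly increasing with derivative `|∇u(X(t,x))|²`
bounded below by a positive constant `m`, tends to `±∞` as `t → ±∞`, and there is a unique
time `τ(x)` with `u(X(τ(x),x)) = 0`. -/
theorem unique_hitting_time (d : ℕ)
    (u : EuclideanSpace ℝ (Fin d) → ℝ) (hu : ContDiff ℝ 1 u)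
    (hper : ∀ (x : EuclideanSpace ℝ (Fin d)) (k : Fin d → ℤ),
      gradient u (x + (WithLp.equiv 2 (Fin d → ℝ)).symm (fun i => (k i : ℝ))) = gradient u x)
    (hnz : ∀ x, gradient u x ≠ 0)
    (X : ℝ × EuclideanSpace ℝ (Fin d) → EuclideanSpace ℝ (Fin d))
    (hX0 : ∀ x, X (0, x) = x)
    (hXt : ∀ t x, HasDerivAt (fun s => X (s, x)) (gradient u (X (t, x))) t) :
    ∃ m : ℝ, 0 < m ∧
      (∀ x t, HasDerivAt (fun s => u (X (s, x))) (‖gradient u (X (t, x))‖ ^ 2) t ∧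
        m ≤ ‖gradient u (X (t, x))‖ ^ 2) ∧
      ∀ x : EuclideanSpace ℝ (Fin d),
        StrictMono (fun t => u (X (t, x))) ∧
        Tendsto (fun t => u (X (t, x))) atTop atTop ∧
        Tendsto (fun t => u (X (t, x))) atBot atBot ∧
        ∃! τ : ℝ, u (X (τ, x)) = 0 := by
  have hgrad : ∀ x, HasGradientAt u (gradient u x) x := fun x =>
    ((hu.differentiable one_ne_zero) x).hasGradientAt
  have hcont : Continuous (gradient u) :=
    (LinearIsometryEquiv.continuous _).comp (hu.continuous_fderiv one_ne_zero)
  obtain ⟨m, hm, hle⟩ := exists_pos_le_norm_sq_of_periodic hcont hper hnz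
  have hder : ∀ x t, HasDerivAt (fun s => u (X (s, x))) (‖gradient u (X (t, x))‖ ^ 2) t := by
    intro x t
    have h := (hgrad (X (t, x))).hasFDerivAt.comp_hasDerivAt t (hXt t x)
    rwa [InnerProductSpace.toDual_apply_apply, real_inner_self_eq_norm_sq] at h
  refine ⟨m, hm, fun x t => ⟨hder x t, hle _⟩, fun x => ?_⟩
  have hmono := monotone_sub_mul_of_le_deriv (hder x) fun t => hle (X (t, x))
  have hstrict : StrictMono fun t => u (X (t, x)) :=
    strictMono_of_deriv_pos fun t => by
      rw [(hder x t).deriv]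
      exact hm.trans_le (hle _)
  have htop : Tendsto (fun t => u (X (t, x))) atTop atTop := by
    refine tendsto_atTop_mono' _ ?_
      (tendsto_atTop_add_const_right _ (u (X (0, x))) (tendsto_id.const_mul_atTop hm))
    filter_upwards [eventually_ge_atTop 0] with t ht
    have h := hmono ht
    simp only [id] at h ⊢
    linarith
  have hbot : Tendsto (fun t => u (X (t, x))) atBot atBot := by
    refine tendsto_atBot_mono' _ ?_
      (tendsto_atBot_add_const_right _ (u (X (0, x))) (tendsto_id.const_mul_atBot hm))
    filter_upwards [eventually_le_atBot 0] with t ht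
    have h := hmono ht
    simp only [id] at h ⊢
    linarith
  have hc : Continuous fun t => u (X (t, x)) :=
    continuous_iff_continuousAt.2 fun t => (hder x t).continuousAt
  obtain ⟨τ, hτ⟩ := hc.surjective htop hbot 0
  exact ⟨hstrict, htop, hbot, τ, hτ, fun s hs => hstrict.injective (hs.trans hτ.symm)⟩
end

section
/- Let u : ℝ^d → ℝ be three times continuously differentiable with ∇u ℤ^d-periodic and ∇u(x) ≠ 0 for every x. Let X : ℝ × ℝ^d → ℝ^d be continuously differentiable with X(0,x) = x, ∂X/∂t(t,x) = ∇u(X(t,x)), and X(s,X(t,x)) = X(s+t,x) for all s,t,x. Let τ : ℝ^d → ℝ be continuously differentiable with u(X(τ(x),x)) = 0 for every x. Then the function w(x) := ∫₀^{τ(x)} Δu(X(s,x)) ds satisfies ∇w(x) · ∇u(x) = −Δu(x) for every x ∈ ℝ^d; consequently σ := e^w is positive, continuously differentiable, and div(σ∇u) = σΔu + ∇σ·∇u = 0 everywhere in ℝ^d. (Explicit isotropic conductivity formula (2.37) from the proof of Theorem 2.3.) -/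
open MeasureTheory
open scoped RealInnerProductSpace

/-- The interval integral of a `C¹` function depending on a parameter in a proper space
is `C¹` in the parameter. -/
theorem contDiff_one_parametric_intervalIntegral {H E : Type*}
    [NormedAddCommGroup H] [NormedSpace ℝ H] [ProperSpace H]
    [NormedAddCommGroup E] [NormedSpace ℝ E]
    {F : H → ℝ → E} (hF : ContDiff ℝ 1 (fun p : H × ℝ => F p.1 p.2)) (a b : ℝ) :
    ContDiff ℝ 1 (fun x => ∫ t in a..b, F x t) := by
  let F' : H → ℝ → H →L[ℝ] E := fun x t =>
    (fderiv ℝ (fun p : H × ℝ => F p.1 p.2) (x, t)).comp (ContinuousLinearMap.inl ℝ H ℝ)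
  have hF'c : Continuous (fun p : H × ℝ => F' p.1 p.2) :=
    (hF.continuous_fderiv one_ne_zero).clm_comp continuous_const
  have hd : ∀ x t, HasFDerivAt (fun y => F y t) (F' x t) x := fun x t =>
    HasFDerivAt.comp (g := fun p : H × ℝ => F p.1 p.2) (f := fun y => (y, t)) x
      (hF.differentiable one_ne_zero (x, t)).hasFDerivAt (hasFDerivAt_prodMk_left x t)
  have hFt : ∀ x, Continuous (F x) := fun x =>
    hF.continuous.comp (Continuous.prodMk_right x)
  have hF't : ∀ x, Continuous (F' x) := fun x =>
    hF'c.comp (Continuous.prodMk_right x)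
  refine contDiff_one_iff_hasFDerivAt.2 ⟨fun x => ∫ t in a..b, F' x t,
    intervalIntegral.continuous_parametric_intervalIntegral_of_continuous' hF'c a b, fun x => ?_⟩
  obtain ⟨C, hC⟩ := ((isCompact_closedBall x 1).prod (isCompact_uIcc (a := a) (b := b))
    ).exists_bound_of_continuousOn hF'c.continuousOn
  refine intervalIntegral.hasFDerivAt_integral_of_dominated_of_fderiv_le
    (bound := fun _ => C) (Metric.closedBall_mem_nhds x one_pos)
    (.of_forall fun y => (hFt y).aestronglyMeasurable) ((hFt x).intervalIntegrable a b)
    (hF't x).aestronglyMeasurable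
    (.of_forall fun t ht y hy => hC (y, t) ⟨hy, Set.uIoc_subset_uIcc ht⟩)
    intervalIntegrable_const (.of_forall fun t _ y _ => hd y t)

/-- The integral of a `C¹` function over an interval with `C¹` moving endpoint is `C¹`. -/
theorem contDiff_one_parametric_primitive {H E : Type*}
    [NormedAddCommGroup H] [NormedSpace ℝ H] [ProperSpace H]
    [NormedAddCommGroup E] [NormedSpace ℝ E]
    {F : H → ℝ → E} (hF : ContDiff ℝ 1 (fun p : H × ℝ => F p.1 p.2))
    {τ : H → ℝ} (hτ : ContDiff ℝ 1 τ) :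
    ContDiff ℝ 1 (fun x => ∫ t in (0 : ℝ)..τ x, F x t) := by
  have h : (fun x => ∫ t in (0 : ℝ)..τ x, F x t) =
      fun x => τ x • ∫ t in (0 : ℝ)..1, F x (τ x * t) := by
    funext x
    simp [intervalIntegral.smul_integral_comp_mul_left]
  rw [h]
  refine hτ.smul (contDiff_one_parametric_intervalIntegral ?_ 0 1)
  exact hF.comp (contDiff_fst.prodMk ((hτ.comp contDiff_fst).mul contDiff_snd))

theorem ContDiff.gradient {H : Type*} [NormedAddCommGroup H] [InnerProductSpace ℝ H]
    [CompleteSpace H] {f : H → ℝ} {m n : WithTop ℕ∞} (hf : ContDiff ℝ n f) (hmn : m + 1 ≤ n) :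
    ContDiff ℝ m (gradient f) :=
  (InnerProductSpace.toDual ℝ H).symm.contDiff.comp (hf.fderiv_right hmn)

/-- The trace of the derivative (the divergence) of a vector field loses one derivative. -/
theorem ContDiff.trace_fderiv {H : Type*} [NormedAddCommGroup H] [NormedSpace ℝ H]
    [FiniteDimensional ℝ H] {f : H → H} {m n : WithTop ℕ∞} (hf : ContDiff ℝ n f)
    (hmn : m + 1 ≤ n) :
    ContDiff ℝ m (fun x => LinearMap.trace ℝ H (fderiv ℝ f x : H →ₗ[ℝ] H)) :=
  (LinearMap.toContinuousLinearMap
    (LinearMap.trace ℝ H ∘ₗ ContinuousLinearMap.coeLM ℝ)).contDiff.comp (hf.fderiv_right hmn)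

/-- A differentiable function without critical points is strictly increasing along the
trajectories of its gradient flow. -/
theorem strictMono_comp_gradient_trajectory {H : Type*} [NormedAddCommGroup H]
    [InnerProductSpace ℝ H] [CompleteSpace H] {u : H → ℝ} (hu : Differentiable ℝ u)
    (hnz : ∀ x, gradient u x ≠ 0) {γ : ℝ → H}
    (hγ : ∀ t, HasDerivAt γ (gradient u (γ t)) t) : StrictMono (fun t => u (γ t)) := by
  refine strictMono_of_hasDerivAt_pos
    (fun t => (hu (γ t)).hasFDerivAt.comp_hasDerivAt t (hγ t)) fun t => ?_
  rw [← inner_gradient_left]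
  exact real_inner_self_pos.2 (hnz _)

/-- Formula (2.37) from the proof of **Theorem 2.3**: with `τ(x)` the hitting time of the
equipotential `{u = 0}` along the gradient flow `X`, the function
`w(x) = ∫₀^{τ(x)} Δu(X(s,x)) ds` satisfies `∇w · ∇u = -Δu`, so that `σ := e^w` is a positive
`C¹` isotropic conductivity with `div(σ∇u) = σΔu + ∇σ·∇u = 0` everywhere. -/
theorem explicit_isotropic_conductivity (d : ℕ)
    (u : EuclideanSpace ℝ (Fin d) → ℝ) (hu : ContDiff ℝ 3 u)
    (hper : ∀ (x : EuclideanSpace ℝ (Fin d)) (k : Fin d → ℤ),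
      gradient u (x + (WithLp.equiv 2 (Fin d → ℝ)).symm (fun i => (k i : ℝ))) = gradient u x)
    (hnz : ∀ x, gradient u x ≠ 0)
    (X : ℝ × EuclideanSpace ℝ (Fin d) → EuclideanSpace ℝ (Fin d))
    (hX : ContDiff ℝ 1 X)
    (hX0 : ∀ x, X (0, x) = x)
    (hXt : ∀ t x, HasDerivAt (fun s => X (s, x)) (gradient u (X (t, x))) t)
    (hXsemigroup : ∀ s t x, X (s, X (t, x)) = X (s + t, x))
    (τ : EuclideanSpace ℝ (Fin d) → ℝ) (hτreg : ContDiff ℝ 1 τ)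
    (hτ : ∀ x, u (X (τ x, x)) = 0)
    (Δu : EuclideanSpace ℝ (Fin d) → ℝ)
    (hΔu : ∀ x, Δu x = LinearMap.trace ℝ (EuclideanSpace ℝ (Fin d))
      (fderiv ℝ (gradient u) x : EuclideanSpace ℝ (Fin d) →ₗ[ℝ] EuclideanSpace ℝ (Fin d)))
    (w : EuclideanSpace ℝ (Fin d) → ℝ)
    (hw : ∀ x, w x = ∫ s in (0:ℝ)..(τ x), Δu (X (s, x))) :
    (∀ x, ⟪gradient w x, gradient u x⟫ = -Δu x) ∧
    ContDiff ℝ 1 (fun x => Real.exp (w x)) ∧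
    (∀ x, 0 < Real.exp (w x)) ∧
    (∀ x, Real.exp (w x) * Δu x
      + ⟪gradient (fun y => Real.exp (w y)) x, gradient u x⟫ = 0) := by
  have hΔ : ContDiff ℝ 1 Δu := by
    rw [funext hΔu]
    have hg : ContDiff ℝ 2 (gradient u) := hu.gradient (by norm_num)
    exact hg.trace_fderiv (by norm_num)
  have hwC : ContDiff ℝ 1 w := by
    rw [funext hw]
    exact contDiff_one_parametric_primitive (F := fun x s => Δu (X (s, x)))
      (hΔ.comp (hX.comp (contDiff_snd.prodMk contDiff_fst))) hτreg
  have hτX : ∀ h x, τ (X (h, x)) = τ x - h := by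
    intro h x
    have hinj := (strictMono_comp_gradient_trajectory (hu.differentiable (by norm_num)) hnz
      (fun t => hXt t x)).injective
    have heq : τ (X (h, x)) + h = τ x := hinj (by
      simp only
      rw [← hXsemigroup, hτ, hτ])
    linarith
  have hwX : ∀ h x, w (X (h, x)) = ∫ s in h..τ x, Δu (X (s, x)) := by
    intro h x
    simp only [hw, hXsemigroup, hτX]
    rw [intervalIntegral.integral_comp_add_right (fun s => Δu (X (s, x)))]
    simp
  have hmain : ∀ x, ⟪gradient w x, gradient u x⟫ = -Δu x := by
    intro x
    have hcont : Continuous (fun s => Δu (X (s, x))) :=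
      hΔ.continuous.comp (hX.continuous.comp (Continuous.prodMk_left x))
    have h1 : HasDerivAt (fun h => w (X (h, x))) (-Δu x) 0 := by
      simp only [hwX]
      simpa only [hX0] using intervalIntegral.integral_hasDerivAt_left
        (hcont.intervalIntegrable 0 (τ x)) (hcont.stronglyMeasurableAtFilter _ _) hcont.continuousAt
    have h2 := (hwC.differentiable one_ne_zero (X (0, x))).hasFDerivAt.comp_hasDerivAt 0 (hXt 0 x)
    rw [inner_gradient_left]
    simpa only [hX0] using h2.unique h1
  refine ⟨hmain, hwC.exp, fun x => Real.exp_pos _, fun x => ?_⟩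
  have he := (hwC.differentiable one_ne_zero x).hasFDerivAt.exp
  rw [inner_gradient_left, he.fderiv]
  have hx := hmain x
  rw [inner_gradient_left] at hx
  simp [hx]
end
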